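/- For every ε > 0 there exists β₀ > 0 such that for every β ≥ β₀ the following holds for the Discrete Gaussian model on Λ_L = {1,…,L}² with zero boundary conditions at inverse-temperature β, conditioned on the floor event {η_x ≥ 0 for all x}. There is a sequence of positive integers H = H(L) satisfying H(L)/√((1/(4πβ)) · log L · log log L) → 1 as L → ∞, such that ϖ_{Λ_L}(#{v ∈ Λ_L : η_v ∈ {H(L), H(L)+1}} ≥ (1−ε)L²) → 1 as L → ∞. -/

import Mathlib

open Filter Topology Classical

noncomputable section

abbrev Site : Type := ℤ × ℤ

/-- Nearest-neighbor adjacency in `ℤ²`. -/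
def adjP (x y : Site) : Prop := |x.1 - y.1| + |x.2 - y.2| = 1

/-- The Discrete Gaussian Hamiltonian `H(η) = ∑_{x∼y} (η_x - η_y)²`, the sum running over
unordered nearest-neighbor pairs (each ordered pair is counted once, whence the factor 1/2). -/
def dgH (η : Site → ℤ) : ℝ :=
  (1 / 2) * ∑' p : Site × Site, if adjP p.1 p.2 then ((η p.1 - η p.2 : ℤ) : ℝ) ^ 2 else 0

/-- Unnormalized weight of the event `A` for the DG model on `Λ` with zero boundary conditions. -/
def dgW (β : ℝ) (Λ : Finset Site) (A : (Site → ℤ) → Prop) : ℝ :=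
  ∑' η : Site → ℤ, if (∀ x ∉ Λ, η x = 0) ∧ A η then Real.exp (-β * dgH η) else 0

/-- `π_Λ(A)`: probability of the event `A` under the DG measure on `Λ`. -/
def dgProb (β : ℝ) (Λ : Finset Site) (A : (Site → ℤ) → Prop) : ℝ :=
  dgW β Λ A / dgW β Λ (fun _ => True)

/-- `ϖ_Λ(A)`: DG measure conditioned on the floor event `η ≥ 0`. -/
def dgProbFloor (β : ℝ) (Λ : Finset Site) (A : (Site → ℤ) → Prop) : ℝ :=
  dgW β Λ (fun η => A η ∧ ∀ x, 0 ≤ η x) / dgW β Λ (fun η => ∀ x, 0 ≤ η x)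

/-- The box `Λ_L = {1,…,L}²`. -/
def box (L : ℕ) : Finset Site := Finset.Icc (1 : ℤ) (L : ℤ) ×ˢ Finset.Icc (1 : ℤ) (L : ℤ)

/-- The lattice ball `B_r = {x ∈ ℤ² : |x| ≤ r}`. -/
def ball (r : ℝ) : Finset Site :=
  ((Finset.Icc (-⌈r⌉) ⌈r⌉) ×ˢ (Finset.Icc (-⌈r⌉) ⌈r⌉)).filter
    fun x => ((x.1 : ℝ) ^ 2 + (x.2 : ℝ) ^ 2 ≤ r ^ 2)

open Real (exp log exp_pos exp_add exp_le_exp exp_nat_mul add_one_le_exp arctan exp_log pi_gt_three pi_pos log_le_log log_nonneg)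
open Finset (range sum_congr sum_le_sum sum_add_distrib mul_sum card_le_card card_union_le sum_product sum_image sum_const sum_boole sum_range_succ sum_eq_zero exists_ne_zero_of_sum_ne_zero sum_comm single_le_sum sum_nonneg mem_product mem_biUnion sum_insert sum_eq_single_of_mem prod_const mem_image_of_mem)
open ENNReal (ofReal tsum_le_tsum ofReal_mul ofReal_le_ofReal ofReal_add ofReal_ofNat mul_ne_top)
open scoped ENNReal
set_option linter.unusedSimpArgs false
set_option linter.unusedVariables false

abbrev Edge : Type := Site × Bool
def nb (e : Edge) : Site := if e.2 then (e.1.1, e.1.2 + 1) else (e.1.1 + 1, e.1.2)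
def gr (η : Site → ℤ) (e : Edge) : ℤ := η (nb e) - η e.1
def FS (η : Site → ℤ) : Prop := (Function.support η).Finite
def GF (η : Site → ℤ) : Prop := (Function.support (gr η)).Finite
def E1 (η : Site → ℤ) : ℕ := ∑ᶠ e, (gr η e).natAbs ^ 2
def Sp (D : Finset Site) (η : Site → ℤ) : Prop := ∀ x ∉ D, η x = 0

lemma nb_inj (b : Bool) : Function.Injective (fun x : Site => nb (x, b)) := by
  intro x y h
  cases b <;> simpa [nb, Prod.ext_iff] using h

lemma Sp.fs {D η} (h : Sp D η) : FS η :=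
  (D.finite_toSet).subset fun x hx => by
    by_contra hn; exact hx (h x hn)

lemma FS.gf {η} (h : FS η) : GF η := by
  have h1 : ((fun e : Edge => e.1) ⁻¹' Function.support η).Finite := by
    have : ((fun e : Edge => e.1) ⁻¹' Function.support η) = Function.support η ×ˢ Set.univ := by
      ext ⟨a, b⟩; simp
    rw [this]; exact h.prod Set.finite_univ
  have h2 : ((fun e : Edge => nb e) ⁻¹' Function.support η).Finite := by
    have : ((fun e : Edge => nb e) ⁻¹' Function.support η) ⊆
      ((fun x => (x, true)) '' ((fun x : Site => nb (x, true)) ⁻¹' Function.support η)) ∪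
      ((fun x => (x, false)) '' ((fun x : Site => nb (x, false)) ⁻¹' Function.support η)) := by
      rintro ⟨a, b⟩ hb
      cases b
      · right; exact ⟨a, hb, rfl⟩
      · left; exact ⟨a, hb, rfl⟩
    refine Set.Finite.subset (Set.Finite.union ?_ ?_) this
    · exact (h.preimage (nb_inj true).injOn).image _
    · exact (h.preimage (nb_inj false).injOn).image _
  refine (h1.union h2).subset fun e he => ?_
  by_contra hn
  simp only [Set.mem_union, Set.mem_preimage, Function.mem_support, not_or, not_not] at hn
  exact he (by simp [gr, hn.1, hn.2])

def GF.fs {η} (h : GF η) : Finset Edge := Set.Finite.toFinset h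
lemma GF.mem {η} (h : GF η) {e} : e ∈ h.fs ↔ gr η e ≠ 0 := Set.Finite.mem_toFinset h

lemma GF.sq {η} (h : GF η) : (Function.support fun e => (gr η e).natAbs ^ 2).Finite :=
  h.subset fun e he hn => he (by simp [hn])

lemma E1_eq {η} {s : Finset Edge} (hs : ∀ e, gr η e ≠ 0 → e ∈ s) :
    E1 η = ∑ e ∈ s, (gr η e).natAbs ^ 2 :=
  finsum_eq_sum_of_support_subset _ fun e he => hs e fun hn => he (by simp [hn])

lemma E1_ge {η} (h : GF η) (s : Finset Edge) : ∑ e ∈ s, (gr η e).natAbs ^ 2 ≤ E1 η := by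
  rw [E1_eq (s := s ∪ h.fs) (by intro e he; simp [h.mem, he])]
  exact Finset.sum_le_sum_of_subset Finset.subset_union_left

lemma gr_add (a b : Site → ℤ) (e) : gr (a + b) e = gr a e + gr b e := by simp [gr]; ring
lemma gr_sub (a b : Site → ℤ) (e) : gr (a - b) e = gr a e - gr b e := by simp [gr]; ring
lemma gr_neg (a : Site → ℤ) (e) : gr (-a) e = - gr a e := by simp [gr]; ring
lemma gr_zero (e) : gr 0 e = 0 := by simp [gr]
lemma gr_const (a : Site → ℤ) (k : ℤ) (e) : gr (fun x => a x + k) e = gr a e := by simp [gr]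
lemma FS.add {a b} (ha : FS a) (hb : FS b) : FS (a + b) :=
  (ha.union hb).subset (Function.support_add a b)
lemma FS.neg {a} (ha : FS a) : FS (-a) := by unfold FS; rwa [Function.support_neg]
lemma FS.sub {a b} (ha : FS a) (hb : FS b) : FS (a - b) := by
  rw [sub_eq_add_neg]; exact ha.add hb.neg
lemma FS.zero : FS 0 := by simp [FS]
lemma E1_zero : E1 0 = 0 := by simp [E1, gr_zero]
lemma E1_neg (a) : E1 (-a) = E1 a := by simp [E1, gr_neg]

def shE (v : Site) : Site ≃ Site := Equiv.addRight v
lemma nb_sh (v x : Site) (b : Bool) : nb (x + v, b) = nb (x, b) + v := by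
  cases b <;> simp [nb, Prod.ext_iff] <;> ring
lemma E1_shift (a : Site → ℤ) (v : Site) : E1 (fun x => a (x + v)) = E1 a := by
  unfold E1
  rw [← finsum_comp_equiv (f := fun e => (gr a e).natAbs ^ 2)
    (Equiv.prodCongr (shE v) (Equiv.refl Bool))]
  refine finsum_congr fun ⟨x, b⟩ => ?_
  simp [gr, shE, nb_sh]

lemma dgH_eq {η} (h : FS η) : dgH η = E1 η := by
  let φ : Edge × Bool → Site × Site := fun p => if p.2 then (nb p.1, p.1.1) else (p.1.1, nb p.1)
  have hφ : Function.Injective φ := by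
    rintro ⟨⟨⟨a, b⟩, c⟩, d⟩ ⟨⟨⟨a', b'⟩, c'⟩, d'⟩ h
    cases c <;> cases d <;> cases c' <;> cases d' <;> simp [φ, nb] at h ⊢ <;> omega
  let F : Site × Site → ℝ := fun p => if adjP p.1 p.2 then ((η p.1 - η p.2 : ℤ) : ℝ) ^ 2 else 0
  have hs : Function.support F ⊆ Set.range φ := by
    rintro ⟨⟨a, b⟩, ⟨c, d⟩⟩ hp
    have hadj : adjP (a, b) (c, d) := by
      by_contra hn; exact hp (by simp [F, hn])
    simp only [adjP] at hadj
    have : (c = a + 1 ∧ d = b) ∨ (c = a ∧ d = b + 1) ∨ (a = c + 1 ∧ b = d) ∨ (a = c ∧ b = d + 1) := by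
      rcases abs_cases (a - c) with h1 | h1 <;> rcases abs_cases (b - d) with h2 | h2 <;> omega
    rcases this with ⟨rfl, rfl⟩ | ⟨rfl, rfl⟩ | ⟨rfl, rfl⟩ | ⟨rfl, rfl⟩
    · exact ⟨(((a, d), false), false), by simp [φ, nb]⟩
    · exact ⟨(((c, b), true), false), by simp [φ, nb]⟩
    · exact ⟨(((c, b), false), true), by simp [φ, nb]⟩
    · exact ⟨(((a, d), true), true), by simp [φ, nb]⟩
  have h1 : ∑' p, F p = ∑' p, F (φ p) := (hφ.tsum_eq hs).symm
  have h2 : ∀ p : Edge × Bool, F (φ p) = (((gr η p.1).natAbs ^ 2 : ℕ) : ℝ) := by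
    rintro ⟨⟨⟨a, b⟩, c⟩, d⟩
    have : ∀ z : ℤ, ((z.natAbs ^ 2 : ℕ) : ℝ) = (z : ℝ) ^ 2 := fun z => by
      push_cast; rw [Nat.cast_natAbs]; push_cast; exact sq_abs _
    rw [this]
    cases c <;> cases d <;> simp [φ, F, adjP, gr, nb]
    all_goals ring
  have hE : (E1 η : ℝ) = ∑ e ∈ h.gf.fs, (((gr η e).natAbs ^ 2 : ℕ) : ℝ) := by
    rw [E1_eq (s := h.gf.fs) (by intro e he; exact h.gf.mem.2 he)]; push_cast; rfl
  have h3 : ∑' p, F (φ p) = 2 * E1 η := by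
    rw [tsum_eq_sum (s := h.gf.fs ×ˢ Finset.univ)]
    · rw [sum_product, hE, mul_sum]
      refine sum_congr rfl fun e _ => ?_
      simp only [h2]; simp
    · intro p hp
      rw [h2]
      have : gr η p.1 = 0 := by
        by_contra hn; exact hp (by simp [h.gf.mem, hn])
      simp [this]
  unfold dgH
  change 1 / 2 * ∑' p, F p = _
  rw [h1, h3]; ring

def ray (b : Bool) (x : Site) (k : ℤ) : Site := if b then (x.1, x.2 + k) else (x.1 + k, x.2)
lemma nb_ray (b x k) : nb (ray b x k, b) = ray b x (k + 1) := by
  cases b <;> simp [nb, ray, Prod.ext_iff] <;> ring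
lemma ray_zero (b x) : ray b x 0 = x := by cases b <;> simp [ray]
lemma ray_inj (b x) : Function.Injective (ray b x) := by
  intro k l h; cases b <;> simpa [ray, Prod.ext_iff] using h

lemma FS.ray_far {c} (h : FS c) (b x) : ∃ N : ℕ, ∀ k : ℤ, (N : ℤ) ≤ |k| → c (ray b x k) = 0 := by
  have hf : ((ray b x) ⁻¹' Function.support c).Finite := h.preimage (ray_inj b x).injOn
  obtain ⟨N, hN⟩ := (hf.image (fun k : ℤ => k.natAbs)).bddAbove
  refine ⟨N + 1, fun k hk => ?_⟩
  by_contra hn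
  have := hN ⟨k, hn, rfl⟩
  simp only at this
  rw [Int.abs_eq_natAbs] at hk
  omega

lemma FS.exit {c} (h : FS c) (b x) (hx : c x ≠ 0) :
    ∃ k : ℕ, (∀ j : ℕ, j ≤ k → c (ray b x j) = c x) ∧ gr c (ray b x k, b) ≠ 0 := by
  obtain ⟨N, hN⟩ := h.ray_far b x
  have hex : ∃ k : ℕ, c (ray b x (k + 1 : ℕ)) ≠ c x :=
    ⟨N, by rw [hN _ (by rw [abs_of_nonneg (by positivity)]; push_cast; omega)]; exact hx.symm⟩
  refine ⟨Nat.find hex, fun j hj => ?_, ?_⟩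
  · rcases j with _ | j
    · simp [ray_zero]
    · by_contra hn
      exact Nat.find_min hex (by omega : j < Nat.find hex) hn
  · have h1 := Nat.find_spec hex
    have h2 : c (ray b x (Nat.find hex : ℕ)) = c x := by
      rcases hk : Nat.find hex with _ | j
      · simp [ray_zero]
      · by_contra hn
        exact Nat.find_min hex (by omega : j < Nat.find hex) hn
    simp only [gr, nb_ray, h2]
    rw [sub_ne_zero]; push_cast at h1; exact h1

lemma abs_le_sum_ray {c} (h : FS c) (b x) :
    ∃ s : Finset Edge, (∀ e ∈ s, e.2 = b ∧ ∃ k : ℕ, e.1 = ray b x k) ∧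
      (c x).natAbs ≤ ∑ e ∈ s, (gr c e).natAbs := by
  obtain ⟨N, hN⟩ := h.ray_far b x
  have key : ∀ n : ℕ, (c x).natAbs ≤ (c (ray b x n)).natAbs +
      ∑ k ∈ range n, (gr c (ray b x k, b)).natAbs := by
    intro n
    induction n with
    | zero => simp [ray_zero]
    | succ n ih =>
      rw [sum_range_succ]
      have : gr c (ray b x n, b) = c (ray b x ((n : ℤ) + 1)) - c (ray b x n) := by
        simp [gr, nb_ray]
      push_cast
      omega
  refine ⟨(range N).image (fun k : ℕ => (ray b x k, b)), ?_, ?_⟩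
  · intro e he
    simp only [Finset.mem_image] at he
    obtain ⟨k, _, rfl⟩ := he
    exact ⟨rfl, k, rfl⟩
  · rw [sum_image]
    · have := key N
      rw [hN N (by simp)] at this
      simpa using this
    · intro i _ j _ hij
      have := ray_inj b x (Prod.ext_iff.1 hij).1
      exact_mod_cast this

lemma natAbs_le_sq (z : ℤ) : z.natAbs ≤ z.natAbs ^ 2 := Nat.le_self_pow (by norm_num) _

lemma abs_le_E1 {c} (h : FS c) (x) : (c x).natAbs ≤ E1 c := by
  obtain ⟨s, -, hs⟩ := abs_le_sum_ray h false x
  exact hs.trans ((sum_le_sum fun e _ => natAbs_le_sq _).trans (E1_ge h.gf s))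

lemma int_const {α} (f : ℤ → α) (h : ∀ b, f (b + 1) = f b) (a b : ℤ) : f a = f b := by
  have : ∀ n : ℕ, ∀ a, f (a + n) = f a := by
    intro n; induction n with
    | zero => simp
    | succ n ih => intro a; push_cast; rw [← add_assoc, h, ih]
  rcases le_total a b with hab | hab
  · have := this (b - a).toNat a
    rw [Int.toNat_of_nonneg (by omega)] at this; rw [← this]; congr 1; ring
  · have := this (a - b).toNat b
    rw [Int.toNat_of_nonneg (by omega)] at this; rw [← this]; congr 1; ring

lemma exists_prim (g : Edge → ℤ) (hf : (Function.support g).Finite)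
    (hc : ∀ a b : ℤ, g ((a, b), false) + g ((a + 1, b), true) = g ((a, b), true) + g ((a, b + 1), false)) :
    ∃ c, FS c ∧ ∀ e, gr c e = g e := by
  obtain ⟨N, hN⟩ : ∃ N : ℕ, ∀ a b : ℤ, ∀ d, ((N : ℤ) ≤ |a| ∨ (N : ℤ) ≤ |b|) → g ((a, b), d) = 0 := by
    obtain ⟨N, hN⟩ := (hf.image (fun e : Edge => e.1.1.natAbs + e.1.2.natAbs)).bddAbove
    refine ⟨N + 1, fun a b d h => ?_⟩
    by_contra hn
    have := hN ⟨((a, b), d), hn, rfl⟩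
    simp only [Int.abs_eq_natAbs] at this h
    omega
  let c : Site → ℤ := fun x => ∑ k ∈ range (x.1 + N).toNat, g ((k - N, x.2), false)
  have hh : ∀ a b, c (a + 1, b) - c (a, b) = g ((a, b), false) := by
    intro a b
    by_cases h : -(N : ℤ) ≤ a
    · obtain ⟨n, rfl⟩ : ∃ n : ℕ, a = n - N := ⟨(a + N).toNat, by omega⟩
      have e1 : ((n : ℤ) - N + 1 + N).toNat = n + 1 := by omega
      have e2 : ((n : ℤ) - N + N).toNat = n := by omega
      simp only [c, e1, e2, sum_range_succ]; ring
    · have e1 : (a + 1 + N).toNat = 0 := by omega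
      have e2 : (a + N).toNat = 0 := by omega
      simp only [c, e1, e2]
      rw [hN a b false (Or.inl (by rw [abs_of_neg (by omega)]; omega))]; simp
  have hv : ∀ a b, c (a, b + 1) - c (a, b) = g ((a, b), true) := by
    intro a b
    by_cases h : -(N : ℤ) ≤ a
    · obtain ⟨n, rfl⟩ : ∃ n : ℕ, a = n - N := ⟨(a + N).toNat, by omega⟩
      have e2 : ((n : ℤ) - N + N).toNat = n := by omega
      simp only [c, e2, ← Finset.sum_sub_distrib]
      have : ∀ k ∈ range n, g (((k : ℤ) - N, b + 1), false) - g (((k : ℤ) - N, b), false) =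
          (fun k : ℕ => g (((k : ℤ) - N, b), true)) (k + 1) - (fun k : ℕ => g (((k : ℤ) - N, b), true)) k := by
        intro k _
        have := hc (k - N) b
        simp only
        have e3 : (((k + 1 : ℕ) : ℤ) - N) = k - N + 1 := by push_cast; ring
        rw [e3]; linarith
      rw [sum_congr rfl this, Finset.sum_range_sub (fun k : ℕ => g (((k : ℤ) - N, b), true))]
      rw [hN (((0 : ℕ) : ℤ) - N) b true (Or.inl (by simp))]; simp
    · have e2 : (a + N).toNat = 0 := by omega
      simp only [c, e2]
      rw [hN a b true (Or.inl (by rw [abs_of_neg (by omega)]; omega))]; simp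
  refine ⟨c, ?_, ?_⟩
  · have hsub : Function.support c ⊆ (Finset.Icc (-(N : ℤ)) N ×ˢ Finset.Icc (-(N : ℤ)) N : Finset Site) := by
      rintro ⟨a, b⟩ hab
      by_contra hn
      apply hab
      simp only [Finset.coe_product, Finset.coe_Icc, Set.mem_prod, Set.mem_Icc, not_and_or, not_le] at hn
      have hrow : ∀ a b : ℤ, (N : ℤ) ≤ |b| → c (a, b) = 0 := fun a b h =>
        sum_eq_zero fun k _ => hN _ _ _ (Or.inr h)
      rcases hn with (h | h) | h | h
      · have e2 : (a + N).toNat = 0 := by omega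
        simp [c, e2]
      · have := int_const (fun b => c (a, b)) (fun b => by
          have := hv a b
          rw [hN a b true (Or.inl (by rw [abs_of_pos (by omega)]; omega))] at this
          linarith) b N
        rw [this]; exact hrow _ _ (by simp)
      · exact hrow _ _ (by rw [abs_of_neg (by omega)]; omega)
      · exact hrow _ _ (by rw [abs_of_pos (by omega)]; omega)
    exact (Finset.finite_toSet _).subset hsub
  · rintro ⟨⟨a, b⟩, d⟩
    cases d
    · simpa [gr, nb] using hh a b
    · simpa [gr, nb] using hv a b

abbrev Fld : Type := (Site → ℤ) × (Site → ℤ)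
def gp (ω : Fld) (e : Edge) : ℤ × ℤ := (gr ω.1 e, gr ω.2 e)
def FP (ω : Fld) : Prop := FS ω.1 ∧ FS ω.2
def En (ω : Fld) : ℕ := E1 ω.1 + E1 ω.2
def pl (x : Site) : Finset Edge :=
  {(x, false), (x, true), ((x.1 + 1, x.2), true), ((x.1, x.2 + 1), false)}
def Nb (e f : Edge) : Prop := ∃ x, e ∈ pl x ∧ f ∈ pl x
def nbs (e : Edge) : Finset Edge :=
  pl e.1 ∪ pl (if e.2 then (e.1.1 - 1, e.1.2) else (e.1.1, e.1.2 - 1))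

lemma Nb.symm {e f} (h : Nb e f) : Nb f e := by obtain ⟨x, a, b⟩ := h; exact ⟨x, b, a⟩
lemma Nb.refl (e) : Nb e e := by
  obtain ⟨x, b⟩ := e
  exact ⟨x, by cases b <;> simp [pl], by cases b <;> simp [pl]⟩
lemma Nb.mem {e f} (h : Nb e f) : f ∈ nbs e := by
  obtain ⟨x, a, b⟩ := h
  simp only [nbs, Finset.mem_union]
  simp only [pl, Finset.mem_insert, Finset.mem_singleton] at a
  rcases a with rfl | rfl | rfl | rfl
  · left; exact b
  · left; exact b
  · right; simpa using b
  · right; simpa using b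
lemma nbs_card (e) : (nbs e).card ≤ 8 :=
  (card_union_le _ _).trans (by
    have : ∀ x, (pl x).card ≤ 4 := fun x => Finset.card_le_four
    have := this e.1; have := ‹∀ x, (pl x).card ≤ 4› (if e.2 then (e.1.1 - 1, e.1.2) else (e.1.1, e.1.2 - 1))
    omega)
lemma Nb.coord {e f} (h : Nb e f) : |e.1.1 - f.1.1| ≤ 1 ∧ |e.1.2 - f.1.2| ≤ 1 := by
  obtain ⟨x, a, b⟩ := h
  simp only [pl, Finset.mem_insert, Finset.mem_singleton] at a b
  rcases a with rfl | rfl | rfl | rfl <;> rcases b with rfl | rfl | rfl | rfl <;> simp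

lemma gp_add (a b : Fld) (e) : gp (a + b) e = gp a e + gp b e := by simp [gp, gr_add]
lemma gp_sub (a b : Fld) (e) : gp (a - b) e = gp a e - gp b e := by simp [gp, gr_sub]
lemma gp_zero (e) : gp 0 e = 0 := by simp [gp, gr_zero]
lemma gp_sum (S : Finset Fld) (e) : gp (∑ c ∈ S, c) e = ∑ c ∈ S, gp c e := by
  induction S using Finset.induction_on with
  | empty => simp [gp_zero]
  | insert a s ha ih => rw [sum_insert ha, sum_insert ha, gp_add, ih]
lemma FP.add {a b} (ha : FP a) (hb : FP b) : FP (a + b) := ⟨ha.1.add hb.1, ha.2.add hb.2⟩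
lemma FP.sub {a b} (ha : FP a) (hb : FP b) : FP (a - b) := ⟨ha.1.sub hb.1, ha.2.sub hb.2⟩
lemma FP.zero : FP 0 := ⟨FS.zero, FS.zero⟩
lemma FP.sum {S : Finset Fld} (h : ∀ c ∈ S, FP c) : FP (∑ c ∈ S, c) := by
  induction S using Finset.induction_on with
  | empty => simpa using FP.zero
  | insert a s ha ih =>
    rw [sum_insert ha]
    exact (h a (by simp)).add (ih fun c hc => h c (by simp [hc]))
def FP.gs {ω} (h : FP ω) : Finset Edge := h.1.gf.fs ∪ h.2.gf.fs
lemma FP.mem {ω} (h : FP ω) {e} : e ∈ h.gs ↔ gp ω e ≠ 0 := by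
  simp only [gs, Finset.mem_union, GF.mem, gp, ne_eq, Prod.mk_eq_zero]; tauto
def q (v : ℤ × ℤ) : ℕ := v.1.natAbs ^ 2 + v.2.natAbs ^ 2
lemma q_zero : q 0 = 0 := by simp [q]
lemma q_pos {v} (h : v ≠ 0) : 1 ≤ q v := by
  rcases v with ⟨a, b⟩
  simp only [ne_eq, Prod.mk_eq_zero, not_and_or] at h
  rcases h with h | h
  · have : 1 ≤ a.natAbs := by omega
    simp only [q]; nlinarith [sq_nonneg b.natAbs]
  · have : 1 ≤ b.natAbs := by omega
    simp only [q]; nlinarith [sq_nonneg a.natAbs]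
lemma En_eq {ω} (s : Finset Edge) (hs : ∀ e, gp ω e ≠ 0 → e ∈ s) : En ω = ∑ e ∈ s, q (gp ω e) := by
  unfold En q
  rw [sum_add_distrib, E1_eq (s := s) fun e he => hs e (by simp [gp, he]),
    E1_eq (s := s) fun e he => hs e (by simp [gp, he])]; rfl
lemma En_ge {ω} (h : FP ω) (s : Finset Edge) : ∑ e ∈ s, q (gp ω e) ≤ En ω := by
  unfold q; rw [sum_add_distrib]; exact add_le_add (E1_ge h.1.gf s) (E1_ge h.2.gf s)
lemma card_le_En {ω} (h : FP ω) (s : Finset Edge) (hs : ∀ e ∈ s, gp ω e ≠ 0) : s.card ≤ En ω := by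
  refine le_trans ?_ (En_ge h s)
  rw [Finset.card_eq_sum_ones]; exact sum_le_sum fun e he => q_pos (hs e he)

lemma fs_eq_zero {c} (h : FS c) (hg : ∀ e, gr c e = 0) : c = 0 := by
  funext x
  have := abs_le_E1 h x
  rw [E1_eq (s := ∅) (by intro e he; exact absurd (hg e) he)] at this
  simpa using this
lemma FP.ext_gp {a b} (ha : FP a) (hb : FP b) (h : ∀ e, gp a e = gp b e) : a = b := by
  have h1 := fs_eq_zero (ha.1.sub hb.1) fun e => by
    rw [gr_sub, sub_eq_zero]; exact (Prod.ext_iff.1 (h e)).1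
  have h2 := fs_eq_zero (ha.2.sub hb.2) fun e => by
    rw [gr_sub, sub_eq_zero]; exact (Prod.ext_iff.1 (h e)).2
  exact Prod.ext (sub_eq_zero.1 h1) (sub_eq_zero.1 h2)

def Rl (ω : Fld) (e f : Edge) : Prop := Nb e f ∧ gp ω f ≠ 0
def Compat (a b : Fld) : Prop := ∀ e f, gp a e ≠ 0 → gp b f ≠ 0 → ¬ Nb e f
def Conn (c : Fld) : Prop := FP c ∧ (∃ e, gp c e ≠ 0) ∧
  ∀ e f, gp c e ≠ 0 → gp c f ≠ 0 → Relation.ReflTransGen (Rl c) e f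
def IsCl (c ω : Fld) : Prop := Conn c ∧ Compat c (ω - c)

lemma Compat.symm {a b} (h : Compat a b) : Compat b a := fun e f he hf hn => h f e hf he hn.symm
lemma IsCl.gp_eq {c ω} (h : IsCl c ω) {e f} (he : gp c e ≠ 0) (hn : Nb e f) : gp ω f = gp c f := by
  by_contra hne
  refine h.2 e f he ?_ hn
  rw [gp_sub]; exact sub_ne_zero.2 hne
lemma IsCl.gp_self {c ω} (h : IsCl c ω) {e} (he : gp c e ≠ 0) : gp ω e = gp c e := h.gp_eq he (Nb.refl e)
lemma IsCl.iff {c ω} (h : IsCl c ω) {e} (he : gp c e ≠ 0) (f) :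
    gp c f ≠ 0 ↔ Relation.ReflTransGen (Rl ω) e f := by
  constructor
  · intro hf
    have := h.1.2.2 e f he hf
    exact Relation.ReflTransGen.mono (fun a b hab => ⟨hab.1, by rw [h.gp_self hab.2]; exact hab.2⟩) _ _ this
  · intro hr
    induction hr with
    | refl => exact he
    | tail _ hab ih => rw [← h.gp_eq ih hab.1]; exact hab.2
lemma IsCl.gp_or {c ω} (h : IsCl c ω) (e) : gp c e = 0 ∨ gp c e = gp ω e := by
  by_cases he : gp c e = 0
  · exact Or.inl he
  · exact Or.inr (h.gp_self he).symm
lemma IsCl.eq {c c' ω e} (h : IsCl c ω) (h' : IsCl c' ω) (he : gp c e ≠ 0) (he' : gp c' e ≠ 0) : c = c' := by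
  refine h.1.1.ext_gp h'.1.1 fun f => ?_
  have := (h.iff he f).trans (h'.iff he' f).symm
  by_cases hf : gp c f = 0
  · rw [hf]; by_contra hn; exact this.2 (fun h => hn h.symm) hf
  · rw [← h.gp_self hf, ← h'.gp_self (this.1 hf)]
lemma IsCl.compat {c c' ω} (h : IsCl c ω) (h' : IsCl c' ω) (hne : c ≠ c') : Compat c c' := by
  intro e f he hf hn
  apply hne
  refine h.eq h' (e := f) ?_ hf
  rw [← h.gp_eq he hn, h'.gp_self hf]; exact hf

lemma exists_cl {ω} (h : FP ω) {e} (he : gp ω e ≠ 0) : ∃ c, IsCl c ω ∧ gp c e ≠ 0 := by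
  let A : Set Edge := {f | Relation.ReflTransGen (Rl ω) e f}
  have hA : ∀ x f f', f ∈ pl x → f' ∈ pl x → f ∈ A → gp ω f' ≠ 0 → f' ∈ A := fun x f f' h1 h2 h3 h4 =>
    Relation.ReflTransGen.tail h3 ⟨⟨x, h1, h2⟩, h4⟩
  have key : ∀ η : Site → ℤ, FS η → (∀ f, gp ω f = 0 → gr η f = 0) →
      ∃ c, FS c ∧ ∀ f, gr c f = if f ∈ A then gr η f else 0 := by
    intro η hη h0
    refine exists_prim (fun f => if f ∈ A then gr η f else 0) ?_ ?_
    · exact hη.gf.subset fun f hf hn => hf (by simp [hn])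
    · intro a b
      have hcl : gr η ((a, b), false) + gr η ((a + 1, b), true) = gr η ((a, b), true) + gr η ((a, b + 1), false) := by
        simp [gr, nb]
      have m1 : ((a, b), false) ∈ pl (a, b) := by simp [pl]
      have m2 : ((a + 1, b), true) ∈ pl (a, b) := by simp [pl]
      have m3 : ((a, b), true) ∈ pl (a, b) := by simp [pl]
      have m4 : ((a, b + 1), false) ∈ pl (a, b) := by simp [pl]
      by_cases hex : ∃ f ∈ pl (a, b), f ∈ A
      · obtain ⟨f, hf, hfA⟩ := hex
        have hall : ∀ f' ∈ pl (a, b), (if f' ∈ A then gr η f' else 0) = gr η f' := by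
          intro f' hf'
          split_ifs with hh
          · rfl
          · by_contra hn
            exact hh (hA _ _ _ hf hf' hfA fun h => hn (h0 f' h).symm)
        simp only [hall _ m1, hall _ m2, hall _ m3, hall _ m4, hcl]
      · push Not at hex
        simp only [hex _ m1, hex _ m2, hex _ m3, hex _ m4, if_false]
  obtain ⟨c1, hc1, h1⟩ := key ω.1 h.1 fun f hf => (Prod.ext_iff.1 hf).1
  obtain ⟨c2, hc2, h2⟩ := key ω.2 h.2 fun f hf => (Prod.ext_iff.1 hf).2
  have hg : ∀ f, gp (c1, c2) f = if f ∈ A then gp ω f else 0 := by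
    intro f; simp only [gp, h1, h2]; split_ifs <;> rfl
  have heA : e ∈ A := Relation.ReflTransGen.refl
  have hne : ∀ f, gp (c1, c2) f ≠ 0 ↔ f ∈ A := by
    intro f; rw [hg]
    split_ifs with hf
    · simp only [hf, iff_true]
      rcases Relation.ReflTransGen.cases_tail hf with rfl | ⟨g, _, hg⟩
      · exact he
      · exact hg.2
    · simp [hf]
  have hchain : ∀ a b, a ∈ A → Relation.ReflTransGen (Rl ω) a b → Relation.ReflTransGen (Rl (c1, c2)) a b := by
    intro a b ha hab
    induction hab with
    | refl => exact Relation.ReflTransGen.refl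
    | tail h1 h2 ih => exact ih.tail ⟨h2.1, (hne _).2 (Relation.ReflTransGen.tail (ha.trans h1) h2)⟩
  have hsymm : ∀ a, a ∈ A → Relation.ReflTransGen (Rl ω) a e := by
    intro a ha
    induction ha with
    | refl => exact Relation.ReflTransGen.refl
    | tail h1 h2 ih =>
      refine Relation.ReflTransGen.head ⟨h2.1.symm, ?_⟩ ih
      rcases Relation.ReflTransGen.cases_tail h1 with rfl | ⟨g, _, hg⟩
      · exact he
      · exact hg.2
  refine ⟨(c1, c2), ⟨⟨⟨hc1, hc2⟩, ⟨e, (hne e).2 heA⟩, ?_⟩, ?_⟩, (hne e).2 heA⟩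
  · intro a b ha hb
    rw [hne] at ha hb
    exact hchain a b ha ((hsymm a ha).trans hb)
  · intro a b ha hb hn
    rw [hne] at ha
    rw [gp_sub, hg] at hb
    split_ifs at hb with hbA
    · simp at hb
    · rw [sub_zero] at hb
      exact hbA (Relation.ReflTransGen.tail ha ⟨hn, hb⟩)

lemma cl_finite {ω} (h : FP ω) : {c | IsCl c ω}.Finite := by
  refine ((Finset.finite_toSet h.gs).image
    (fun e => Classical.epsilon fun c => IsCl c ω ∧ gp c e ≠ 0)).subset ?_
  intro c hc
  obtain ⟨e, he⟩ := hc.1.2.1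
  refine ⟨e, h.mem.2 (by rw [hc.gp_self he]; exact he), ?_⟩
  have := Classical.epsilon_spec (p := fun c => IsCl c ω ∧ gp c e ≠ 0) ⟨c, hc, he⟩
  exact this.1.eq hc this.2 he

def ClF (ω : Fld) : Finset Fld := if h : {c | IsCl c ω}.Finite then h.toFinset else ∅
lemma mem_ClF {ω} (h : FP ω) {c} : c ∈ ClF ω ↔ IsCl c ω := by
  simp [ClF, cl_finite h]

lemma gp_ClF {ω} (h : FP ω) (e) : ∑ c ∈ ClF ω, gp c e = gp ω e := by
  by_cases he : gp ω e = 0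
  · rw [he]; refine sum_eq_zero fun c hc => ?_
    rcases ((mem_ClF h).1 hc).gp_or e with h1 | h1
    · exact h1
    · rw [h1, he]
  · obtain ⟨c, hc, hce⟩ := exists_cl h he
    rw [sum_eq_single_of_mem c ((mem_ClF h).2 hc), hc.gp_self hce]
    intro b hb hne
    by_contra hbe
    exact hne (((mem_ClF h).1 hb).eq hc hbe hce)

lemma sum_ClF {ω} (h : FP ω) : ∑ c ∈ ClF ω, c = ω := by
  refine (FP.sum fun c hc => ((mem_ClF h).1 hc).1.1).ext_gp h fun e => ?_
  rw [gp_sum, gp_ClF h]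

lemma ClF_sum {S : Finset Fld} (hS : ∀ c ∈ S, Conn c)
    (hc : ∀ c ∈ S, ∀ c' ∈ S, c ≠ c' → Compat c c') : ClF (∑ c ∈ S, c) = S := by
  have hF : FP (∑ c ∈ S, c) := FP.sum fun c h => (hS c h).1
  have h1 : ∀ c ∈ S, IsCl c (∑ c ∈ S, c) := by
    intro c h
    refine ⟨hS c h, fun e f he hf hn => ?_⟩
    have : (∑ c ∈ S, c) - c = ∑ c ∈ S.erase c, c := by rw [← Finset.add_sum_erase S _ h]; simp
    rw [this, gp_sum] at hf
    obtain ⟨c', h', hf'⟩ := exists_ne_zero_of_sum_ne_zero hf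
    rw [Finset.mem_erase] at h'
    exact hc c h c' h'.2 (Ne.symm h'.1) e f he hf' hn
  ext c
  rw [mem_ClF hF]
  refine ⟨fun h => ?_, h1 c⟩
  obtain ⟨e, he⟩ := h.1.2.1
  have h2 := h.gp_self he
  have h3 : gp (∑ c ∈ S, c) e ≠ 0 := by rw [h2]; exact he
  rw [gp_sum] at h3
  obtain ⟨c', h', hf'⟩ := exists_ne_zero_of_sum_ne_zero h3
  rw [h.eq (h1 c' h') he hf']; exact h'

lemma En_sum {S : Finset Fld} (hS : ∀ c ∈ S, Conn c)
    (hc : ∀ c ∈ S, ∀ c' ∈ S, c ≠ c' → Compat c c') : En (∑ c ∈ S, c) = ∑ c ∈ S, En c := by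
  have hF : FP (∑ c ∈ S, c) := FP.sum fun c h => (hS c h).1
  have h2 : ∀ c ∈ S, IsCl c (∑ c ∈ S, c) := fun c h => by rw [← mem_ClF hF, ClF_sum hS hc]; exact h
  have h3 : ∀ c ∈ S, En c = ∑ e ∈ hF.gs, q (gp c e) := fun c h =>
    En_eq _ fun e he => hF.mem.2 (by rw [(h2 c h).gp_self he]; exact he)
  rw [sum_congr rfl h3, sum_comm, En_eq hF.gs fun e he => hF.mem.2 he]
  refine sum_congr rfl fun e he => ?_
  obtain ⟨c, hc', hce⟩ := exists_cl hF (hF.mem.1 he)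
  have hcS : c ∈ S := by rw [← ClF_sum hS hc, mem_ClF hF]; exact hc'
  rw [hc'.gp_self hce, sum_eq_single_of_mem c hcS]
  intro b hb hne
  have : gp b e = 0 := by
    by_contra hbe
    exact hne ((h2 b hb).eq hc' hbe hce)
  rw [this, q_zero]

lemma En_ClF {ω} (h : FP ω) : ∑ c ∈ ClF ω, En c = En ω := by
  conv_rhs => rw [← sum_ClF h]
  rw [En_sum]
  · intro c hc; exact ((mem_ClF h).1 hc).1
  · intro c hc c' hc' hne; exact ((mem_ClF h).1 hc).compat ((mem_ClF h).1 hc') hne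

lemma ClF_erase {ω c} (h : FP ω) (hc : c ∈ ClF ω) : ClF (ω - c) = (ClF ω).erase c := by
  have : ω - c = ∑ c ∈ (ClF ω).erase c, c := by
    conv_lhs => rw [← sum_ClF h, ← Finset.add_sum_erase _ _ hc]
    simp
  rw [this, ClF_sum]
  · intro c hc; exact ((mem_ClF h).1 (Finset.mem_of_mem_erase hc)).1
  · intro c hc c' hc' hne
    exact ((mem_ClF h).1 (Finset.mem_of_mem_erase hc)).compat ((mem_ClF h).1 (Finset.mem_of_mem_erase hc')) hne

lemma En_sub {ω c} (h : FP ω) (hc : c ∈ ClF ω) : En (ω - c) + En c = En ω := by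
  have hF : FP (ω - c) := h.sub ((mem_ClF h).1 hc).1.1
  rw [← En_ClF hF, ClF_erase h hc, ← En_ClF h, Finset.sum_erase_add _ _ hc]

def swp (P : Fld → Prop) (c : Fld) : Fld := if P c then (c.2, c.1) else c
def act (P : Fld → Prop) (ω : Fld) : Fld := ∑ c ∈ ClF ω, swp P c
def SwInv (P : Fld → Prop) : Prop := ∀ c : Fld, P (c.2, c.1) ↔ P c

lemma swp_gp (P c e) : gp (swp P c) e ≠ 0 ↔ gp c e ≠ 0 := by
  unfold swp; split_ifs <;> simp [gp]; tauto
lemma swp_En (P c) : En (swp P c) = En c := by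
  unfold swp; split_ifs <;> simp [En]; ring
lemma swp_FP (P) {c} (h : FP c) : FP (swp P c) := by
  unfold swp; split_ifs; exacts [⟨h.2, h.1⟩, h]
lemma swp_swp {P} (hP : SwInv P) (c) : swp P (swp P c) = c := by
  unfold swp
  by_cases h : P c
  · simp [h, (hP c).2 h]
  · simp [h]
lemma swp_conn (P) {c} (h : Conn c) : Conn (swp P c) := by
  refine ⟨swp_FP P h.1, ?_, fun e f he hf => ?_⟩
  · obtain ⟨e, he⟩ := h.2.1; exact ⟨e, (swp_gp P c e).2 he⟩
  · exact Relation.ReflTransGen.mono (fun a b hab => ⟨hab.1, (swp_gp P c b).2 hab.2⟩) _ _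
      (h.2.2 e f ((swp_gp P c e).1 he) ((swp_gp P c f).1 hf))
lemma act_eq {P} (hP : SwInv P) {ω} : act P ω = ∑ c ∈ (ClF ω).image (swp P), c := by
  rw [sum_image]; rfl
  intro a _ b _ h; rw [← swp_swp hP a, h, swp_swp hP]
lemma ClF_act {P} (hP : SwInv P) {ω} (h : FP ω) : ClF (act P ω) = (ClF ω).image (swp P) ∧
    En (act P ω) = En ω := by
  have h1 : ∀ c ∈ (ClF ω).image (swp P), Conn c := by
    intro c hc
    obtain ⟨c, hc1, rfl⟩ := Finset.mem_image.1 hc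
    exact swp_conn P ((mem_ClF h).1 hc1).1
  have h2 : ∀ c ∈ (ClF ω).image (swp P), ∀ c' ∈ (ClF ω).image (swp P), c ≠ c' → Compat c c' := by
    intro c hc c' hc' hne
    obtain ⟨c, hc1, rfl⟩ := Finset.mem_image.1 hc
    obtain ⟨c', hc2, rfl⟩ := Finset.mem_image.1 hc'
    intro e f he hf
    rw [swp_gp] at he hf
    exact ((mem_ClF h).1 hc1).compat ((mem_ClF h).1 hc2) (fun h => hne (by rw [h])) e f he hf
  rw [act_eq hP]
  refine ⟨ClF_sum h1 h2, ?_⟩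
  rw [En_sum h1 h2, sum_image, ← En_ClF h]
  · exact sum_congr rfl fun c _ => swp_En P c
  · intro a _ b _ h; rw [← swp_swp hP a, h, swp_swp hP]
lemma act_act {P} (hP : SwInv P) {ω} (h : FP ω) : act P (act P ω) = ω := by
  unfold act
  rw [show (∑ c ∈ ClF ω, swp P c) = act P ω from rfl, (ClF_act hP h).1, sum_image]
  · simp only [swp_swp hP]; exact sum_ClF h
  · intro a _ b _ h; rw [← swp_swp hP a, h, swp_swp hP]
lemma sum_fst (S : Finset Fld) (f : Fld → Fld) (x) : (∑ c ∈ S, f c).1 x = ∑ c ∈ S, (f c).1 x := by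
  rw [Prod.fst_sum]; simp
lemma sum_snd (S : Finset Fld) (f : Fld → Fld) (x) : (∑ c ∈ S, f c).2 x = ∑ c ∈ S, (f c).2 x := by
  rw [Prod.snd_sum]; simp

def Ray (D : Finset Site) : Prop := ∀ x ∉ D, ∃ b : Bool,
  (∀ k : ℕ, ray b x k ∉ D) ∨ (∀ k : ℕ, ray b x (-k) ∉ D)
def SpP (D D' : Finset Site) (ω : Fld) : Prop := Sp D ω.1 ∧ Sp D' ω.2
lemma SpP.fp {D D' ω} (h : SpP D D' ω) : FP ω := ⟨h.1.fs, h.2.fs⟩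

lemma sp_of_gr {D} (hD : Ray D) {η c : Site → ℤ} (hη : Sp D η) (hc : FS c)
    (h : ∀ e, gr c e = 0 ∨ gr c e = gr η e) : Sp D c := by
  intro x hx
  obtain ⟨b, hb⟩ := hD x hx
  have hz : ∀ e : Edge, e.1 ∉ D → nb e ∉ D → gr c e = 0 := by
    intro e h1 h2
    rcases h e with h | h
    · exact h
    · rw [h, gr, hη _ h1, hη _ h2]; rfl
  obtain ⟨N, hN⟩ := hc.ray_far b x
  rcases hb with hb | hb
  · have : ∀ n : ℕ, c (ray b x n) = c x := by
      intro n; induction n with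
      | zero => simp [ray_zero]
      | succ n ih =>
        have := hz (ray b x n, b) (hb n) (by rw [nb_ray]; exact_mod_cast hb (n + 1))
        rw [gr, nb_ray] at this
        push_cast; simp only at this; omega
    rw [← this N]; exact hN _ (by simp)
  · have : ∀ n : ℕ, c (ray b x (-n)) = c x := by
      intro n; induction n with
      | zero => simp [ray_zero]
      | succ n ih =>
        have e : (-((n + 1 : ℕ) : ℤ)) + 1 = -n := by push_cast; ring
        have := hz (ray b x (-((n + 1 : ℕ) : ℤ)), b) (hb (n + 1)) (by rw [nb_ray, e]; exact hb n)
        rw [gr, nb_ray, e] at this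
        simp only at this; omega
    rw [← this N]; exact hN _ (by simp)

lemma IsCl.spP {D D' c ω} (hD : Ray D) (hD' : Ray D') (h : IsCl c ω) (hω : SpP D D' ω) : SpP D D' c :=
  ⟨sp_of_gr hD hω.1 h.1.1.1 fun e => (h.gp_or e).imp (fun h => (Prod.ext_iff.1 h).1) fun h => (Prod.ext_iff.1 h).1,
   sp_of_gr hD' hω.2 h.1.1.2 fun e => (h.gp_or e).imp (fun h => (Prod.ext_iff.1 h).2) fun h => (Prod.ext_iff.1 h).2⟩

lemma ray_empty : Ray ∅ := fun x _ => ⟨true, Or.inl fun k => by simp⟩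

lemma single_cl {ω c x} (h : FP ω) (hc : IsCl c ω) (hx : c.1 x ≠ 0) :
    ∃ c', IsCl c' (ω.1, 0) ∧ En c' ≤ En c ∧ c'.1 x ≠ 0 := by
  let a : Fld := (c.1, 0)
  let b : Fld := (ω.1 - c.1, 0)
  have ha : FP a := ⟨hc.1.1.1, FS.zero⟩
  have hb : FP b := ⟨h.1.sub hc.1.1.1, FS.zero⟩
  have hab : Compat a b := by
    intro e f he hf hn
    refine hc.2 e f ?_ ?_ hn
    · simp [a, gp, gr_zero] at he ⊢; tauto
    · simp [b, gp, gr_zero, gr_sub] at hf ⊢; tauto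
  have hsum : (ω.1, (0 : Site → ℤ)) = a + b := by simp [a, b]
  have h1 : ∃ c' ∈ ClF a, c'.1 x ≠ 0 := by
    have := sum_fst (ClF a) id x
    simp only [id] at this
    rw [sum_ClF ha] at this
    exact exists_ne_zero_of_sum_ne_zero (this ▸ hx)
  obtain ⟨c', hc', hx'⟩ := h1
  refine ⟨c', ⟨((mem_ClF ha).1 hc').1, ?_⟩, ?_, hx'⟩
  · rw [hsum]
    intro e f he hf hn
    rw [show a + b - c' = (a - c') + b by abel, gp_add] at hf
    by_cases h0 : gp (a - c') f = 0
    · rw [h0, zero_add] at hf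
      refine hab e f ?_ hf hn
      rw [((mem_ClF ha).1 hc').gp_self he]; exact he
    · exact ((mem_ClF ha).1 hc').2 e f he h0 hn
  · have h1 : En c' ≤ En a := by
      rw [← En_ClF ha]; exact single_le_sum (f := En) (fun _ _ => Nat.zero_le _) hc'
    have h2 : En a ≤ En c := by simp [En, a, E1_zero]
    omega

lemma summable_exp_abs {s : ℝ} (hs : 0 < s) : Summable fun a : ℤ => exp (-s * |(a : ℝ)|) := by
  have h : Summable fun n : ℕ => exp (-s * n) := by
    have := summable_geometric_of_lt_one (exp_pos (-s)).le (by rw [Real.exp_lt_one_iff]; linarith)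
    refine this.congr fun n => ?_
    rw [← exp_nat_mul]; congr 1; ring
  rw [summable_int_iff_summable_nat_and_neg]
  constructor <;> refine h.congr fun n => ?_ <;> simp

def kap (v : ℤ × ℤ) : ℝ := exp (-(q v : ℝ))
lemma kap_summable : Summable kap := by
  have h := summable_exp_abs one_pos
  have h2 := h.mul_of_nonneg h (fun _ => (exp_pos _).le) (fun _ => (exp_pos _).le)
  refine Summable.of_nonneg_of_le (fun _ => (exp_pos _).le) (fun v => ?_) h2
  rw [← exp_add, kap, exp_le_exp]
  have key : ∀ z : ℤ, |(z : ℝ)| ≤ ((z.natAbs ^ 2 : ℕ) : ℝ) := fun z => by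
    have := natAbs_le_sq z
    have h3 : (z.natAbs : ℝ) ≤ ((z.natAbs ^ 2 : ℕ) : ℝ) := by exact_mod_cast this
    rwa [Nat.cast_natAbs, Int.cast_abs] at h3
  have h1 := key v.1; have h2 := key v.2
  simp only [q]; push_cast at *; linarith

def zet : ℝ := ∑' v, kap v
lemma kap_zero : kap 0 = 1 := by simp [kap, q_zero]
lemma zet_ge : 1 ≤ zet := by
  rw [← kap_zero]; exact kap_summable.le_tsum 0 fun _ _ => (exp_pos _).le
def C0 : ℝ := 1 + 8 * log zet

lemma count_fin (e : Edge) (F : Finset Fld) (hF : ∀ c ∈ F, Conn c ∧ gp c e ≠ 0) :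
    ∑ c ∈ F, exp (-C0 * En c) ≤ 1 := by
  have hfp : ∀ c : F, FP c.1 := fun c => (hF c.1 c.2).1.1
  let A : F → Finset Edge := fun c => (hfp c).gs
  let N : F → Finset Edge := fun c => (A c).biUnion nbs
  let E : Finset Edge := Finset.univ.biUnion N
  let V : Finset (ℤ × ℤ) := insert 0 (Finset.univ.biUnion fun c : F => E.image (gp c.1))
  let ζ : ℝ := ∑ v ∈ V, kap v
  have hζ1 : 1 ≤ ζ := by
    rw [← kap_zero]
    exact single_le_sum (f := kap) (fun _ _ => (exp_pos _).le) (Finset.mem_insert_self _ _)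
  have hζ2 : ζ ≤ zet := kap_summable.sum_le_tsum V fun _ _ => (exp_pos _).le
  let T : F → E → Finset (ℤ × ℤ) := fun c f => if f.1 ∈ N c then {gp c.1 f.1} else V
  have hNE : ∀ c, N c ⊆ E := fun c f hf => mem_biUnion.2 ⟨c, Finset.mem_univ _, hf⟩
  have hsum : ∀ c : F, ∑ g ∈ Fintype.piFinset (T c), ∏ f, kap (g f) =
      exp (-(En c.1 : ℝ)) * ζ ^ (E.card - (N c).card) := by
    intro c
    rw [← Finset.prod_univ_sum (t := T c) (f := fun _ v => kap v)]
    have h1 : ∀ f : E, ∑ v ∈ T c f, kap v = if f.1 ∈ N c then kap (gp c.1 f.1) else ζ := by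
      intro f; simp only [T]; split_ifs <;> simp [ζ]
    rw [Finset.prod_congr rfl fun f _ => h1 f,
      Finset.prod_coe_sort E (fun f => if f ∈ N c then kap (gp c.1 f) else ζ), Finset.prod_ite,
      prod_const]
    have h2 : E.filter (fun f => f ∈ N c) = N c := by
      ext f; simp only [Finset.mem_filter]; exact ⟨fun h => h.2, fun h => ⟨hNE c h, h⟩⟩
    have h3 : (E.filter (fun f => f ∉ N c)).card = E.card - (N c).card := by
      rw [← Finset.card_sdiff_of_subset (hNE c)]; congr 1; ext f; simp
    rw [h2, h3]
    congr 1
    rw [En_eq (N c)]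
    · simp only [kap]; rw [← Real.exp_sum]; push_cast; rw [Finset.sum_neg_distrib]
    · intro f hf
      exact mem_biUnion.2 ⟨f, (hfp c).mem.2 hf, (Nb.refl f).mem⟩
  have hdisj : ∀ c c' : F, c ≠ c' → Disjoint (Fintype.piFinset (T c)) (Fintype.piFinset (T c')) := by
    intro c c' hne
    rw [Finset.disjoint_left]
    intro g hg hg'
    rw [Fintype.mem_piFinset] at hg hg'
    have hval : ∀ (c : F), (∀ a, g a ∈ T c a) → ∀ f (hf : f ∈ N c), g ⟨f, hNE c hf⟩ = gp c.1 f := by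
      intro c hg f hf
      have := hg ⟨f, hNE c hf⟩
      simpa [T, hf] using this
    have hsub : ∀ c c' : F, (∀ a, g a ∈ T c a) → (∀ a, g a ∈ T c' a) → ∀ f, gp c.1 f ≠ 0 →
        gp c.1 f = gp c'.1 f := by
      intro c c' hg hg' f hf
      have hch := (hF c.1 c.2).1.2.2 e f (hF c.1 c.2).2 hf
      have hnn : ∀ (c : F) a b, gp c.1 a ≠ 0 → Nb a b → b ∈ N c := fun c a b ha hab =>
        mem_biUnion.2 ⟨a, (hfp c).mem.2 ha, hab.mem⟩
      have : gp c'.1 f ≠ 0 := by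
        clear hf
        induction hch with
        | refl => exact (hF c'.1 c'.2).2
        | tail h1 h2 ih =>
          have m1 := hnn c _ _ h2.2 (Nb.refl _)
          have m2 := hnn c' _ _ ih h2.1
          rw [← hval c' hg' _ m2, hval c hg _ m1]; exact h2.2
      rw [← hval c hg f (hnn c _ _ hf (Nb.refl _)), hval c' hg' f (hnn c' _ _ this (Nb.refl _))]
    apply hne
    apply Subtype.ext
    refine (hfp c).ext_gp (hfp c') fun f => ?_
    by_cases h : gp c.1 f = 0
    · by_cases h' : gp c'.1 f = 0
      · rw [h, h']
      · exact (hsub c' c hg' hg f h').symm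
    · exact hsub c c' hg hg' f h
  have htot : ∑ c : F, ∑ g ∈ Fintype.piFinset (T c), ∏ f, kap (g f) ≤ ζ ^ E.card := by
    rw [← Finset.sum_biUnion fun c _ c' _ h => hdisj c c' h]
    have h0 : ζ ^ E.card = ∑ g ∈ Fintype.piFinset (fun _ : E => V), ∏ f, kap (g f) := by
      rw [← Finset.prod_univ_sum (t := fun _ : E => V) (f := fun _ v => kap v)]
      simp [ζ]
    rw [h0]
    refine Finset.sum_le_sum_of_subset_of_nonneg ?_ fun g _ _ => Finset.prod_nonneg fun _ _ => (exp_pos _).le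
    intro g hg
    obtain ⟨c, _, hg⟩ := mem_biUnion.1 hg
    rw [Fintype.mem_piFinset] at hg ⊢
    intro f
    have := hg f
    simp only [T] at this
    split_ifs at this
    · rw [Finset.mem_singleton.1 this]
      exact Finset.mem_insert_of_mem (mem_biUnion.2 ⟨c, Finset.mem_univ _, mem_image_of_mem _ f.2⟩)
    · exact this
  have hz : 0 < ζ ^ E.card := by positivity
  have hb : ∀ c : F, exp (-C0 * En c.1) * ζ ^ E.card ≤ exp (-(En c.1 : ℝ)) * ζ ^ (E.card - (N c).card) := by
    intro c
    have hN : (N c).card ≤ 8 * En c.1 := by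
      calc (N c).card ≤ ∑ f ∈ A c, (nbs f).card := Finset.card_biUnion_le
        _ ≤ ∑ f ∈ A c, 8 := sum_le_sum fun f _ => nbs_card f
        _ = 8 * (A c).card := by simp [mul_comm]
        _ ≤ _ := Nat.mul_le_mul_left _ (card_le_En (hfp c) _ fun f hf => (hfp c).mem.1 hf)
    have h1 : ζ ^ E.card = ζ ^ (N c).card * ζ ^ (E.card - (N c).card) := by
      rw [← pow_add, Nat.add_sub_cancel' (card_le_card (hNE c))]
    have h2 : ζ ^ (N c).card ≤ exp (8 * log zet * En c.1) := by
      calc ζ ^ (N c).card ≤ ζ ^ (8 * En c.1) := pow_le_pow_right₀ hζ1 hN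
        _ ≤ zet ^ (8 * En c.1) := pow_le_pow_left₀ (by linarith) hζ2 _
        _ = _ := by
          rw [show 8 * log zet * En c.1 = ((8 * En c.1 : ℕ) : ℝ) * log zet by push_cast; ring,
            exp_nat_mul, exp_log (by linarith [zet_ge])]
    rw [h1, ← mul_assoc]
    refine mul_le_mul_of_nonneg_right ?_ (by positivity)
    calc _ ≤ exp (-C0 * En c.1) * exp (8 * log zet * En c.1) := by gcongr
      _ = _ := by rw [← exp_add]; congr 1; simp only [C0]; ring
  rw [← Finset.sum_coe_sort]
  have := (sum_le_sum fun c (_ : c ∈ Finset.univ) => hb c).trans ((sum_congr rfl fun c _ => (hsum c).symm).le.trans htot)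
  rw [← Finset.sum_mul] at this
  exact le_of_mul_le_mul_right (by simpa using this) hz

def ex (t : ℝ) : ℝ≥0∞ := ofReal (exp t)
lemma ex_add (s t) : ex (s + t) = ex s * ex t := by
  rw [ex, exp_add, ofReal_mul (exp_pos _).le]; rfl
lemma ex_mono {s t} (h : s ≤ t) : ex s ≤ ex t := ofReal_le_ofReal (exp_le_exp.2 h)
lemma ex_ne_top (t) : ex t ≠ ⊤ := ENNReal.ofReal_ne_top
lemma ex_ne_zero (t) : ex t ≠ 0 := by simp [ex, exp_pos]
lemma ex_zero : ex 0 = 1 := by simp [ex]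

lemma count_edge (e : Edge) : ∑' c : Fld, (if Conn c ∧ gp c e ≠ 0 then ex (-C0 * En c) else 0) ≤ 1 := by
  rw [ENNReal.tsum_eq_iSup_sum]
  refine iSup_le fun F => ?_
  rw [← Finset.sum_filter]
  have := count_fin e (F.filter fun c => Conn c ∧ gp c e ≠ 0) fun c hc => (Finset.mem_filter.1 hc).2
  simp only [ex]
  rw [← ENNReal.ofReal_sum_of_nonneg fun _ _ => (exp_pos _).le]
  exact ENNReal.ofReal_le_one.2 this

def tch (c : Fld) (x : Site) : Prop := c.1 x ≠ 0 ∨ c.2 x ≠ 0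
lemma exit_cl {c : Fld} (h : FP c) {x} (hx : tch c x) (b : Bool) :
    ∃ k : ℕ, gp c (ray b x k, b) ≠ 0 ∧ ∀ j : ℕ, j ≤ k → tch c (ray b x j) := by
  rcases hx with hx | hx
  · obtain ⟨k, h1, h2⟩ := h.1.exit b x hx
    exact ⟨k, fun h => h2 (Prod.ext_iff.1 h).1, fun j hj => Or.inl (by rw [h1 j hj]; exact hx)⟩
  · obtain ⟨k, h1, h2⟩ := h.2.exit b x hx
    exact ⟨k, fun h => h2 (Prod.ext_iff.1 h).2, fun j hj => Or.inr (by rw [h1 j hj]; exact hx)⟩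

lemma card_rows_le {c : Fld} (h : FP c) (b : Bool) (S : Finset ℤ)
    (hS : ∀ r ∈ S, ∃ x, tch c x ∧ (if b then x.1 else x.2) = r) : S.card ≤ En c := by
  choose! f hf hr using hS
  choose! k hk using fun r hr => (exit_cl h (hf r hr) b)
  rw [← Finset.card_image_of_injOn (f := fun r => (ray b (f r) (k r), b)) (s := S)]
  · refine card_le_En h _ fun e he => ?_
    obtain ⟨r, hr, rfl⟩ := Finset.mem_image.1 he
    exact (hk r hr).1
  · intro r h1 r' h2 heq
    have h3 := (Prod.ext_iff.1 heq).1
    rw [← hr r h1, ← hr r' h2]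
    cases b
    · simpa [ray] using (Prod.ext_iff.1 h3).2
    · simpa [ray] using (Prod.ext_iff.1 h3).1

def C1 : ℝ := C0 + 1
lemma C0_ge : 1 ≤ C0 := by have := log_nonneg zet_ge; simp only [C0]; linarith
lemma count_site (x : Site) : ∑' c : Fld, (if Conn c ∧ tch c x then ex (-C1 * En c) else 0) ≤ 1 := by
  have h1 : ∀ c : Fld, (if Conn c ∧ tch c x then ex (-C1 * En c) else 0) ≤
      ∑' k : ℕ, ex (-((k : ℝ) + 1)) * (if Conn c ∧ gp c (ray true x k, true) ≠ 0 then ex (-C0 * En c) else 0) := by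
    intro c
    split_ifs with h
    · obtain ⟨k, hk, hj⟩ := exit_cl h.1.1 h.2 true
      refine le_trans ?_ (ENNReal.le_tsum k)
      rw [if_pos ⟨h.1, hk⟩, ← ex_add]
      apply ex_mono
      have : k + 1 ≤ En c := by
        have := card_rows_le h.1.1 false ((range (k + 1)).image fun j : ℕ => x.2 + j) (by
          intro r hr
          obtain ⟨j, hj', rfl⟩ := Finset.mem_image.1 hr
          exact ⟨_, hj j (by simp at hj'; omega), by simp [ray]⟩)
        rwa [Finset.card_image_of_injective _ (fun a b h => by simpa using h), Finset.card_range] at this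
      have h3 : (k : ℝ) + 1 ≤ En c := by exact_mod_cast this
      simp only [C1]; nlinarith
    · exact zero_le
  refine (tsum_le_tsum h1).trans ?_
  rw [ENNReal.tsum_comm]
  have h2 : ∀ k : ℕ, ∑' c : Fld, ex (-((k : ℝ) + 1)) * (if Conn c ∧ gp c (ray true x k, true) ≠ 0 then ex (-C0 * En c) else 0)
      ≤ ofReal ((1 / 2) / 2 ^ k) := by
    intro k
    rw [ENNReal.tsum_mul_left]
    refine (mul_le_mul_right (count_edge _) _).trans ?_
    rw [mul_one]
    refine ofReal_le_ofReal ?_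
    rw [Real.exp_neg, inv_le_comm₀ (exp_pos _) (by positivity)]
    have h2 : (2 : ℝ) ≤ exp 1 := by linarith [add_one_le_exp (1 : ℝ)]
    calc ((1 : ℝ) / 2 / 2 ^ k)⁻¹ = 2 ^ (k + 1) := by field_simp; ring
      _ ≤ exp 1 ^ (k + 1) := by gcongr
      _ = _ := by rw [← exp_nat_mul]; simp
  refine (tsum_le_tsum h2).trans ?_
  rw [← ENNReal.ofReal_tsum_of_nonneg (fun _ => by positivity) (summable_geometric_two' _)]
  rw [tsum_geometric_two']; simp

lemma tsum_inj {X Y : Type*} (F : X → ℝ≥0∞) (G : Y → ℝ≥0∞) (φ : X → Y)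
    (hinj : ∀ a b, F a ≠ 0 → F b ≠ 0 → φ a = φ b → a = b) (h : ∀ a, F a ≠ 0 → F a ≤ G (φ a)) :
    ∑' a, F a ≤ ∑' b, G b := by
  rw [← tsum_subtype_support F]
  calc ∑' a : Function.support F, F a ≤ ∑' a : Function.support F, G (φ a) :=
        tsum_le_tsum fun a => h a.1 a.2
    _ ≤ _ := ENNReal.tsum_comp_le_tsum_of_injective
        (f := fun a : Function.support F => φ a) (fun a b hab => Subtype.ext (hinj _ _ a.2 b.2 hab)) G

def wD (β : ℝ) (D : Finset Site) (η : Site → ℤ) : ℝ≥0∞ := if Sp D η then ex (-β * E1 η) else 0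
def Z (β : ℝ) (D : Finset Site) : ℝ≥0∞ := ∑' η, wD β D η
def wP (β : ℝ) (D D' : Finset Site) (ω : Fld) : ℝ≥0∞ := wD β D ω.1 * wD β D' ω.2
lemma wP_eq (β D D' ω) : wP β D D' ω = if SpP D D' ω then ex (-β * En ω) else 0 := by
  unfold wP wD SpP
  by_cases h1 : Sp D ω.1 <;> by_cases h2 : Sp D' ω.2 <;> simp [h1, h2]
  rw [← ex_add]; congr 1; simp [En]; ring
lemma wP_sp {β D D' ω} (h : wP β D D' ω ≠ 0) : SpP D D' ω := by
  by_contra hn; rw [wP_eq, if_neg hn] at h; exact h rfl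
lemma wD_sp {β D η} (h : wD β D η ≠ 0) : Sp D η := by
  by_contra hn; rw [wD, if_neg hn] at h; exact h rfl
lemma ZP_eq (β D D') (f g : (Site → ℤ) → ℝ≥0∞) :
    ∑' ω : Fld, wP β D D' ω * (f ω.1 * g ω.2) = (∑' η, wD β D η * f η) * ∑' η, wD β D' η * g η := by
  rw [ENNReal.tsum_prod (f := fun a b => wP β D D' (a, b) * (f a * g b)), ← ENNReal.tsum_mul_right]
  refine tsum_congr fun a => ?_
  rw [← ENNReal.tsum_mul_left]
  refine tsum_congr fun b => ?_
  simp only [wP]; ring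
def ZP (β : ℝ) (D D' : Finset Site) : ℝ≥0∞ := ∑' ω, wP β D D' ω
lemma ZP_mul (β D D') : ZP β D D' = Z β D * Z β D' := by
  have := ZP_eq β D D' (fun _ => 1) (fun _ => 1); simpa [ZP, Z] using this

lemma prod_fin (u : ℤ → ℝ≥0∞) (D : Finset Site) :
    ∑' η : Site → ℤ, (if Sp D η then ∏ x ∈ D, u (η x) else 0) ≤ (∑' k, u k) ^ D.card := by
  induction D using Finset.induction_on with
  | empty =>
    simp only [Finset.prod_empty, Finset.card_empty, pow_zero]
    rw [tsum_eq_single 0]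
    · split_ifs <;> simp
    · intro η hη; rw [if_neg]; intro h; exact hη (funext fun x => h x (by simp))
  | insert x D hx ih =>
    rw [Finset.card_insert_of_notMem hx, pow_succ']
    refine le_trans ?_ (mul_le_mul_right ih _)
    rw [← ENNReal.tsum_mul_right]
    simp_rw [← ENNReal.tsum_mul_left]
    rw [← ENNReal.tsum_prod (f := fun k η => u k * if Sp D η then ∏ x ∈ D, u (η x) else 0)]
    refine tsum_inj _ _ (fun η => (η x, Function.update η x 0)) ?_ ?_
    · intro a b _ _ h
      simp only [Prod.mk.injEq] at h
      funext y
      by_cases hy : y = x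
      · rw [hy, h.1]
      · have := congrFun h.2 y; simpa [hy] using this
    · intro η h
      have hs : Sp (insert x D) η := by by_contra hn; simp [hn] at h
      have hs' : Sp D (Function.update η x 0) := by
        intro y hy
        by_cases hyx : y = x
        · simp [hyx]
        · simp [hyx]; exact hs y (by simp [hyx, hy])
      simp only [hs, hs', if_true]
      rw [Finset.prod_insert hx]
      gcongr with y hy
      rw [Function.update_of_ne]; rintro rfl; exact hx hy

lemma Z_ne_top {β : ℝ} (hβ : 0 < β) (D) : Z β D ≠ ⊤ := by
  set s : ℝ := β / (D.card + 1) with hs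
  have hs0 : 0 < s := by positivity
  have hu : ∑' k : ℤ, ex (-s * |(k : ℝ)|) ≠ ⊤ := by
    unfold ex; rw [← ENNReal.ofReal_tsum_of_nonneg (fun _ => (exp_pos _).le) (summable_exp_abs hs0)]
    exact ENNReal.ofReal_ne_top
  refine ne_top_of_le_ne_top (ENNReal.pow_ne_top hu) (le_trans ?_ (prod_fin (fun k => ex (-s * |(k : ℝ)|)) D))
  refine tsum_le_tsum fun η => ?_
  unfold wD
  split_ifs with h
  · have h1 : ∏ x ∈ D, ex (-s * |(η x : ℝ)|) = ex (∑ x ∈ D, -s * |(η x : ℝ)|) := by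
      unfold ex; rw [Real.exp_sum, ENNReal.ofReal_prod_of_nonneg fun _ _ => (exp_pos _).le]
    rw [h1]
    apply ex_mono
    have h2 : ∀ x ∈ D, -s * (E1 η : ℝ) ≤ -s * |(η x : ℝ)| := by
      intro x _
      have := abs_le_E1 h.fs x
      have h3 : |(η x : ℝ)| ≤ E1 η := by
        rw [← Int.cast_abs, ← Nat.cast_natAbs]; exact_mod_cast this
      nlinarith
    refine le_trans ?_ (sum_le_sum h2)
    rw [sum_const, nsmul_eq_mul]
    have : s * D.card ≤ β := by
      rw [hs, div_mul_eq_mul_div, div_le_iff₀ (by positivity)]; nlinarith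
    have h4 : (0 : ℝ) ≤ E1 η := Nat.cast_nonneg _
    nlinarith
  · exact le_rfl
lemma Z_ne_zero (β D) : Z β D ≠ 0 := by
  have : wD β D 0 ≤ Z β D := ENNReal.le_tsum 0
  intro h; rw [h] at this
  have h0 : Sp D 0 := fun _ _ => rfl
  simp [wD, h0, E1_zero, ex_zero] at this
lemma ZP_ne_top {β : ℝ} (hβ : 0 < β) (D D') : ZP β D D' ≠ ⊤ := by
  rw [ZP_mul]; exact mul_ne_top (Z_ne_top hβ D) (Z_ne_top hβ D')

def NF (F : Fld → ℝ) (ω : Fld) : ℝ := ∑ c ∈ ClF ω, F c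

lemma rem_cl {β D D' c ω} (hD : Ray D) (hD' : Ray D') (hω : SpP D D' ω) (hc : c ∈ ClF ω) :
    SpP D D' c ∧ Conn c ∧ wP β D D' ω = ex (-β * En c) * wP β D D' (ω - c) := by
  have hcl := (mem_ClF hω.fp).1 hc
  have h1 := hcl.spP hD hD' hω
  have h2 : SpP D D' (ω - c) := ⟨fun x hx => by simp [hω.1 x hx, h1.1 x hx], fun x hx => by simp [hω.2 x hx, h1.2 x hx]⟩
  refine ⟨h1, hcl.1, ?_⟩
  rw [wP_eq, wP_eq, if_pos hω, if_pos h2, ← ex_add]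
  congr 1
  rw [← En_sub hω.fp hc]; push_cast; ring

lemma peierls {β D D'} (hD : Ray D) (hD' : Ray D') (Q : Fld → Prop) :
    ∑' ω, (if ∃ c ∈ ClF ω, Q c then wP β D D' ω else 0) ≤
      (∑' c, if Conn c ∧ SpP D D' c ∧ Q c then ex (-β * En c) else 0) * ZP β D D' := by
  rw [← ENNReal.tsum_mul_right]
  calc _ ≤ ∑' ω, ∑' c, (if c ∈ ClF ω ∧ Q c then wP β D D' ω else 0) := by
        refine tsum_le_tsum fun ω => ?_
        split_ifs with h
        · obtain ⟨c, h1, h2⟩ := h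
          refine le_trans ?_ (ENNReal.le_tsum c); rw [if_pos ⟨h1, h2⟩]
        · exact zero_le
    _ = ∑' c, ∑' ω, (if c ∈ ClF ω ∧ Q c then wP β D D' ω else 0) := ENNReal.tsum_comm
    _ ≤ _ := by
        refine tsum_le_tsum fun c => ?_
        rw [ZP, ← ENNReal.tsum_mul_left]
        refine tsum_inj _ _ (fun ω => ω - c) (fun a b _ _ h => sub_left_injective h) fun ω h => ?_
        have h1 : c ∈ ClF ω ∧ Q c := by by_contra hn; rw [if_neg hn] at h; exact h rfl
        rw [if_pos h1] at h ⊢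
        obtain ⟨h2, h3, h4⟩ := rem_cl (β := β) hD hD' (wP_sp h) h1.1
        rw [if_pos ⟨h3, h2, h1.2⟩, h4]

theorem tilt {β : ℝ} (hβ : 0 < β) {D D'} (hD : Ray D) (hD' : Ray D') (F : Fld → ℝ) (hF0 : ∀ c, 0 ≤ F c)
    (hF : ∀ c, Conn c → SpP D D' c → F c ≤ β / 2 * En c) {M : ℝ} (hM : 0 < M)
    (hsum : ∑' c, (if Conn c ∧ SpP D D' c then ofReal (F c) * ex (-(β / 2) * En c) else 0)
      ≤ ofReal M) (x : ℝ) :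
    ∑' ω, (if x ≤ NF F ω then wP β D D' ω else 0) ≤ 2 * ex (2 * M - x) * ZP β D D' := by
  set X : ℝ≥0∞ := ∑' ω, wP β D D' ω * ex (NF F ω) with hX
  have hXt : X ≠ ⊤ := by
    refine ne_top_of_le_ne_top (ZP_ne_top (half_pos hβ) D D') (tsum_le_tsum fun ω => ?_)
    rw [wP_eq, wP_eq]
    split_ifs with h
    · rw [← ex_add]
      apply ex_mono
      have : NF F ω ≤ β / 2 * En ω := by
        rw [← En_ClF h.fp]; push_cast; rw [mul_sum]
        refine sum_le_sum fun c hc => ?_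
        have hcl := (mem_ClF h.fp).1 hc
        exact hF c hcl.1 (hcl.spP hD hD' h)
      linarith
    · simp
  have hY : ∑' ω, wP β D D' ω * ex (NF F ω) * ofReal (NF F ω) ≤ ofReal M * X := by
    calc _ = ∑' ω, ∑' c, (if c ∈ ClF ω then wP β D D' ω * ex (NF F ω) * ofReal (F c) else 0) := by
          refine tsum_congr fun ω => ?_
          rw [tsum_eq_sum (s := ClF ω) (fun c hc => by simp [hc]), NF,
            ENNReal.ofReal_sum_of_nonneg fun c _ => hF0 c, mul_sum]
          exact sum_congr rfl fun c hc => by simp [hc]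
      _ = ∑' c, ∑' ω, (if c ∈ ClF ω then wP β D D' ω * ex (NF F ω) * ofReal (F c) else 0) :=
          ENNReal.tsum_comm
      _ ≤ ∑' c, (if Conn c ∧ SpP D D' c then ofReal (F c) * ex (-(β / 2) * En c) else 0) * X := by
          refine tsum_le_tsum fun c => ?_
          rw [hX, ← ENNReal.tsum_mul_left]
          refine tsum_inj _ _ (fun ω => ω - c) (fun a b _ _ h => sub_left_injective h) fun ω h => ?_
          have h1 : c ∈ ClF ω := by by_contra hn; rw [if_neg hn] at h; exact h rfl
          rw [if_pos h1] at h ⊢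
          have hs : SpP D D' ω := wP_sp (β := β) fun hh => h (by rw [hh]; simp)
          obtain ⟨h2, h3, h4⟩ := rem_cl (β := β) hD hD' hs h1
          have h5 : NF F ω = NF F (ω - c) + F c := by
            rw [NF, NF, ClF_erase hs.fp h1, Finset.sum_erase_add _ _ h1]
          rw [if_pos ⟨h3, h2⟩, h4, h5, ex_add]
          have h6 : ex (-β * En c) * ex (F c) ≤ ex (-(β / 2) * En c) := by
            rw [← ex_add]; apply ex_mono; have := hF c h3 h2; linarith
          calc _ = (ex (-β * En c) * ex (F c)) * (ofReal (F c) * (wP β D D' (ω - c) * ex (NF F (ω - c)))) := by ring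
            _ ≤ ex (-(β / 2) * En c) * (ofReal (F c) * (wP β D D' (ω - c) * ex (NF F (ω - c)))) := by gcongr
            _ = _ := by ring
      _ = _ * X := ENNReal.tsum_mul_right
      _ ≤ _ := by gcongr
  have hle : X ≤ ex (2 * M) * ZP β D D' + X / 2 := by
    have h1 : X ≤ ∑' ω, (ex (2 * M) * wP β D D' ω +
        ofReal (1 / (2 * M)) * (wP β D D' ω * ex (NF F ω) * ofReal (NF F ω))) := by
      refine tsum_le_tsum fun ω => ?_
      by_cases h : NF F ω ≤ 2 * M
      · refine le_trans ?_ le_self_add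
        rw [mul_comm]; gcongr; exact ex_mono h
      · refine le_trans ?_ le_add_self
        push Not at h
        have : 1 ≤ ofReal (1 / (2 * M)) * ofReal (NF F ω) := by
          rw [← ofReal_mul (by positivity), ENNReal.one_le_ofReal, one_div, inv_mul_eq_div,
            le_div_iff₀ (by positivity)]; linarith
        calc _ = (wP β D D' ω * ex (NF F ω)) * 1 := by ring
          _ ≤ (wP β D D' ω * ex (NF F ω)) * (ofReal (1 / (2 * M)) * ofReal (NF F ω)) := by gcongr
          _ = _ := by ring
    refine h1.trans ?_
    rw [ENNReal.tsum_add, ENNReal.tsum_mul_left, ENNReal.tsum_mul_left]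
    gcongr
    · exact le_rfl
    · calc _ ≤ ofReal (1 / (2 * M)) * (ofReal M * X) := by gcongr
        _ = X / 2 := by
          rw [← mul_assoc, ← ofReal_mul (by positivity)]
          have : 1 / (2 * M) * M = 1 / 2 := by field_simp
          rw [this, mul_comm, ENNReal.div_eq_inv_mul, mul_comm]; congr 1
          rw [one_div, ENNReal.ofReal_inv_of_pos two_pos]; simp
  have hX2 : X ≤ 2 * (ex (2 * M) * ZP β D D') := by
    have h1 : X - X / 2 ≤ ex (2 * M) * ZP β D D' := tsub_le_iff_right.2 hle
    rw [ENNReal.sub_half hXt] at h1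
    calc X = 2 * (X / 2) := (ENNReal.mul_div_cancel two_ne_zero ENNReal.ofNat_ne_top).symm
      _ ≤ _ := by gcongr
  calc _ ≤ ∑' ω, ex (-x) * (wP β D D' ω * ex (NF F ω)) := by
        refine tsum_le_tsum fun ω => ?_
        split_ifs with h
        · calc wP β D D' ω = 1 * wP β D D' ω := by ring
            _ ≤ ex (-x + NF F ω) * wP β D D' ω := by
              gcongr; rw [← ex_zero]; apply ex_mono; linarith
            _ = _ := by rw [ex_add]; ring
        · exact zero_le
    _ = ex (-x) * X := ENNReal.tsum_mul_left
    _ ≤ ex (-x) * (2 * (ex (2 * M) * ZP β D D')) := by gcongr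
    _ = _ := by rw [sub_eq_add_neg, ex_add]; ring

lemma count_big (x : Site) {n0 b : ℝ} (hb : C1 ≤ b) :
    ∑' c : Fld, (if Conn c ∧ tch c x ∧ n0 ≤ En c then ex (-b * En c) else 0) ≤ ex (-(b - C1) * n0) := by
  calc _ ≤ ∑' c : Fld, ex (-(b - C1) * n0) * (if Conn c ∧ tch c x then ex (-C1 * En c) else 0) := by
        refine tsum_le_tsum fun c => ?_
        by_cases h : Conn c ∧ tch c x ∧ n0 ≤ En c
        · rw [if_pos h, if_pos ⟨h.1, h.2.1⟩, ← ex_add]; apply ex_mono; nlinarith [h.2.2]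
        · rw [if_neg h]; exact zero_le
    _ = _ := ENNReal.tsum_mul_left
    _ ≤ ex (-(b - C1) * n0) * 1 := by gcongr; exact count_site x
    _ = _ := mul_one _

def W (β : ℝ) (D : Finset Site) (A : (Site → ℤ) → Prop) : ℝ≥0∞ := ∑' η, if A η then wD β D η else 0
lemma W_mono {β D} {A B : (Site → ℤ) → Prop} (h : ∀ η, Sp D η → A η → B η) : W β D A ≤ W β D B := by
  refine tsum_le_tsum fun η => ?_
  by_cases hs : Sp D η
  · by_cases hA : A η
    · simp [hA, h η hs hA]
    · simp [hA]
  · simp [wD, hs]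
lemma W_le_Z {β D} {A : (Site → ℤ) → Prop} : W β D A ≤ Z β D :=
  tsum_le_tsum fun η => by split_ifs <;> simp
lemma W_true {β D} : W β D (fun _ => True) = Z β D := by simp [W, Z]
lemma W_or {β D} {A B C : (Site → ℤ) → Prop} (h : ∀ η, Sp D η → A η → B η ∨ C η) :
    W β D A ≤ W β D B + W β D C := by
  refine (W_mono (B := fun η => B η ∨ C η) h).trans ?_
  rw [W, W, W, ← ENNReal.tsum_add]
  refine tsum_le_tsum fun η => ?_
  by_cases hB : B η <;> by_cases hC : C η <;> simp [hB, hC]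
lemma W_ne_top {β D} {A : (Site → ℤ) → Prop} (hβ : 0 < β) : W β D A ≠ ⊤ :=
  ne_top_of_le_ne_top (Z_ne_top hβ D) W_le_Z
lemma W_pair {β D D'} (A B : (Site → ℤ) → Prop) :
    ∑' ω : Fld, (if A ω.1 ∧ B ω.2 then wP β D D' ω else 0) = W β D A * W β D' B := by
  have := ZP_eq β D D' (fun η => if A η then 1 else 0) (fun η => if B η then 1 else 0)
  simp only [mul_ite, mul_one, mul_zero] at this
  rw [W, W, ← this]
  refine tsum_congr fun ω => ?_
  by_cases hA : A ω.1 <;> by_cases hB : B ω.2 <;> simp [hA, hB]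
lemma W_fst {β D D'} (A : (Site → ℤ) → Prop) :
    ∑' ω : Fld, (if A ω.1 then wP β D D' ω else 0) = W β D A * Z β D' := by
  simpa [W_true] using W_pair (β := β) (D := D) (D' := D') A (fun _ => True)
lemma Z_empty (β) : Z β ∅ = 1 := by
  rw [Z, tsum_eq_single 0]
  · have : Sp ∅ 0 := fun _ _ => rfl
    simp [wD, this, E1_zero, ex_zero]
  · intro η hη
    rw [wD, if_neg]; intro h; exact hη (funext fun x => h x (by simp))
lemma Conn.pos {c} (h : Conn c) : 1 ≤ En c := by
  obtain ⟨e, he⟩ := h.2.1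
  simpa using card_le_En h.1 {e} (by simpa using he)

def C2 : ℝ := C1 + 1
lemma C2_ge : 3 ≤ C2 := by have := C0_ge; simp only [C2, C1]; linarith
theorem tiltS {β : ℝ} (hβ : 2 * C2 ≤ β) {D D'} (hD : Ray D) (hD' : Ray D') (S : Finset Site) {s n0 M : ℝ}
    (hs : 0 ≤ s) (g : Fld → Site → ℝ) (hg0 : ∀ c x, 0 ≤ g c x)
    (hg : ∀ c x, Conn c → g c x ≠ 0 → tch c x ∧ n0 ≤ En c ∧ g c x ≤ En c)
    (hF : ∀ c, Conn c → SpP D D' c → s * ∑ x ∈ S, g c x ≤ β / 2 * En c) (hM : 0 < M)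
    (hsum : s * S.card * exp (-(β / 2 - C2) * n0) ≤ M) (y : ℝ) :
    ∑' ω, (if y ≤ s * ∑ x ∈ S, ∑ c ∈ ClF ω, g c x then wP β D D' ω else 0) ≤ 2 * ex (2 * M - y) * ZP β D D' := by
  have hb := C2_ge
  have := tilt (by linarith : 0 < β) hD hD' (fun c => s * ∑ x ∈ S, g c x)
    (fun c => mul_nonneg hs (sum_nonneg fun x _ => hg0 c x)) hF hM ?_ y
  · simpa only [NF, ← mul_sum, sum_comm (s := S)] using this
  · calc _ ≤ ∑' c, ∑ x ∈ S, ofReal s * (if Conn c ∧ tch c x ∧ n0 ≤ En c then ex (-(β / 2 - 1) * En c) else 0) := by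
          refine tsum_le_tsum fun c => ?_
          split_ifs with h
          · rw [ofReal_mul hs, ENNReal.ofReal_sum_of_nonneg fun x _ => hg0 c x, mul_sum, Finset.sum_mul]
            refine sum_le_sum fun x _ => ?_
            rw [mul_assoc]
            gcongr
            by_cases h0 : g c x = 0
            · simp [h0]
            · obtain ⟨h1, h2, h3⟩ := hg c x h.1 h0
              rw [if_pos ⟨h.1, h1, h2⟩, show -(β / 2 - 1) * (En c : ℝ) = En c + -(β / 2) * En c by ring, ex_add]
              gcongr
              exact ofReal_le_ofReal (h3.trans (by linarith [add_one_le_exp (En c : ℝ)]))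
          · exact zero_le
      _ = ∑ x ∈ S, ofReal s * ∑' c, (if Conn c ∧ tch c x ∧ n0 ≤ En c then ex (-(β / 2 - 1) * En c) else 0) := by
          rw [Summable.tsum_finsetSum fun _ _ => ENNReal.summable]
          simp only [ENNReal.tsum_mul_left]
      _ ≤ ∑ x ∈ S, ofReal s * ex (-(β / 2 - C2) * n0) := by
          refine sum_le_sum fun x _ => mul_le_mul_right ((count_big x ?_).trans_eq ?_) _
          · simp only [C2] at hβ; linarith
          · congr 1; simp only [C2]; ring
      _ = ofReal (s * S.card * exp (-(β / 2 - C2) * n0)) := by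
          rw [sum_const, nsmul_eq_mul, ofReal_mul (by positivity), ofReal_mul hs, ex]
          simp; ring
      _ ≤ _ := ofReal_le_ofReal hsum
theorem tilt1 {β : ℝ} (hβ : 2 * C2 ≤ β) {D} (hD : Ray D) (S : Finset Site) {s n0 M : ℝ}
    (hs : 0 ≤ s) (g : Fld → Site → ℝ) (hg0 : ∀ c x, 0 ≤ g c x)
    (hg : ∀ c x, Conn c → g c x ≠ 0 → tch c x ∧ n0 ≤ En c ∧ g c x ≤ En c)
    (hF : ∀ c, Conn c → SpP D ∅ c → s * ∑ x ∈ S, g c x ≤ β / 2 * En c) (hM : 0 < M)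
    (hsum : s * S.card * exp (-(β / 2 - C2) * n0) ≤ M) (y : ℝ) (A : (Site → ℤ) → Prop)
    (hA : ∀ η, Sp D η → A η → y ≤ s * ∑ x ∈ S, ∑ c ∈ ClF (η, 0), g c x) :
    W β D A ≤ 2 * ex (2 * M - y) * Z β D := by
  have := tiltS hβ hD ray_empty S hs g hg0 hg hF hM hsum y
  rw [ZP_mul, Z_empty, mul_one] at this
  refine le_trans ?_ this
  rw [← mul_one (W β D A), ← Z_empty β, ← W_fst]
  refine tsum_le_tsum fun ω => ?_
  by_cases h0 : wP β D ∅ ω = 0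
  · simp [h0]
  · have h1 := wP_sp h0
    have h2 : ω = (ω.1, 0) := Prod.ext rfl (funext fun x => h1.2 x (by simp))
    by_cases h : A ω.1
    · have h3 := hA _ h1.1 h
      rw [← h2] at h3
      rw [if_pos h, if_pos h3]
    · simp [h]

lemma chain_ivt (π : Edge → ℤ) {c e f} (hπ : ∀ e f, Nb e f → |π e - π f| ≤ 1) (he : gp c e ≠ 0)
    (h : Relation.ReflTransGen (Rl c) e f) : ∀ r, π e ≤ r → r ≤ π f → ∃ g, gp c g ≠ 0 ∧ π g = r := by
  induction h with
  | refl => intro r h1 h2; exact ⟨e, he, by omega⟩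
  | @tail b d _ hbd ih =>
    intro r h1 h2
    by_cases h : r ≤ π b
    · exact ih r h1 h
    · have := abs_le.1 (hπ _ _ hbd.1)
      exact ⟨d, hbd.2, by omega⟩
lemma diam_aux {c x y} (h : Conn c) (hx : tch c x) (hy : tch c y) (b : Bool) :
    (if b then y.1 else y.2) - (if b then x.1 else x.2) + 1 ≤ En c := by
  let π : Edge → ℤ := fun e => if b then e.1.1 else e.1.2
  obtain ⟨k, hk, -⟩ := exit_cl h.1 hx b
  obtain ⟨k', hk', -⟩ := exit_cl h.1 hy b
  have h1 := chain_ivt π (fun e f hn => by cases b <;> simp [π, hn.coord.1, hn.coord.2]) hk (h.2.2 _ _ hk hk')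
  choose! g hg hgr using h1
  have e1 : π (ray b x k, b) = if b then x.1 else x.2 := by cases b <;> simp [π, ray]
  have e2 : π (ray b y k', b) = if b then y.1 else y.2 := by cases b <;> simp [π, ray]
  rw [e1, e2] at hg hgr
  have := card_le_En h.1 ((Finset.Icc (if b then x.1 else x.2) (if b then y.1 else y.2)).image g) (by
    intro e he
    obtain ⟨r, hr, rfl⟩ := Finset.mem_image.1 he
    rw [Finset.mem_Icc] at hr
    exact hg r hr.1 hr.2)
  rw [Finset.card_image_of_injOn] at this
  · simp at this; omega
  · intro r hr r' hr' heq
    simp only [Finset.coe_Icc, Set.mem_Icc] at hr hr'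
    rw [← hgr r hr.1 hr.2, ← hgr r' hr'.1 hr'.2, heq]
def Qb (ℓ : ℕ) (x : Site) : Finset Site := Finset.Icc (x.1 - ℓ) (x.1 + ℓ) ×ˢ Finset.Icc (x.2 - ℓ) (x.2 + ℓ)
lemma mem_Qb {ℓ : ℕ} {x y : Site} : y ∈ Qb ℓ x ↔ (x.1 - ℓ ≤ y.1 ∧ y.1 ≤ x.1 + ℓ) ∧ x.2 - ℓ ≤ y.2 ∧ y.2 ≤ x.2 + ℓ := by
  simp [Qb]
lemma diam {c x y} {ℓ : ℕ} (h : Conn c) (hx : tch c x) (hy : tch c y) (hl : En c ≤ ℓ) : y ∈ Qb ℓ x := by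
  have h1 := diam_aux h hx hy true
  have h2 := diam_aux h hx hy false
  have h3 := diam_aux h hy hx true
  have h4 := diam_aux h hy hx false
  simp at h1 h2 h3 h4
  rw [mem_Qb]; omega
lemma ray_prod (A B : Finset ℤ) : Ray (A ×ˢ B) := by
  intro x hx
  by_cases h : x.1 ∈ A
  · refine ⟨false, Or.inl fun k => ?_⟩
    simp only [mem_product, not_and] at hx
    simp [ray, hx h]
  · exact ⟨true, Or.inl fun k => by simp [ray, h]⟩

lemma card_tch {c} (h : FP c) (A B : Finset ℤ) : ((A ×ˢ B).filter (tch c)).card ≤ A.card * En c := by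
  calc _ ≤ (A ×ˢ ((A ×ˢ B).filter (tch c)).image Prod.snd).card := by
        refine card_le_card fun x hx => ?_
        have := Finset.mem_filter.1 hx
        exact mem_product.2 ⟨(mem_product.1 this.1).1, mem_image_of_mem _ hx⟩
    _ ≤ _ := by
        rw [Finset.card_product]
        refine Nat.mul_le_mul_left _ (card_rows_le h false _ fun r hr => ?_)
        obtain ⟨x, hx, rfl⟩ := Finset.mem_image.1 hr
        exact ⟨x, (Finset.mem_filter.1 hx).2, rfl⟩
lemma card_tch2 {c} (h : FP c) (S : Finset Site) : (S.filter (tch c)).card ≤ En c * En c := by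
  set A := (S.filter (tch c)).image Prod.fst
  set B := (S.filter (tch c)).image Prod.snd
  have h1 : A.card ≤ En c := card_rows_le h true _ fun r hr => by
    obtain ⟨x, hx, rfl⟩ := Finset.mem_image.1 hr
    exact ⟨x, (Finset.mem_filter.1 hx).2, rfl⟩
  refine le_trans (card_le_card fun x hx => ?_) ((card_tch h A B).trans (Nat.mul_le_mul_right _ h1))
  exact Finset.mem_filter.2 ⟨mem_product.2 ⟨mem_image_of_mem _ hx, mem_image_of_mem _ hx⟩,
    (Finset.mem_filter.1 hx).2⟩

lemma sum_line {c} (h : FS c) (b : Bool) (S : Finset Site)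
    (hS : Set.InjOn (fun x : Site => if b then x.1 else x.2) S) : ∑ x ∈ S, (c x).natAbs ≤ E1 c := by
  choose s hs1 hs2 using fun x => abs_le_sum_ray h b x
  calc _ ≤ ∑ x ∈ S, ∑ e ∈ s x, (gr c e).natAbs := sum_le_sum fun x _ => hs2 x
    _ = ∑ e ∈ S.biUnion s, (gr c e).natAbs := by
        rw [Finset.sum_biUnion]
        intro x hx y hy hxy
        rw [Function.onFun, Finset.disjoint_left]
        intro e he he'
        obtain ⟨_, k, hk⟩ := hs1 x e he
        obtain ⟨_, k', hk'⟩ := hs1 y e he'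
        refine hxy (hS hx hy ?_)
        rw [hk] at hk'
        cases b
        · simpa [ray] using (Prod.ext_iff.1 hk').2
        · simpa [ray] using (Prod.ext_iff.1 hk').1
    _ ≤ ∑ e ∈ S.biUnion s, (gr c e).natAbs ^ 2 := sum_le_sum fun e _ => natAbs_le_sq _
    _ ≤ _ := E1_ge h.gf _

lemma act_sp {P ω D D'} (hP : SwInv P) (hD : Ray D) (hD' : Ray D') (h : SpP D D' ω)
    (hc : ∀ c, Conn c → SpP D D' c → P c → SpP D D' (c.2, c.1)) : SpP D D' (act P ω) := by
  have key : ∀ c ∈ ClF ω, SpP D D' (swp P c) := by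
    intro c hcl
    have h1 := (mem_ClF h.fp).1 hcl
    unfold swp; split_ifs with hp
    · exact hc c h1.1 (h1.spP hD hD' h) hp
    · exact h1.spP hD hD' h
  exact ⟨fun x hx => by rw [act, sum_fst]; exact sum_eq_zero fun c hc => (key c hc).1 x hx,
    fun x hx => by rw [act, sum_snd]; exact sum_eq_zero fun c hc => (key c hc).2 x hx⟩
lemma act_w {β P ω D D'} (hP : SwInv P) (hD : Ray D) (hD' : Ray D') (h : SpP D D' ω)
    (hc : ∀ c, Conn c → SpP D D' c → P c → SpP D D' (c.2, c.1)) : wP β D D' (act P ω) = wP β D D' ω := by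
  rw [wP_eq, wP_eq, if_pos h, if_pos (act_sp hP hD hD' h hc), (ClF_act hP h.fp).2]
lemma tch_sw {c : Fld} {x} : tch (c.2, c.1) x ↔ tch c x := by simp [tch, or_comm]
lemma En_sw {c : Fld} : En (c.2, c.1) = En c := by simp [En, add_comm]
lemma fst_eq {ω} (h : FP ω) (x) : ω.1 x = ∑ c ∈ ClF ω, c.1 x := by
  conv_lhs => rw [← sum_ClF h]
  exact sum_fst _ (fun c => c) x
lemma snd_eq {ω} (h : FP ω) (x) : ω.2 x = ∑ c ∈ ClF ω, c.2 x := by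
  conv_lhs => rw [← sum_ClF h]
  exact sum_snd _ (fun c => c) x

theorem dom {β : ℝ} (hβ : C1 ≤ β) {D D' : Finset Site} (hD : Ray D) (hD' : Ray D') {ℓ : ℕ} {x : Site} (h1 : Qb ℓ x ⊆ D)
    (h2 : Qb ℓ x ⊆ D') (A : ℤ → Prop) :
    W β D (fun η => A (η x)) * Z β D' ≤ Z β D * W β D' (fun η => A (η x)) + ex (-(β - C1) * ℓ) * ZP β D D' := by
  set P : Fld → Prop := fun c => En c ≤ ℓ ∧ tch c x with hPdef
  have hP : SwInv P := fun c => by simp only [hPdef, tch_sw, En_sw]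
  have hc : ∀ c, Conn c → SpP D D' c → P c → SpP D D' (c.2, c.1) := by
    intro c hcon hs hp
    have key : ∀ y, y ∉ Qb ℓ x → ¬ tch c y := fun y hy ht => hy (diam hcon hp.2 ht hp.1)
    simp only [tch, not_or, not_not] at key
    exact ⟨fun y hy => (key y fun h => hy (h1 h)).2, fun y hy => (key y fun h => hy (h2 h)).1⟩
  rw [← W_fst]
  calc _ ≤ ∑' ω, ((if (∀ c ∈ ClF ω, tch c x → En c ≤ ℓ) ∧ A (ω.1 x) then wP β D D' ω else 0) +
        (if ∃ c ∈ ClF ω, tch c x ∧ (ℓ : ℝ) ≤ En c then wP β D D' ω else 0)) := by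
        refine tsum_le_tsum fun ω => ?_
        by_cases hA : A (ω.1 x)
        · by_cases hb : ∀ c ∈ ClF ω, tch c x → En c ≤ ℓ
          · rw [if_pos hA, if_pos ⟨hb, hA⟩]; exact le_self_add
          · have : ∃ c ∈ ClF ω, tch c x ∧ (ℓ : ℝ) ≤ En c := by
              push Not at hb
              obtain ⟨c, h1, h2, h3⟩ := hb
              exact ⟨c, h1, h2, by exact_mod_cast h3.le⟩
            rw [if_pos hA, if_pos this]; exact le_add_self
        · simp [hA]
    _ = ∑' ω, (if (∀ c ∈ ClF ω, tch c x → En c ≤ ℓ) ∧ A (ω.1 x) then wP β D D' ω else 0) +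
        ∑' ω, (if ∃ c ∈ ClF ω, tch c x ∧ (ℓ : ℝ) ≤ En c then wP β D D' ω else 0) := ENNReal.tsum_add
    _ ≤ _ := by
        have hpe := peierls (β := β) hD hD' (fun c => tch c x ∧ (ℓ : ℝ) ≤ En c)
        refine add_le_add ?_ (le_trans (le_of_eq (by congr!)) (hpe.trans (mul_le_mul_left ?_ _)))
        · rw [← W_true, ← W_pair]
          refine tsum_inj _ _ (act P) ?_ ?_
          · intro a b ha hb hab
            have sp : ∀ ω, (if (∀ c ∈ ClF ω, tch c x → En c ≤ ℓ) ∧ A (ω.1 x) then wP β D D' ω else 0) ≠ 0 → FP ω :=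
              fun ω h => (wP_sp (β := β) fun h0 => h (by rw [h0]; simp)).fp
            rw [← act_act hP (sp a ha), hab, act_act hP (sp b hb)]
          · intro ω h
            have hh : (∀ c ∈ ClF ω, tch c x → En c ≤ ℓ) ∧ A (ω.1 x) := by
              by_contra hn; rw [if_neg hn] at h; exact h rfl
            rw [if_pos hh] at h ⊢
            have hs := wP_sp h
            rw [act_w hP hD hD' hs hc, if_pos]
            refine ⟨trivial, ?_⟩
            have : (act P ω).2 x = ω.1 x := by
              rw [act, sum_snd, fst_eq hs.fp]
              refine sum_congr rfl fun c hcl => ?_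
              unfold swp; split_ifs with hp
              · rfl
              · have : ¬ tch c x := fun ht => hp ⟨hh.1 c hcl ht, ht⟩
                simp only [tch, not_or, not_not] at this
                rw [this.1, this.2]
            rw [this]; exact hh.2
        · refine le_trans (tsum_le_tsum fun c => ?_) (count_big x hβ (n0 := ℓ))
          by_cases h : Conn c ∧ SpP D D' c ∧ tch c x ∧ (ℓ : ℝ) ≤ En c
          · rw [if_pos h, if_pos ⟨h.1, h.2.2⟩]
          · rw [if_neg h]; exact zero_le

lemma ff_gen {α : Type*} [DistribLattice α] (f₁ f₂ f₃ f₄ : α → ℝ≥0∞) (t₁ : ∀ a, f₁ a ≠ ⊤) (t₂ : ∀ a, f₂ a ≠ ⊤)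
    (t₃ : ∀ a, f₃ a ≠ ⊤) (t₄ : ∀ a, f₄ a ≠ ⊤) (h : ∀ a b, f₁ a * f₂ b ≤ f₃ (a ⊓ b) * f₄ (a ⊔ b)) :
    (∑' a, f₁ a) * ∑' a, f₂ a ≤ (∑' a, f₃ a) * ∑' a, f₄ a := by
  rw [ENNReal.tsum_eq_iSup_sum, ENNReal.tsum_eq_iSup_sum, ENNReal.iSup_mul]
  refine iSup_le fun s => ?_
  rw [ENNReal.mul_iSup]
  refine iSup_le fun t => ?_
  have key := four_functions_theorem (fun a => (f₁ a).toNNReal) (fun a => (f₂ a).toNNReal) (fun a => (f₃ a).toNNReal)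
    (fun a => (f₄ a).toNNReal) (fun _ => zero_le) (fun _ => zero_le) (fun _ => zero_le) (fun _ => zero_le)
    (fun a b => by
      rw [← ENNReal.toNNReal_mul, ← ENNReal.toNNReal_mul]
      exact ENNReal.toNNReal_mono (mul_ne_top (t₃ _) (t₄ _)) (h a b)) s t
  have conv : ∀ (f : α → ℝ≥0∞) (ht : ∀ a, f a ≠ ⊤) (u : Finset α), ∑ a ∈ u, f a = ((∑ a ∈ u, (f a).toNNReal : NNReal) : ℝ≥0∞) := by
    intro f ht u; push_cast; exact sum_congr rfl fun a _ => (ENNReal.coe_toNNReal (ht a)).symm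
  open scoped FinsetFamily in
  calc _ ≤ (∑ a ∈ s ⊼ t, f₃ a) * ∑ a ∈ s ⊻ t, f₄ a := by
        rw [conv f₁ t₁, conv f₂ t₂, conv f₃ t₃, conv f₄ t₄]; exact_mod_cast key
    _ ≤ _ := by gcongr <;> exact ENNReal.sum_le_tsum _

lemma submod (η σ : Site → ℤ) (h1 : GF η) (h2 : GF σ) (h3 : GF (η ⊓ σ)) (h4 : GF (η ⊔ σ)) :
    E1 (η ⊓ σ) + E1 (η ⊔ σ) ≤ E1 η + E1 σ := by
  set s := h1.fs ∪ h2.fs ∪ h3.fs ∪ h4.fs with hs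
  rw [E1_eq (s := s) (fun e he => by simp only [hs, Finset.mem_union, GF.mem]; tauto), E1_eq (s := s) (fun e he => by simp only [hs, Finset.mem_union, GF.mem]; tauto),
    E1_eq (s := s) (fun e he => by simp only [hs, Finset.mem_union, GF.mem]; tauto), E1_eq (s := s) (fun e he => by simp only [hs, Finset.mem_union, GF.mem]; tauto),
    ← sum_add_distrib, ← sum_add_distrib]
  refine sum_le_sum fun e _ => ?_
  zify
  simp only [sq_abs, gr, Pi.inf_apply, Pi.sup_apply]
  generalize η (nb e) = a, η e.1 = b, σ (nb e) = c, σ e.1 = d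
  rcases le_total a c with h | h <;> rcases le_total b d with h' | h' <;>
    simp only [inf_of_le_left, inf_of_le_right, sup_of_le_left, sup_of_le_right, h, h'] <;> nlinarith

theorem ff {β : ℝ} (hβ : 0 ≤ β) {D : Finset Site} {k : ℤ} (hk : 0 ≤ k) (A₁ A₂ A₃ A₄ : (Site → ℤ) → Prop)
    (h : ∀ η σ, Sp D η → Sp D σ → A₁ η → A₂ σ → A₃ (η ⊓ fun x => σ x + k) ∧ A₄ (fun x => max (η x) (σ x + k) - k)) :
    W β D A₁ * W β D A₂ ≤ W β D A₃ * W β D A₄ := by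
  have sh : ∀ A : (Site → ℤ) → Prop, W β D A = ∑' η : Site → ℤ, if A (fun x => η x - k) then wD β D (fun x => η x - k) else 0 := by
    intro A
    exact ((Equiv.subRight (fun _ : Site => k)).tsum_eq (fun η => if A η then wD β D η else 0)).symm
  have top : ∀ (A : Prop) (η : Site → ℤ), (if A then wD β D η else 0) ≠ ⊤ := by
    intro A η; unfold wD; split_ifs <;> simp [ex_ne_top]
  rw [sh A₂, sh A₄]
  refine ff_gen _ _ _ _ (fun a => top _ _) (fun a => top _ _) (fun a => top _ _) (fun a => top _ _) fun η σ => ?_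
  by_cases h1 : A₁ η
  swap; · simp [h1]
  by_cases h2 : A₂ (fun x => σ x - k)
  swap; · simp [h2]
  by_cases s1 : Sp D η
  swap; · simp [wD, s1]
  by_cases s2 : Sp D (fun x => σ x - k)
  swap; · simp [wD, s2]
  obtain ⟨h3, h4⟩ := h η _ s1 s2 h1 h2
  simp only [sub_add_cancel] at h3 h4
  have s3 : Sp D (η ⊓ σ) := fun x hx => by
    have e1 := s1 x hx; have e2 := s2 x hx; simp only at e2; simp only [Pi.inf_apply, e1]; omega
  have s4 : Sp D (fun x => (η ⊔ σ) x - k) := fun x hx => by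
    have e1 := s1 x hx; have e2 := s2 x hx; simp only at e2; simp only [Pi.sup_apply, e1]; omega
  rw [if_pos h1, if_pos h2, if_pos h3, if_pos (show A₄ fun x => (η ⊔ σ) x - k from h4)]
  unfold wD
  rw [if_pos s1, if_pos s2, if_pos s3, if_pos s4, ← ex_add, ← ex_add]
  apply ex_mono
  have hgr : ∀ (a : Site → ℤ), gr (fun x => a x - k) = gr a := fun a => funext fun e => by simp [gr]
  have hE : ∀ (a : Site → ℤ), E1 (fun x => a x - k) = E1 a := fun a => by simp [E1, hgr]
  have hG : ∀ (a : Site → ℤ), Sp D (fun x => a x - k) → GF a := fun a ha => by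
    have := ha.fs.gf; unfold GF at *; rwa [hgr] at this
  rw [hE, hE]
  have := submod η σ s1.fs.gf (hG _ s2) s3.fs.gf (hG _ s4)
  have h' : (E1 (η ⊓ σ) : ℝ) + E1 (η ⊔ σ) ≤ E1 η + E1 σ := by exact_mod_cast this
  nlinarith

def pr (β : ℝ) (D : Finset Site) (A : (Site → ℤ) → Prop) : ℝ := (W β D A / Z β D).toReal
section
variable {β : ℝ} {D : Finset Site} {A B C : (Site → ℤ) → Prop}
lemma pr_nonneg : 0 ≤ pr β D A := ENNReal.toReal_nonneg
lemma W_div_top (hβ : 0 < β) : W β D A / Z β D ≠ ⊤ := ENNReal.div_ne_top (W_ne_top hβ) (Z_ne_zero _ _)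
lemma W_eq (hβ : 0 < β) : W β D A = ofReal (pr β D A) * Z β D := by
  rw [pr, ENNReal.ofReal_toReal (W_div_top hβ), ENNReal.div_mul_cancel (Z_ne_zero _ _) (Z_ne_top hβ _)]
lemma pr_le_of (hβ : 0 < β) {b : ℝ} (hb : 0 ≤ b) (h : W β D A ≤ ofReal b * Z β D) : pr β D A ≤ b := by
  refine ENNReal.toReal_le_of_le_ofReal hb (ENNReal.div_le_of_le_mul h)
lemma le_pr_of (hβ : 0 < β) {b : ℝ} (h : ofReal b * Z β D ≤ W β D A) : b ≤ pr β D A := by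
  refine (ENNReal.ofReal_le_iff_le_toReal (W_div_top hβ)).1 ?_
  rwa [ENNReal.le_div_iff_mul_le (Or.inl (Z_ne_zero _ _)) (Or.inl (Z_ne_top hβ _))]
lemma pr_mono (hβ : 0 < β) (h : ∀ η, Sp D η → A η → B η) : pr β D A ≤ pr β D B :=
  pr_le_of hβ pr_nonneg ((W_mono h).trans_eq (W_eq hβ))
lemma pr_or (hβ : 0 < β) (h : ∀ η, Sp D η → A η → B η ∨ C η) : pr β D A ≤ pr β D B + pr β D C := by
  refine pr_le_of hβ (add_nonneg pr_nonneg pr_nonneg) ((W_or h).trans_eq ?_)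
  rw [W_eq hβ, W_eq hβ (A := C), ofReal_add pr_nonneg pr_nonneg, add_mul]
lemma pr_true (hβ : 0 < β) : pr β D (fun _ => True) = 1 := by
  rw [pr, W_true, ENNReal.div_self (Z_ne_zero _ _) (Z_ne_top hβ _)]; rfl
lemma pr_le_one (hβ : 0 < β) : pr β D A ≤ 1 := (pr_mono hβ fun _ _ _ => trivial).trans_eq (pr_true hβ)
lemma one_le_pr (hβ : 0 < β) (h : ∀ η, Sp D η → A η ∨ B η) : 1 ≤ pr β D A + pr β D B := by
  rw [← pr_true hβ (D := D)]; exact pr_or hβ fun η hs _ => h η hs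
lemma pr_neg (hβ : 0 < β) : pr β D (fun η => A (-η)) = pr β D A := by
  unfold pr W
  rw [← (Equiv.neg (Site → ℤ)).tsum_eq]
  congr 2
  refine tsum_congr fun η => ?_
  have : wD β D (-η) = wD β D η := by unfold wD; rw [E1_neg]; congr 1; simp [Sp]
  simp [this]
lemma pr_shift (hβ : 0 < β) (v : Site) {D' : Finset Site} (hD : ∀ x, x ∈ D ↔ x + v ∈ D') :
    pr β D A = pr β D' (fun η => A fun x => η (x + v)) := by
  have key : ∀ (A : (Site → ℤ) → Prop), W β D A = W β D' (fun η => A fun x => η (x + v)) := by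
    intro A
    unfold W
    rw [← (Equiv.arrowCongr (Equiv.subRight v) (Equiv.refl ℤ)).tsum_eq]
    refine tsum_congr fun η => ?_
    have e : (Equiv.arrowCongr (Equiv.subRight v) (Equiv.refl ℤ)) η = fun x => η (x + v) := by
      funext x; simp [Equiv.arrowCongr]
    rw [e]
    have : wD β D (fun x => η (x + v)) = wD β D' η := by
      unfold wD; rw [E1_shift]; congr 1
      refine propext ⟨fun h x hx => ?_, fun h x hx => h _ (fun hh => hx ((hD x).2 hh))⟩
      have := h (x - v) (fun hh => hx (by simpa using (hD _).1 hh)); simpa using this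
    rw [this]
  have h2 : Z β D = Z β D' := by rw [← W_true, key, W_true]
  rw [pr, pr, key, h2]
lemma pr_ff (hβ : 0 < β) {k : ℤ} (hk : 0 ≤ k) (A₁ A₂ A₃ A₄ : (Site → ℤ) → Prop)
    (h : ∀ η σ, Sp D η → Sp D σ → A₁ η → A₂ σ → A₃ (η ⊓ fun x => σ x + k) ∧ A₄ (fun x => max (η x) (σ x + k) - k)) :
    pr β D A₁ * pr β D A₂ ≤ pr β D A₃ * pr β D A₄ := by
  have := ff hβ.le hk A₁ A₂ A₃ A₄ h
  unfold pr
  rw [← ENNReal.toReal_mul, ← ENNReal.toReal_mul]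
  refine ENNReal.toReal_mono (mul_ne_top (W_div_top hβ) (W_div_top hβ)) ?_
  rw [div_eq_mul_inv, div_eq_mul_inv, div_eq_mul_inv, div_eq_mul_inv, mul_mul_mul_comm, mul_mul_mul_comm (W β D A₃)]
  gcongr
lemma pr_fkg (hβ : 0 < β) (u : ℤ) (S : Finset Site) :
    ∏ x ∈ S, pr β D (fun η => u ≤ η x) ≤ pr β D (fun η => ∀ x ∈ S, u ≤ η x) := by
  induction S using Finset.induction_on with
  | empty => simp [pr_true hβ]
  | insert x S hx ih =>
    rw [Finset.prod_insert hx]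
    refine (mul_le_mul_of_nonneg_left ih pr_nonneg).trans ?_
    refine (pr_ff hβ le_rfl _ _ (fun _ => True) (fun η => ∀ y ∈ insert x S, u ≤ η y) ?_).trans_eq (by rw [pr_true hβ, one_mul])
    intro η σ _ _ h1 h2
    refine ⟨trivial, fun y hy => ?_⟩
    simp only [add_zero, sub_zero]
    rcases Finset.mem_insert.1 hy with rfl | hy
    · exact le_max_of_le_left h1
    · exact le_max_of_le_right (h2 y hy)
lemma pr_tilt (hβ : 2 * C2 ≤ β) (hD : Ray D) (S : Finset Site) {s n0 M : ℝ}
    (hs : 0 ≤ s) (g : Fld → Site → ℝ) (hg0 : ∀ c x, 0 ≤ g c x)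
    (hg : ∀ c x, Conn c → g c x ≠ 0 → tch c x ∧ n0 ≤ En c ∧ g c x ≤ En c)
    (hF : ∀ c, Conn c → SpP D ∅ c → s * ∑ x ∈ S, g c x ≤ β / 2 * En c) (hM : 0 < M)
    (hsum : s * S.card * exp (-(β / 2 - C2) * n0) ≤ M) (y : ℝ)
    (hA : ∀ η, Sp D η → A η → y ≤ s * ∑ x ∈ S, ∑ c ∈ ClF (η, 0), g c x) :
    pr β D A ≤ 2 * exp (2 * M - y) := by
  have := C2_ge
  refine pr_le_of (by linarith) (by positivity) ((tilt1 hβ hD S hs g hg0 hg hF hM hsum y A hA).trans_eq ?_)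
  rw [ofReal_mul two_pos.le, ex]; simp
lemma pr_dom (hβ : 2 * C2 ≤ β) {D' : Finset Site} (hD : Ray D) (hD' : Ray D') {ℓ : ℕ} {x : Site} (h1 : Qb ℓ x ⊆ D)
    (h2 : Qb ℓ x ⊆ D') (A : ℤ → Prop) :
    pr β D (fun η => A (η x)) ≤ pr β D' (fun η => A (η x)) + exp (-(β - C1) * ℓ) := by
  have h3 := C2_ge
  have hβ0 : 0 < β := by linarith
  have := dom (by simp only [C2] at hβ h3; linarith) hD hD' h1 h2 A
  refine pr_le_of hβ0 (add_nonneg pr_nonneg (exp_pos _).le) ?_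
  rw [W_eq hβ0 (D := D'), ZP_mul] at this
  have h4 := Z_ne_zero β D'
  have h5 := Z_ne_top hβ0 D'
  rw [← ENNReal.mul_le_mul_iff_left h4 h5]
  refine this.trans_eq ?_
  rw [ofReal_add pr_nonneg (exp_pos _).le, ex]; ring
lemma abs_sum_cl {x} {η : Site → ℤ} (h : FS η) : (|η x| : ℝ) ≤ ∑ c ∈ ClF (η, 0), (|c.1 x| : ℝ) := by
  have := fst_eq (ω := (η, 0)) ⟨h, FS.zero⟩ x
  simp only at this
  rw [this]; push_cast
  exact Finset.abs_sum_le_sum_abs _ _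
lemma abs_le_En {c : Fld} (h : FP c) (x) : (|c.1 x| : ℝ) ≤ En c := by
  have := abs_le_E1 h.1 x
  have h2 : |(c.1 x : ℝ)| = ((c.1 x).natAbs : ℝ) := by rw [Nat.cast_natAbs, Int.cast_abs]
  rw [h2]; exact_mod_cast this.trans (by simp [En])
lemma exp_small (hβ : 2 * C2 ≤ β) : exp (-(β / 2 - C2) * 1) ≤ 1 := by
  rw [Real.exp_le_one_iff]; linarith
lemma pr_crude (hβ : 2 * C2 ≤ β) (hD : Ray D) (x : Site) (h : ℝ) :
    pr β D (fun η => h ≤ |(η x : ℝ)|) ≤ 2 * exp (2 - h) := by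
  have hc := C2_ge
  have := pr_tilt (A := fun η => h ≤ |(η x : ℝ)|) hβ hD {x} (s := 1) (n0 := 1) (M := 1) zero_le_one (fun c x => |(c.1 x : ℝ)|) (fun _ _ => abs_nonneg _)
    (fun c x hc h0 => ⟨Or.inl fun h => h0 (by simp [h]), by exact_mod_cast hc.pos, abs_le_En hc.1 x⟩)
    (fun c hc _ => by
      have := abs_le_En hc.1 x
      have h2 : (0 : ℝ) ≤ En c := Nat.cast_nonneg _
      simp; nlinarith) one_pos (by simpa using exp_small hβ) h
    (fun η hs hA => by simpa using le_trans hA (abs_sum_cl hs.fs))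
  simpa using this
lemma pr_zero (hβ : 2 * C2 ≤ β) (hD : Ray D) (x : Site) : 1 / 2 ≤ pr β D (fun η => η x = 0) := by
  have hc := C2_ge
  have hβ0 : 0 < β := by linarith
  have h1 : pr β D (fun η => η x ≠ 0) ≤ exp (-1) := by
    refine pr_le_of hβ0 (exp_pos _).le ?_
    have hpe := peierls (β := β) hD ray_empty (fun c => tch c x ∧ (1 : ℝ) ≤ En c)
    rw [ZP_mul, Z_empty, mul_one] at hpe
    rw [← mul_one (W β D _), ← Z_empty β, ← W_fst]
    refine le_trans (tsum_le_tsum fun ω => ?_) (hpe.trans (mul_le_mul_left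
      (le_trans (tsum_le_tsum fun c => ?_) ((count_big x (b := β) (n0 := 1) (by simp only [C2] at hβ hc; linarith)).trans (ex_mono (by simp only [C2] at hβ hc; linarith)))) _))
    · by_cases h0 : wP β D ∅ ω = 0
      · simp [h0]
      by_cases h : ω.1 x ≠ 0
      · rw [if_pos h, if_pos]
        have h2 := fst_eq (wP_sp h0).fp x
        obtain ⟨c, hc1, hc2⟩ := exists_ne_zero_of_sum_ne_zero (h2 ▸ h)
        exact ⟨c, hc1, Or.inl hc2, by exact_mod_cast ((mem_ClF (wP_sp h0).fp).1 hc1).1.pos⟩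
      · rw [if_neg h]; exact zero_le
    · by_cases h : Conn c ∧ SpP D ∅ c ∧ tch c x ∧ (1 : ℝ) ≤ En c
      · rw [if_pos h, if_pos ⟨h.1, h.2.2⟩]
      · rw [if_neg h]; exact zero_le
  have h2 := one_le_pr (D := D) hβ0 (A := fun η => η x = 0) (B := fun η => η x ≠ 0) fun η _ => _root_.em _
  have h3 : exp (-1) ≤ 1 / 2 := by
    rw [Real.exp_neg, inv_le_comm₀ (exp_pos _) (by norm_num)]; linarith [add_one_le_exp (1 : ℝ)]
  linarith
end

lemma E1_par {a b} (ha : FS a) (hb : FS b) : E1 (a + b) + E1 (a - b) = 2 * E1 a + 2 * E1 b := by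
  set s := ha.gf.fs ∪ hb.gf.fs with hs
  have h1 : ∀ e, e ∉ s → gr a e = 0 ∧ gr b e = 0 := by
    intro e he; simp only [hs, Finset.mem_union, GF.mem] at he; tauto
  rw [E1_eq (η := a + b) (s := s) (fun e he => by by_contra hn; rw [gr_add] at he; simp [h1 e hn] at he),
    E1_eq (η := a - b) (s := s) (fun e he => by by_contra hn; rw [gr_sub] at he; simp [h1 e hn] at he),
    E1_eq (η := a) (s := s) (fun e he => by by_contra hn; simp [h1 e hn] at he),
    E1_eq (η := b) (s := s) (fun e he => by by_contra hn; simp [h1 e hn] at he),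
    ← sum_add_distrib, mul_sum, mul_sum, ← sum_add_distrib]
  refine sum_congr rfl fun e _ => ?_
  zify; simp only [sq_abs, gr_add, gr_sub]; ring
section
variable {β : ℝ} {D : Finset Site}
lemma pr_spike (hβ : 0 < β) {φ : Site → ℤ} (hφ : Sp D φ) (x : Site) :
    exp (-β * E1 φ) * pr β D (fun η => η x = 0) ≤ pr β D (fun η => φ x ≤ η x) := by
  refine le_pr_of hβ ?_
  rw [ofReal_mul (exp_pos _).le, mul_assoc, ← W_eq hβ]
  have h1 : W β D (fun η => φ x ≤ η x) = ∑' σ : Site → ℤ, if φ x ≤ (φ + σ) x then wD β D (φ + σ) else 0 :=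
    by rw [W, ← (Equiv.addLeft φ).tsum_eq]; exact tsum_congr fun σ => by simp only [Equiv.coe_addLeft]; by_cases h : φ x ≤ (φ + σ) x <;> simp only [h, if_true, if_false]
  have h2 : W β D (fun η => φ x ≤ η x) = ∑' σ : Site → ℤ, if φ x ≤ (φ - σ) x then wD β D (φ - σ) else 0 :=
    by rw [W, ← (Equiv.subLeft φ).tsum_eq]; exact tsum_congr fun σ => by simp only [Equiv.subLeft_apply]
  rw [← ENNReal.mul_le_mul_iff_right (a := 2) two_ne_zero ENNReal.ofNat_ne_top, two_mul (W β D fun η => φ x ≤ η x)]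
  conv_rhs => rw [h1]
  conv_rhs => arg 2; rw [← h1, h2]
  rw [← ENNReal.tsum_add, W, ← ENNReal.tsum_mul_left, ← ENNReal.tsum_mul_left]
  refine tsum_le_tsum fun σ => ?_
  by_cases hσ : σ x = 0
  swap; · simp [hσ]
  by_cases hs : Sp D σ
  swap; · simp [wD, hs]
  have s1 : Sp D (φ + σ) := fun y hy => by simp [hφ y hy, hs y hy]
  have s2 : Sp D (φ - σ) := fun y hy => by simp [hφ y hy, hs y hy]
  rw [if_pos hσ, if_pos (by simp [hσ]), if_pos (by simp [hσ])]
  unfold wD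
  rw [if_pos hs, if_pos s1, if_pos s2]
  unfold ex
  rw [← ofReal_mul (exp_pos _).le, ← exp_add, ← ofReal_add (exp_pos _).le (exp_pos _).le,
    ← ofReal_ofNat, ← ofReal_mul two_pos.le]
  refine ofReal_le_ofReal ?_
  have hp : (E1 (φ + σ) : ℝ) + E1 (φ - σ) = 2 * E1 φ + 2 * E1 σ := by exact_mod_cast E1_par hφ.fs hs.fs
  have e1 : exp (-β * E1 φ + -β * E1 σ) =
      exp (-β * E1 (φ + σ) / 2) * exp (-β * E1 (φ - σ) / 2) := by
    rw [← exp_add]; congr 1; linear_combination (-β / 2) * hp.symm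
  have e2 : ∀ t : ℝ, exp t = exp (t / 2) * exp (t / 2) := fun t => by rw [← exp_add]; ring_nf
  rw [e1, e2 (-β * E1 (φ + σ)), e2 (-β * E1 (φ - σ))]
  nlinarith [sq_nonneg (exp (-β * E1 (φ + σ) / 2) - exp (-β * E1 (φ - σ) / 2))]
lemma pr_lc (hβ : 0 < β) (x : Site) (h : ℤ) :
    pr β D (fun η => h + 2 ≤ η x) * pr β D (fun η => h ≤ η x) ≤ pr β D (fun η => h + 1 ≤ η x) ^ 2 := by
  rw [sq]
  refine pr_ff hβ zero_le_one _ _ _ _ fun η σ _ _ h1 h2 => ⟨?_, ?_⟩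
  · simp only [Pi.inf_apply, le_inf_iff]; omega
  · simp only [] at *; omega
lemma E1_single (x : Site) (h : ℤ) : E1 (fun y => if y = x then h else 0) ≤ 4 * h.natAbs ^ 2 := by
  set s : Finset Edge := {(x, true), (x, false), ((x.1, x.2 - 1), true), ((x.1 - 1, x.2), false)} with hs
  rw [E1_eq (s := s)]
  · refine (Finset.sum_le_card_nsmul s _ (h.natAbs ^ 2) fun e _ => ?_).trans ?_
    · gcongr; simp only [gr]; split_ifs <;> simp
    · rw [smul_eq_mul]; gcongr; exact Finset.card_le_four
  · intro e he
    obtain ⟨⟨a, b⟩, t⟩ := e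
    by_contra hn
    apply he
    simp only [gr]
    rw [if_neg, if_neg]; · simp
    · rintro h; subst h; cases t <;> simp [hs] at hn
    · rintro h; subst h; cases t <;> simp [hs, nb] at hn
lemma pr_floor (hβ : 2 * C2 ≤ β) (hD : Ray D) {D' : Finset Site} (hD' : D' ⊆ D) (hin : ∀ e : Edge, e.1 ∈ D' → nb e ∈ D)
    (hin' : ∀ e : Edge, nb e ∈ D' → e.1 ∈ D) {H : ℕ} :
    (exp (-(4 * β) * H ^ 2) / 2) ^ (D \ D').card * pr β D' (fun η => ∀ x ∈ D', -(H : ℤ) ≤ η x) ≤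
      pr β D (fun η => ∀ x, 0 ≤ η x) := by
  have hc := C2_ge
  have hβ0 : 0 < β := by linarith
  set φ : Site → ℤ := fun x => if x ∈ D then (H : ℤ) else 0 with hφ
  have hφs : Sp D φ := fun x hx => by simp [hφ, hx]
  set In : (Site → ℤ) → Prop := fun η => Sp D' (fun x => η x - φ x) with hIn
  have h1 : pr β D (fun η => ∀ x ∈ D \ D', (H : ℤ) ≤ η x) * pr β D (fun η => In η ∧ ∀ x, 0 ≤ η x) ≤
      pr β D In * pr β D (fun η => ∀ x, 0 ≤ η x) := by
    refine pr_ff hβ0 le_rfl _ _ _ _ fun η σ s1 s2 h1 h2 => ⟨?_, ?_⟩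
    · intro x hx
      have h3 := h2.1 x hx
      simp only [Pi.inf_apply, add_zero, hφ] at h3 ⊢
      by_cases hxD : x ∈ D
      · have := h1 x (Finset.mem_sdiff.2 ⟨hxD, hx⟩); simp only [hxD, if_true] at h3 ⊢; omega
      · have := s1 x hxD; simp only [hxD, if_false] at h3 ⊢; omega
    · intro x; have := h2.2 x; simp only [add_zero, sub_zero]; exact le_max_of_le_right this
  have key : ∀ A : (Site → ℤ) → Prop, W β D (fun η => In η ∧ A η) = ex (-β * E1 φ) * W β D' (fun η => A (fun x => η x + φ x)) := by
    intro A
    rw [W, W, ← (Equiv.addRight φ).tsum_eq, ← ENNReal.tsum_mul_left]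
    refine tsum_congr fun η => ?_
    have e0 : (Equiv.addRight φ) η = fun x => η x + φ x := rfl
    rw [e0]
    by_cases hs : Sp D' η
    · have s1 : Sp D (fun x => η x + φ x) := fun x hx => by
        simp only [hφs x hx, hs x (fun h => hx (hD' h)), add_zero]
      have s2 : In (fun x => η x + φ x) := fun x hx => by simp [hs x hx]
      by_cases hA : A (fun x => η x + φ x)
      · rw [if_pos ⟨s2, hA⟩, if_pos hA, wD, wD, if_pos hs, if_pos s1, ← ex_add]
        congr 1
        have : E1 (fun x => η x + φ x) = E1 η + E1 φ := by
          have hz : ∀ e, gr η e = 0 ∨ gr φ e = 0 := by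
            intro e
            by_cases h1 : e.1 ∈ D'
            · right; simp [gr, hφ, hD' h1, hin e h1]
            · by_cases h2 : nb e ∈ D'
              · right; simp [gr, hφ, hD' h2, hin' e h2]
              · left; simp [gr, hs _ h1, hs _ h2]
          set s := hs.fs.gf.fs ∪ hφs.fs.gf.fs with hsd
          have h1 : ∀ e, e ∉ s → gr η e = 0 ∧ gr φ e = 0 := by
            intro e he; simp only [hsd, Finset.mem_union, GF.mem] at he; tauto
          have hg : ∀ e, gr (fun x => η x + φ x) e = gr η e + gr φ e := gr_add η φ
          rw [E1_eq (s := s) (fun e he => by by_contra hn; rw [hg] at he; simp [h1 e hn] at he),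
            E1_eq (η := η) (s := s) (fun e he => by by_contra hn; simp [h1 e hn] at he),
            E1_eq (η := φ) (s := s) (fun e he => by by_contra hn; simp [h1 e hn] at he), ← sum_add_distrib]
          refine sum_congr rfl fun e _ => ?_
          rw [hg]; rcases hz e with h | h <;> simp [h]
        rw [this]; push_cast; ring
      · rw [if_neg (fun h => hA h.2), if_neg hA, mul_zero]
    · have : ¬ In (fun x => η x + φ x) := fun h => hs fun x hx => by simpa using h x hx
      rw [if_neg (fun h => this h.1), wD, if_neg hs]; simp
  have h2 : pr β D (fun η => In η ∧ ∀ x, 0 ≤ η x) = pr β D In * pr β D' (fun η => ∀ x ∈ D', -(H : ℤ) ≤ η x) := by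
    have k1 := key (fun _ => True)
    have k2 := key (fun η => ∀ x, 0 ≤ η x)
    have e1 : W β D' (fun η => ∀ x, 0 ≤ η x + φ x) = W β D' (fun η => ∀ x ∈ D', -(H : ℤ) ≤ η x) := by
      refine le_antisymm (W_mono fun η hs h x hx => ?_) (W_mono fun η hs h x => ?_)
      · have := h x; simp only [hφ, hD' hx, if_true] at this; omega
      · by_cases hx : x ∈ D'
        · have := h x hx; simp only [hφ, hD' hx, if_true]; omega
        · simp only [hs x hx, hφ, zero_add]; split_ifs <;> simp
    simp only [and_true] at k1
    rw [W_true] at k1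
    rw [e1, W_eq hβ0 (D := D')] at k2
    unfold pr at k2 ⊢
    rw [k2, show W β D In = _ from k1, ← ENNReal.toReal_mul, ENNReal.ofReal_toReal (W_div_top hβ0)]
    congr 1
    simp only [div_eq_mul_inv]; ring
  have h3 : 0 < pr β D In := by
    refine lt_of_lt_of_le (b := (ENNReal.toReal (ex (-β * E1 φ) * Z β D' / Z β D))) ?_ ?_
    · refine ENNReal.toReal_pos ?_ (ENNReal.div_ne_top (mul_ne_top (ex_ne_top _) (Z_ne_top hβ0 _)) (Z_ne_zero _ _))
      exact ENNReal.div_ne_zero.2 ⟨mul_ne_zero (ex_ne_zero _) (Z_ne_zero _ _), Z_ne_top hβ0 _⟩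
    · have k1 := key (fun _ => True)
      simp only [and_true] at k1
      rw [W_true] at k1
      rw [pr, ← k1]
  have h4 : pr β D (fun η => ∀ x ∈ D \ D', (H : ℤ) ≤ η x) * pr β D' (fun η => ∀ x ∈ D', -(H : ℤ) ≤ η x) ≤
      pr β D (fun η => ∀ x, 0 ≤ η x) := by
    rw [h2] at h1; nlinarith
  refine le_trans (mul_le_mul_of_nonneg_right ?_ pr_nonneg) h4
  refine le_trans ?_ (pr_fkg hβ0 _ _)
  rw [← prod_const]
  refine Finset.prod_le_prod (fun _ _ => by positivity) fun x hx => ?_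
  have hx' := (Finset.mem_sdiff.1 hx).1
  have h5 := pr_spike hβ0 (D := D) (φ := fun y => if y = x then (H : ℤ) else 0)
    (by intro y hy; exact if_neg (fun h : y = x => hy (h ▸ hx'))) x
  simp only [if_true] at h5
  refine le_trans ?_ h5
  rw [div_eq_mul_one_div]
  refine mul_le_mul (exp_le_exp.2 ?_) (pr_zero hβ hD x) (by norm_num) (exp_pos _).le
  have h6 := E1_single x H
  simp only [Int.natAbs_natCast] at h6
  have h7 : (E1 (fun y => if y = x then (H : ℤ) else 0) : ℝ) ≤ 4 * (H : ℝ) ^ 2 := by exact_mod_cast h6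
  nlinarith
end

section
variable {β : ℝ} {D : Finset Site}
def gW (β : ℝ) (D : Finset Site) (ℓ : (Site → ℤ) → ℝ) (t : ℝ) (u : Site → ℤ) : ℝ≥0∞ :=
  if Sp D u then ex (-(β / 2) * E1 u + t * ℓ u) else 0
def gF (β : ℝ) (D : Finset Site) (ℓ : (Site → ℤ) → ℝ) (t : ℝ) : ℝ≥0∞ := ∑' η, ex (t * ℓ η) * wD β D η
def gS (β : ℝ) (D : Finset Site) (ℓ : (Site → ℤ) → ℝ) (t : ℝ) (κ : Site → ℤ) : ℝ≥0∞ :=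
  ∑' u, if (fun x => u x % 2) = κ then gW β D ℓ t u else 0
lemma gF_mul (ℓ : (Site → ℤ) → ℝ) (hl : ∀ u v, ℓ (u + v) = ℓ u + ℓ v) (s r : ℝ) :
    gF β D ℓ s * gF β D ℓ r = ∑' κ, gS β D ℓ ((s + r) / 2) κ * gS β D ℓ ((s - r) / 2) κ := by
  have hneg : ∀ u v, ℓ (u - v) = ℓ u - ℓ v := fun u v => by
    have := hl (u - v) v; rw [sub_add_cancel] at this; linarith
  have h1 : ∀ κ, gS β D ℓ ((s + r) / 2) κ * gS β D ℓ ((s - r) / 2) κ =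
      ∑' p : (Site → ℤ) × (Site → ℤ), if (fun x => p.1 x % 2) = κ ∧ (fun x => p.2 x % 2) = κ then
        gW β D ℓ ((s + r) / 2) p.1 * gW β D ℓ ((s - r) / 2) p.2 else 0 := by
    intro κ
    rw [ENNReal.tsum_prod (f := fun a b => if (fun x => a x % 2) = κ ∧ (fun x => b x % 2) = κ then
        gW β D ℓ ((s + r) / 2) a * gW β D ℓ ((s - r) / 2) b else 0), gS, gS, ← ENNReal.tsum_mul_right]
    refine tsum_congr fun a => ?_
    rw [← ENNReal.tsum_mul_left]
    refine tsum_congr fun b => ?_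
    by_cases ha : (fun x => a x % 2) = κ <;> by_cases hb : (fun x => b x % 2) = κ <;> simp only [ha, hb, and_true, true_and, and_false, false_and, if_true, if_false, zero_mul, mul_zero]
  have h2 : ∑' κ, gS β D ℓ ((s + r) / 2) κ * gS β D ℓ ((s - r) / 2) κ =
      ∑' p : (Site → ℤ) × (Site → ℤ), if (fun x => p.2 x % 2) = (fun x => p.1 x % 2) then
        gW β D ℓ ((s + r) / 2) p.1 * gW β D ℓ ((s - r) / 2) p.2 else 0 := by
    rw [tsum_congr h1, ENNReal.tsum_comm]
    refine tsum_congr fun p => ?_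
    rw [tsum_eq_single (fun x => p.1 x % 2)]
    · simp only [true_and]
    · intro κ hκ; rw [if_neg]; rintro ⟨h, -⟩; exact hκ h.symm
  rw [h2]
  have hinj : Function.Injective (fun p : (Site → ℤ) × (Site → ℤ) => (p.1 + p.2, p.1 - p.2)) := by
    rintro ⟨a, b⟩ ⟨c, d⟩ h
    simp only [Prod.mk.injEq, funext_iff, Pi.add_apply, Pi.sub_apply] at h
    obtain ⟨h3, h4⟩ := h
    ext x <;> have := h3 x <;> have := h4 x <;> simp only <;> omega
  rw [← hinj.tsum_eq]
  · unfold gF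
    rw [← ENNReal.tsum_mul_right, ENNReal.tsum_prod (f := fun a b : Site → ℤ => if (fun x => (a - b) x % 2) = (fun x => (a + b) x % 2) then
        gW β D ℓ ((s + r) / 2) (a + b) * gW β D ℓ ((s - r) / 2) (a - b) else 0)]
    refine tsum_congr fun a => ?_
    rw [← ENNReal.tsum_mul_left]
    refine tsum_congr fun b => ?_
    rw [if_pos (by ext x; simp only [Pi.add_apply, Pi.sub_apply]; omega)]
    unfold gW wD
    by_cases h : Sp D a ∧ Sp D b
    · obtain ⟨ha, hb⟩ := h
      have s1 : Sp D (a + b) := fun x hx => by simp [ha x hx, hb x hx]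
      have s2 : Sp D (a - b) := fun x hx => by simp [ha x hx, hb x hx]
      rw [if_pos ha, if_pos hb, if_pos s1, if_pos s2]
      simp only [← ex_add]
      congr 1
      have hp : (E1 (a + b) : ℝ) + E1 (a - b) = 2 * E1 a + 2 * E1 b := by exact_mod_cast E1_par ha.fs hb.fs
      rw [hl, hneg]
      linear_combination (β / 2) * hp
    · have : ¬ (Sp D (a + b) ∧ Sp D (a - b)) := by
        rintro ⟨s1, s2⟩; apply h
        constructor <;> intro x hx <;> have e1 := s1 x hx <;> have e2 := s2 x hx <;>
          simp only [Pi.add_apply, Pi.sub_apply] at e1 e2 <;> omega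
      rcases not_and_or.1 h with h | h <;> rcases not_and_or.1 this with h' | h' <;> simp [h, h']
  · rintro ⟨u, v⟩ h
    rw [Function.mem_support] at h
    have hp : (fun x => v x % 2) = fun x => u x % 2 := by by_contra hn; exact h (if_neg hn)
    refine ⟨((fun x => (u x + v x) / 2), fun x => (u x - v x) / 2), ?_⟩
    simp only [Prod.mk.injEq]
    constructor <;> ext x <;> have := congr_fun hp x <;> simp only [Pi.add_apply, Pi.sub_apply] at this ⊢ <;> omega
lemma amgm (x y m : ℝ≥0∞) : 2 * m * (x * y) ≤ x * x + m * m * (y * y) := by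
  have : ∀ a b : ℝ≥0∞, 2 * (a * b) ≤ a * a + b * b := by
    intro a b
    rcases le_total a b with h | h
    · obtain ⟨c, rfl⟩ := le_iff_exists_add.1 h
      have : a * a + (a + c) * (a + c) = 2 * (a * (a + c)) + c * c := by ring
      rw [this]; exact le_self_add
    · obtain ⟨c, rfl⟩ := le_iff_exists_add.1 h
      have : (b + c) * (b + c) + b * b = 2 * ((b + c) * b) + c * c := by ring
      rw [this]; exact le_self_add
  calc _ = 2 * (x * (m * y)) := by ring
    _ ≤ _ := this _ _
    _ = _ := by ring
lemma gF_zero (ℓ) : gF β D ℓ 0 = Z β D := by simp [gF, Z, ex_zero]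
lemma gF_top (hβ : 0 < β) {ℓ : (Site → ℤ) → ℝ} {K κ : ℝ} (hK0 : 0 ≤ K) (hκ : 0 < κ) (hκ1 : κ < 1)
    (hK : ∀ u, Sp D u → ℓ u ^ 2 ≤ K * E1 u) (t : ℝ) :
    gF β D ℓ t ≤ ex (t ^ 2 * (K / (4 * β * κ))) * Z ((1 - κ) * β) D := by
  rw [gF, Z, ← ENNReal.tsum_mul_left]
  refine tsum_le_tsum fun u => ?_
  unfold wD
  split_ifs with hs
  swap; · simp
  rw [← ex_add, ← ex_add]
  refine ex_mono ?_
  have h1 := hK u hs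
  have h2 : t * ℓ u ≤ κ * β * E1 u + t ^ 2 * (K / (4 * β * κ)) := by
    have hA : 0 ≤ κ * β * E1 u := by positivity
    have hB : 0 ≤ t ^ 2 * (K / (4 * β * κ)) := by positivity
    have hAB : 4 * (κ * β * E1 u * (t ^ 2 * (K / (4 * β * κ)))) = t ^ 2 * (K * E1 u) := by field_simp
    refine le_of_abs_le (abs_le_of_sq_le_sq ?_ (by positivity))
    nlinarith [sq_nonneg (κ * β * E1 u - t ^ 2 * (K / (4 * β * κ))), mul_le_mul_of_nonneg_left h1 (sq_nonneg t)]
  linarith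
theorem gdom (hβ : 0 < β) {ℓ : (Site → ℤ) → ℝ} (hl : ∀ u v, ℓ (u + v) = ℓ u + ℓ v) {K κ : ℝ} (hK0 : 0 ≤ K) (hκ : 0 < κ) (hκ1 : κ < 1)
    (hK : ∀ u, Sp D u → ℓ u ^ 2 ≤ K * E1 u) (t : ℝ) :
    gF β D ℓ t ≤ ex (t ^ 2 * (K / (4 * β * κ))) * Z β D := by
  set f : ℝ → ℝ := fun t => (gF β D ℓ t / Z β D).toReal with hf
  have htop : ∀ t, gF β D ℓ t ≠ ⊤ := fun t => ne_top_of_le_ne_top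
    (mul_ne_top (ex_ne_top _) (Z_ne_top (by nlinarith) D)) (gF_top hβ hK0 hκ hκ1 hK t)
  have hdt : ∀ t, gF β D ℓ t / Z β D ≠ ⊤ := fun t => ENNReal.div_ne_top (htop t) (Z_ne_zero _ _)
  have hfe : ∀ t, gF β D ℓ t = ofReal (f t) * Z β D := fun t => by
    rw [hf]; simp only; rw [ENNReal.ofReal_toReal (hdt t), ENNReal.div_mul_cancel (Z_ne_zero _ _) (Z_ne_top hβ _)]
  have hf0 : ∀ t, 0 ≤ f t := fun t => ENNReal.toReal_nonneg
  have hZt := Z_ne_top hβ D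
  have hZ0 := Z_ne_zero β D
  have step : ∀ t, f t ^ 4 ≤ f (2 * t) := by
    intro t
    have e1 := gF_mul (β := β) (D := D) ℓ hl (2 * t) 0
    have e2 := gF_mul (β := β) (D := D) ℓ hl t t
    have e3 := gF_mul (β := β) (D := D) ℓ hl 0 0
    simp only [add_zero, sub_zero, mul_div_cancel_left₀ t (two_ne_zero' ℝ), add_self_div_two, sub_self, zero_div, gF_zero] at e1 e2 e3
    set m := ofReal (f t ^ 2) with hm
    have h1 : 2 * m * (gF β D ℓ t * gF β D ℓ t) ≤ gF β D ℓ (2 * t) * Z β D + m * m * (Z β D * Z β D) := by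
      rw [e1, e2, e3, ← ENNReal.tsum_mul_left, ← ENNReal.tsum_mul_left, ← ENNReal.tsum_add]
      exact tsum_le_tsum fun κ => amgm _ _ _
    rw [hfe t, hfe (2 * t)] at h1
    have h2 : (2 * m * (ofReal (f t) * ofReal (f t))) * (Z β D * Z β D) ≤
        (ofReal (f (2 * t)) + m * m) * (Z β D * Z β D) := by
      refine le_trans (le_of_eq ?_) (h1.trans (le_of_eq ?_)) <;> ring
    rw [ENNReal.mul_le_mul_iff_left (mul_ne_zero hZ0 hZ0) (mul_ne_top hZt hZt), hm,
      ← ofReal_ofNat, ← ofReal_mul (hf0 t), ← ofReal_mul two_pos.le, ← ofReal_mul (by positivity),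
      ← ofReal_mul (by positivity), ← ofReal_add (hf0 _) (by positivity),
      ENNReal.ofReal_le_ofReal_iff (add_nonneg (hf0 _) (by positivity))] at h2
    nlinarith
  set K' := K / (4 * β * κ) with hK'
  obtain ⟨Cs, hCs⟩ : ∃ Cs : ℝ, ∀ t, f t ≤ exp (t ^ 2 * K') * Cs := by
    refine ⟨(Z ((1 - κ) * β) D / Z β D).toReal, fun t => ?_⟩
    have h1 := gF_top (β := β) (D := D) hβ hK0 hκ hκ1 hK t
    have h2 : gF β D ℓ t / Z β D ≤ ex (t ^ 2 * K') * (Z ((1 - κ) * β) D / Z β D) := by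
      rw [← mul_div_assoc]; exact ENNReal.div_le_div_right h1 _
    have h3 : Z ((1 - κ) * β) D / Z β D ≠ ⊤ := ENNReal.div_ne_top (Z_ne_top (by nlinarith) D) hZ0
    have h4 := ENNReal.toReal_mono (mul_ne_top (ex_ne_top _) h3) h2
    rwa [ENNReal.toReal_mul, ex, ENNReal.toReal_ofReal (exp_pos _).le] at h4
  have hit : ∀ n : ℕ, f t ^ (4 ^ n) ≤ f (2 ^ n * t) := by
    intro n
    induction n with
    | zero => simp
    | succ n ih =>
      rw [pow_succ 4 n, pow_mul, show (2 : ℝ) ^ (n + 1) * t = 2 * (2 ^ n * t) by ring]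
      exact (pow_le_pow_left₀ (by have := hf0 t; positivity) ih 4).trans (step _)
  have hfin : f t ≤ exp (t ^ 2 * K') := by
    by_contra! hlt
    set q := f t / exp (t ^ 2 * K') with hq
    have hq1 : 1 < q := by rw [hq, one_lt_div (exp_pos _)]; exact hlt
    obtain ⟨n, hn⟩ := pow_unbounded_of_one_lt Cs hq1
    have h1 : q ^ n ≤ q ^ (4 ^ n) := pow_le_pow_right₀ hq1.le (Nat.lt_pow_self (by norm_num)).le
    have h2 : q ^ (4 ^ n) ≤ Cs := by
      rw [hq, div_pow, div_le_iff₀ (by positivity), ← exp_nat_mul, mul_comm Cs]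
      refine (hit n).trans ((hCs _).trans (le_of_eq ?_))
      congr 2
      push_cast
      rw [mul_pow, ← pow_mul, mul_comm n 2, pow_mul]; norm_num; ring
    linarith
  rw [hfe t]
  exact mul_le_mul_left (ofReal_le_ofReal hfin) _
theorem pr_gauss (hβ : 0 < β) {ℓ : (Site → ℤ) → ℝ} (hl : ∀ u v, ℓ (u + v) = ℓ u + ℓ v) {K κ : ℝ} (hK0 : 0 < K) (hκ : 0 < κ) (hκ1 : κ < 1)
    (hK : ∀ u, Sp D u → ℓ u ^ 2 ≤ K * E1 u) {y : ℝ} (hy : 0 ≤ y) :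
    pr β D (fun η => y ≤ ℓ η) ≤ exp (-(β * κ * y ^ 2 / K)) := by
  set t := 2 * β * κ * y / K with ht
  have ht0 : 0 ≤ t := by positivity
  refine pr_le_of hβ (exp_pos _).le ?_
  have h1 : ex (t * y) * W β D (fun η => y ≤ ℓ η) ≤ gF β D ℓ t := by
    rw [W, gF, ← ENNReal.tsum_mul_left]
    refine tsum_le_tsum fun η => ?_
    by_cases h : y ≤ ℓ η
    · rw [if_pos h]; exact mul_le_mul_left (ex_mono (by gcongr)) _
    · rw [if_neg h]; simp
  have h2 := h1.trans (gdom hβ hl hK0.le hκ hκ1 hK t)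
  have h3 : W β D (fun η => y ≤ ℓ η) = ex (-(t * y)) * (ex (t * y) * W β D (fun η => y ≤ ℓ η)) := by
    rw [← mul_assoc, ← ex_add]; simp [ex_zero]
  rw [h3]
  refine (mul_le_mul_right h2 _).trans (le_of_eq ?_)
  rw [← mul_assoc, ← ex_add]
  congr 1
  unfold ex; congr 2; rw [ht]; field_simp; ring
end

def aA (n m : ℤ) : ℝ := arctan ((m + 1 / 2) / (n + 1 / 2))
def thF (a b : ℤ) : ℝ := aA a b - aA a (b - 1)
def sgn2 (n : ℤ) : ℝ := if 0 ≤ n then 1 else -1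
lemma half_pos_or (n : ℤ) : (0 ≤ n ∧ (0 : ℝ) < n + 1 / 2) ∨ (¬ 0 ≤ n ∧ (n : ℝ) + 1 / 2 < 0) := by
  by_cases h : 0 ≤ n
  · left; refine ⟨h, ?_⟩; have : (0 : ℝ) ≤ n := by exact_mod_cast h
    linarith
  · right; refine ⟨h, ?_⟩; have : (n : ℝ) ≤ -1 := by exact_mod_cast (by omega : n ≤ -1)
    linarith
lemma aA_sum (n m : ℤ) : aA n m + aA m n = Real.pi / 2 * sgn2 n * sgn2 m := by
  have e : aA m n = arctan (((m + 1 / 2 : ℝ) / (n + 1 / 2))⁻¹) := by rw [aA, inv_div]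
  rw [e, aA]
  rcases half_pos_or n with ⟨h1, h2⟩ | ⟨h1, h2⟩ <;> rcases half_pos_or m with ⟨h3, h4⟩ | ⟨h3, h4⟩ <;>
    simp only [sgn2, h1, h3, if_true, if_false]
  · rw [Real.arctan_inv_of_pos (div_pos h4 h2)]; ring
  · rw [Real.arctan_inv_of_neg (div_neg_of_neg_of_pos h4 h2)]; ring
  · rw [Real.arctan_inv_of_neg (div_neg_of_pos_of_neg h4 h2)]; ring
  · rw [Real.arctan_inv_of_pos (div_pos_of_neg_of_neg h4 h2)]; ring
lemma thF_div (a b : ℤ) : (thF a b - thF (a - 1) b) + (thF b a - thF (b - 1) a) =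
    if a = 0 ∧ b = 0 then 2 * Real.pi else 0 := by
  have : (thF a b - thF (a - 1) b) + (thF b a - thF (b - 1) a) =
      (aA a b + aA b a) - (aA a (b - 1) + aA (b - 1) a) - (aA (a - 1) b + aA b (a - 1)) + (aA (a - 1) (b - 1) + aA (b - 1) (a - 1)) := by
    unfold thF; ring
  rw [this, aA_sum, aA_sum, aA_sum, aA_sum]
  unfold sgn2
  split_ifs <;> first | omega | ring
lemma abel (g w : ℤ → ℝ) (m : ℤ) (n : ℕ) : ∑ i ∈ range n, g (m + i) * (w (m + i) - w (m + i + 1)) =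
    ∑ i ∈ range (n + 1), w (m + i) * (g (m + i) - g (m + i - 1)) - w (m + n) * g (m + n) + w m * g (m - 1) := by
  induction n with
  | zero => simp; ring
  | succ n ih =>
    rw [sum_range_succ, ih, sum_range_succ _ (n + 1)]
    push_cast
    rw [show m + ((n : ℤ) + 1) - 1 = m + n by ring, show m + ((n : ℤ) + 1) = m + n + 1 by ring]
    ring
lemma at_deriv {α : ℝ} (hα : α ≠ 0) (y : ℝ) : HasDerivAt (fun y => arctan (y / α)) (α / (α ^ 2 + y ^ 2)) y := by
  have h := ((hasDerivAt_id y).div_const α).arctan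
  refine h.congr_deriv ?_
  have : (0 : ℝ) < α ^ 2 + y ^ 2 := by positivity
  simp only [id]
  field_simp
lemma sq_le_of_deriv {f G f' : ℝ → ℝ} (hf : ∀ y, HasDerivAt f (f' y) y) (hG : ∀ y, HasDerivAt G (f' y ^ 2) y) (y : ℝ) :
    (f (y + 1) - f y) ^ 2 ≤ G (y + 1) - G y := by
  set c := f (y + 1) - f y with hc
  have hd : ∀ z, HasDerivAt (fun z => G z - 2 * c * f z + c ^ 2 * z) (f' z ^ 2 - 2 * c * f' z + c ^ 2 * 1) z := fun z =>
    ((hG z).sub ((hf z).const_mul _)).add ((hasDerivAt_id z).const_mul _)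
  have hm : Monotone (fun z => G z - 2 * c * f z + c ^ 2 * z) :=
    monotone_of_deriv_nonneg (fun z => (hd z).differentiableAt) fun z => by
      rw [(hd z).deriv]; nlinarith [sq_nonneg (f' z - c)]
  have := hm (show y ≤ y + 1 by linarith)
  simp only at this
  nlinarith
def gG (α y : ℝ) : ℝ := (1 / 2) * ((1 / α) * arctan (y / α) + y / (α ^ 2 + y ^ 2))
lemma gG_deriv {α : ℝ} (hα : α ≠ 0) (y : ℝ) : HasDerivAt (gG α) ((α / (α ^ 2 + y ^ 2)) ^ 2) y := by
  have h0 : (0 : ℝ) < α ^ 2 + y ^ 2 := by positivity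
  have h := (((at_deriv hα y).const_mul (1 / α)).add ((hasDerivAt_id y).div (((hasDerivAt_id y).pow 2).const_add (α ^ 2)) h0.ne')).const_mul (1 / 2)
  refine HasDerivAt.congr_deriv (f' := _) (h.congr_of_eventuallyEq ?_) ?_
  · exact Filter.Eventually.of_forall fun z => by simp [gG]
  · simp only [id, Pi.pow_apply]
    field_simp
    ring
lemma half_ne (n : ℤ) : (n : ℝ) + 1 / 2 ≠ 0 := by
  rcases half_pos_or n with h | h
  · exact h.2.ne'
  · exact h.2.ne
lemma thF_sq (a b : ℤ) : thF a b ^ 2 ≤ gG (a + 1 / 2) (b - 1 / 2 + 1) - gG (a + 1 / 2) (b - 1 / 2) := by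
  have := sq_le_of_deriv (at_deriv (half_ne a)) (gG_deriv (half_ne a)) (b - 1 / 2)
  refine le_trans (le_of_eq ?_) this
  unfold thF aA; push_cast; congr 3 <;> congr 1 <;> ring
lemma at_lip (x y : ℝ) : |arctan x - arctan y| ≤ |x - y| := by
  have := Convex.norm_image_sub_le_of_norm_deriv_le (f := arctan) (C := 1) (s := Set.univ) (x := y) (y := x)
    (fun z _ => Real.differentiable_arctan z) (fun z _ => by
      rw [Real.deriv_arctan, Real.norm_eq_abs, abs_of_pos (by positivity), div_le_one (by positivity)]
      nlinarith [sq_nonneg z]) convex_univ trivial trivial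
  simpa using this
lemma thF_abs (a b : ℤ) : |thF a b| ≤ 1 / |(a : ℝ) + 1 / 2| := by
  refine (at_lip _ _).trans (le_of_eq ?_)
  rw [← sub_div, abs_div]; push_cast; congr 1; ring_nf; simp
lemma sum_half (n : ℕ) (hn : 1 ≤ n) : ∑ i ∈ range n, 1 / ((i : ℝ) + 1 / 2) ≤ 3 + log n := by
  obtain ⟨m, rfl⟩ : ∃ m, n = m + 1 := ⟨n - 1, by omega⟩
  rw [Finset.sum_range_succ']
  have h1 : ∑ i ∈ range m, 1 / (((i + 1 : ℕ) : ℝ) + 1 / 2) ≤ (harmonic m : ℝ) := by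
    rw [harmonic]; push_cast
    refine sum_le_sum fun i _ => ?_
    rw [← one_div]; exact one_div_le_one_div_of_le (by positivity) (by linarith)
  have h2 := harmonic_le_one_add_log m
  have h3 : log m ≤ log ((m + 1 : ℕ) : ℝ) := by
    rcases Nat.eq_zero_or_pos m with rfl | h
    · simp
    · apply log_le_log (by exact_mod_cast h); push_cast; linarith
  norm_num at h1 ⊢; norm_num at h3; linarith
lemma row_en (R : ℕ) (hR : 1 ≤ R) (a : ℤ) :
    ∑ j ∈ range (2 * R + 1), thF a (-R + j) ^ 2 ≤ Real.pi / 2 * (1 / |(a : ℝ) + 1 / 2|) + 1 / R := by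
  have hR' : (1 : ℝ) ≤ R := by exact_mod_cast hR
  have h1 : ∑ j ∈ range (2 * R + 1), thF a (-R + j) ^ 2 ≤ gG (a + 1 / 2) (R + 1 / 2) - gG (a + 1 / 2) (-(R + 1 / 2)) := by
    have := Finset.sum_range_sub (fun j : ℕ => gG (a + 1 / 2) (-R + j - 1 / 2)) (2 * R + 1)
    refine (sum_le_sum fun (j : ℕ) _ => thF_sq a (-(R : ℤ) + (j : ℤ))).trans (le_of_eq ?_)
    refine Eq.trans (sum_congr rfl fun j _ => ?_) (this.trans ?_)
    · push_cast; ring_nf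
    · push_cast; ring_nf
  refine h1.trans ?_
  set α : ℝ := a + 1 / 2 with hα
  set y : ℝ := R + 1 / 2 with hy
  have hα0 : α ≠ 0 := half_ne a
  have e : gG α y - gG α (-y) = (1 / α) * arctan (y / α) + y / (α ^ 2 + y ^ 2) := by
    unfold gG; rw [neg_div, Real.arctan_neg]; ring
  rw [e]
  gcongr ?_ + ?_
  · refine (le_abs_self _).trans ?_
    rw [abs_mul, abs_div, abs_one, mul_comm]
    gcongr
    exact abs_le.2 ⟨(Real.neg_pi_div_two_lt_arctan _).le, (Real.arctan_lt_pi_div_two _).le⟩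
  · rw [div_le_div_iff₀ (by positivity) (by positivity)]
    nlinarith [sq_nonneg α]
lemma tot_en (R : ℕ) (hR : 1 ≤ R) :
    ∑ i ∈ range (2 * R), ∑ j ∈ range (2 * R + 1), thF (-R + i) (-R + j) ^ 2 ≤ Real.pi * (3 + log R) + 2 := by
  have hR' : (1 : ℝ) ≤ R := by exact_mod_cast hR
  refine (sum_le_sum fun i _ => row_en R hR _).trans ?_
  rw [sum_add_distrib, ← mul_sum]
  have h1 : ∑ i ∈ range (2 * R), 1 / |((-R + i : ℤ) : ℝ) + 1 / 2| ≤ 2 * (3 + log R) := by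
    rw [two_mul, Finset.sum_range_add, ← Finset.sum_range_reflect]
    have e1 : ∀ i ∈ range R, 1 / |((-R + (R - 1 - i : ℕ) : ℤ) : ℝ) + 1 / 2| = 1 / ((i : ℝ) + 1 / 2) := by
      intro i hi
      have hi := Finset.mem_range.1 hi
      have : ((R - 1 - i : ℕ) : ℤ) = R - 1 - i := by omega
      rw [this]; push_cast
      rw [show -(R : ℝ) + (R - 1 - i) + 1 / 2 = -(i + 1 / 2) by ring, abs_neg, abs_of_pos (by positivity)]
    have e2 : ∀ i ∈ range R, 1 / |((-R + (R + i : ℕ) : ℤ) : ℝ) + 1 / 2| = 1 / ((i : ℝ) + 1 / 2) := by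
      intro i hi
      push_cast
      rw [show -(R : ℝ) + (R + i) + 1 / 2 = (i + 1 / 2) by ring, abs_of_pos (by positivity)]
    rw [sum_congr rfl e1, sum_congr rfl e2]
    linarith [sum_half R hR]
  have h2 : ∑ i ∈ range (2 * R), 1 / (R : ℝ) = 2 := by
    rw [sum_const, Finset.card_range]; simp; field_simp
  rw [h2]
  nlinarith [pi_pos]
def edg (R : ℕ) (p : (ℕ × ℕ) × Bool) : Edge :=
  if p.2 then ((-R + (p.1.2 : ℤ), -R + (p.1.1 : ℤ)), true) else ((-R + (p.1.1 : ℤ), -R + (p.1.2 : ℤ)), false)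
lemma edg_inj (R) : Function.Injective (edg R) := by
  rintro ⟨⟨a, b⟩, c⟩ ⟨⟨a', b'⟩, c'⟩ h
  cases c <;> cases c' <;> simp [edg] at h ⊢ <;> tauto
def ringS (R : ℕ) (u : Site → ℤ) : ℝ := ∑ j ∈ range (2 * R + 1),
  (|(u (R, -R + j) : ℝ)| + |(u (-R, -R + j) : ℝ)| + |(u (-R + j, R) : ℝ)| + |(u (-R + j, -R) : ℝ)|)
def lF (R : ℕ) (u : Site → ℤ) : ℝ := -(1 / (2 * Real.pi)) *
  ∑ p ∈ (range (2 * R) ×ˢ range (2 * R + 1)) ×ˢ (Finset.univ : Finset Bool), thF (-R + p.1.1) (-R + p.1.2) * gr u (edg R p)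
lemma lF_add (R u v) : lF R (u + v) = lF R u + lF R v := by
  unfold lF; rw [← mul_add, ← sum_add_distrib]; congr 1
  exact sum_congr rfl fun p _ => by rw [gr_add]; push_cast; ring
lemma lF_sq {R : ℕ} (hR : 1 ≤ R) {u} (hu : FS u) : lF R u ^ 2 ≤ (log R / (2 * Real.pi) + 1) * E1 u := by
  have hpi := pi_gt_three
  unfold lF
  set P := (range (2 * R) ×ˢ range (2 * R + 1)) ×ˢ (Finset.univ : Finset Bool) with hP
  have h1 := Finset.sum_mul_sq_le_sq_mul_sq P (fun p => thF (-R + p.1.1) (-R + p.1.2)) (fun p => (gr u (edg R p) : ℝ))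
  have h2 : ∑ p ∈ P, (gr u (edg R p) : ℝ) ^ 2 ≤ E1 u := by
    have h := E1_ge hu.gf (P.image (edg R))
    rw [sum_image (fun a _ b _ h => edg_inj R h)] at h
    have h' : ((∑ p ∈ P, (gr u (edg R p)).natAbs ^ 2 : ℕ) : ℝ) ≤ E1 u := by exact_mod_cast h
    push_cast at h'
    simpa [Nat.cast_natAbs, sq_abs] using h'
  have h3 : ∑ p ∈ P, thF (-R + p.1.1) (-R + p.1.2) ^ 2 ≤ 2 * (Real.pi * (3 + log R) + 2) := by
    rw [hP, sum_product, sum_product]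
    simp only [sum_const, Finset.card_univ, Fintype.card_bool, ← Finset.smul_sum, nsmul_eq_mul, ← mul_sum]
    exact_mod_cast mul_le_mul_of_nonneg_left (tot_en R hR) two_pos.le
  have h4 : (0 : ℝ) ≤ ∑ p ∈ P, (gr u (edg R p) : ℝ) ^ 2 := sum_nonneg fun _ _ => sq_nonneg _
  have hlog : 0 ≤ log R := Real.log_natCast_nonneg R
  have h5 := h1.trans (mul_le_mul h3 h2 h4 (by positivity))
  rw [mul_pow, neg_sq]
  have h6 : (1 / (2 * Real.pi)) ^ 2 * (2 * (Real.pi * (3 + log R) + 2)) ≤ log R / (2 * Real.pi) + 1 := by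
    have : log R / (2 * Real.pi) + 1 - (1 / (2 * Real.pi)) ^ 2 * (2 * (Real.pi * (3 + log R) + 2)) =
      (4 * Real.pi ^ 2 - 6 * Real.pi - 4) / (4 * Real.pi ^ 2) := by field_simp; ring
    have h7 : 0 ≤ (4 * Real.pi ^ 2 - 6 * Real.pi - 4) / (4 * Real.pi ^ 2) := div_nonneg (by nlinarith) (by positivity)
    linarith
  calc _ ≤ (1 / (2 * Real.pi)) ^ 2 * (2 * (Real.pi * (3 + log R) + 2) * E1 u) := by gcongr
    _ = ((1 / (2 * Real.pi)) ^ 2 * (2 * (Real.pi * (3 + log R) + 2))) * E1 u := by ring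
    _ ≤ _ := by gcongr
lemma lF_ring {R : ℕ} (hR : 1 ≤ R) (u : Site → ℤ) : |u 0 - lF R u| ≤ (1 / R) * ringS R u := by
  have hpi := pi_gt_three
  have hR' : (1 : ℝ) ≤ R := by exact_mod_cast hR
  set T := ∑ j ∈ range (2 * R + 1), (((u (R, -R + j) : ℝ) * thF R (-R + j) - (u (-R, -R + j) : ℝ) * thF (-R - 1) (-R + j)) +
    ((u (-R + j, R) : ℝ) * thF R (-R + j) - (u (-R + j, -R) : ℝ) * thF (-R - 1) (-R + j))) with hT
  have h1 : 2 * Real.pi * lF R u = 2 * Real.pi * u 0 - T := by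
    have e1 : 2 * Real.pi * lF R u = ∑ j ∈ range (2 * R + 1), (∑ i ∈ range (2 * R),
        thF (-R + i) (-R + j) * ((u (-R + i, -R + j) : ℝ) - u (-R + i + 1, -R + j)) +
        ∑ i ∈ range (2 * R), thF (-R + i) (-R + j) * ((u (-R + j, -R + i) : ℝ) - u (-R + j, -R + i + 1))) := by
      unfold lF
      rw [← mul_assoc, show 2 * Real.pi * -(1 / (2 * Real.pi)) = -1 by field_simp, sum_product, sum_product, sum_comm,
        mul_sum]
      refine sum_congr rfl fun j _ => ?_
      rw [mul_sum, ← sum_add_distrib]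
      refine sum_congr rfl fun i _ => ?_
      simp only [Fintype.sum_bool, edg, gr, nb, if_true]
      simp; ring
    rw [e1]
    have e2 : ∀ j ∈ range (2 * R + 1), (∑ i ∈ range (2 * R),
        thF (-R + i) (-R + j) * ((u (-R + i, -R + j) : ℝ) - u (-R + i + 1, -R + j)) +
        ∑ i ∈ range (2 * R), thF (-R + i) (-R + j) * ((u (-R + j, -R + i) : ℝ) - u (-R + j, -R + i + 1))) =
        ∑ i ∈ range (2 * R + 1), ((u (-R + i, -R + j) : ℝ) * (thF (-R + i) (-R + j) - thF (-R + i - 1) (-R + j))) +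
        ∑ i ∈ range (2 * R + 1), ((u (-R + j, -R + i) : ℝ) * (thF (-R + i) (-R + j) - thF (-R + i - 1) (-R + j))) -
        (((u (R, -R + j) : ℝ) * thF R (-R + j) - (u (-R, -R + j) : ℝ) * thF (-R - 1) (-R + j)) +
    ((u (-R + j, R) : ℝ) * thF R (-R + j) - (u (-R + j, -R) : ℝ) * thF (-R - 1) (-R + j))) := by
      intro j _
      have a1 := abel (fun a => thF a (-R + j)) (fun a => (u (a, -R + j) : ℝ)) (-R) (2 * R)
      have a2 := abel (fun a => thF a (-R + j)) (fun a => (u (-R + j, a) : ℝ)) (-R) (2 * R)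
      have e3 : -(R : ℤ) + (2 * R : ℕ) = R := by push_cast; ring
      rw [e3] at a1 a2
      rw [a1, a2]; ring
    rw [sum_congr rfl e2, Finset.sum_sub_distrib, sum_add_distrib]
    rw [hT]; congr 1
    rw [sum_comm, ← sum_add_distrib]
    have e4 : ∀ i ∈ range (2 * R + 1), (∑ j ∈ range (2 * R + 1), ((u (-R + i, -R + j) : ℝ) * (thF (-R + i) (-R + j) - thF (-R + i - 1) (-R + j))) +
        ∑ j ∈ range (2 * R + 1), ((u (-R + i, -R + j) : ℝ) * (thF (-R + j) (-R + i) - thF (-R + j - 1) (-R + i)))) =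
        ∑ j ∈ range (2 * R + 1), if i = R ∧ j = R then 2 * Real.pi * u 0 else 0 := by
      intro i _
      rw [← sum_add_distrib]
      refine sum_congr rfl fun j _ => ?_
      rw [← mul_add, thF_div]
      by_cases h : i = R ∧ j = R
      · obtain ⟨rfl, rfl⟩ := h; simp; rw [mul_comm]; rfl
      · rw [if_neg h, if_neg (by omega), mul_zero]
    rw [sum_congr rfl e4, sum_eq_single_of_mem R (Finset.mem_range.2 (by omega)),
      sum_eq_single_of_mem R (Finset.mem_range.2 (by omega))]
    · simp
    · intro j _ hj; simp [hj]
    · intro i _ hi; exact sum_eq_zero fun j _ => by simp [hi]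
  have h2 : |T| ≤ (1 / R) * ringS R u := by
    rw [hT, ringS, mul_sum]
    refine (Finset.abs_sum_le_sum_abs _ _).trans (sum_le_sum fun j _ => ?_)
    have b1 : |thF R (-R + j)| ≤ 1 / R := by
      refine (thF_abs _ _).trans (one_div_le_one_div_of_le (by positivity) ?_)
      rw [abs_of_pos (by positivity)]; push_cast; linarith
    have b2 : |thF (-R - 1) (-R + j)| ≤ 1 / R := by
      refine (thF_abs _ _).trans (one_div_le_one_div_of_le (by positivity) ?_)
      push_cast; rw [abs_of_neg (by linarith)]; linarith
    have c : ∀ (z : ℤ) (t : ℝ), |t| ≤ 1 / R → |(z : ℝ) * t| ≤ 1 / R * |(z : ℝ)| := fun z t ht => by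
      rw [abs_mul, mul_comm]; gcongr
    refine (abs_add_le _ _).trans ?_
    have d1 := abs_sub ((u (R, -R + j) : ℝ) * thF R (-R + j)) ((u (-R, -R + j) : ℝ) * thF (-R - 1) (-R + j))
    have d2 := abs_sub ((u (-R + j, R) : ℝ) * thF R (-R + j)) ((u (-R + j, -R) : ℝ) * thF (-R - 1) (-R + j))
    have := c (u (R, -R + j)) _ b1
    have := c (u (-R, -R + j)) _ b2
    have := c (u (-R + j, R)) _ b1
    have := c (u (-R + j, -R)) _ b2
    linarith
  have h3 : |u 0 - lF R u| = |T| / (2 * Real.pi) := by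
    rw [show T = 2 * Real.pi * (u 0 - lF R u) by linarith, abs_mul, abs_of_pos (by positivity : 0 < 2 * Real.pi)]; field_simp
  rw [h3]
  exact (div_le_self (abs_nonneg _) (by linarith)).trans h2

section
variable {β : ℝ} {D : Finset Site}
lemma pr_line (hβ : 2 * C2 ≤ β) (hD : Ray D) (b : Bool) (S : Finset Site)
    (hS : Set.InjOn (fun x : Site => if b then x.1 else x.2) S) (y : ℝ) :
    pr β D (fun η => y ≤ ∑ x ∈ S, |(η x : ℝ)|) ≤ 2 * exp (β * (S.card + 1) - β / 2 * y) := by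
  have hc := C2_ge
  have := pr_tilt (A := fun η => y ≤ ∑ x ∈ S, |(η x : ℝ)|) hβ hD S (s := β / 2) (n0 := 1) (M := β / 2 * (S.card + 1))
    (by linarith) (fun c x => |(c.1 x : ℝ)|) (fun _ _ => abs_nonneg _)
    (fun c x hc h0 => ⟨Or.inl fun h => h0 (by simp [h]), by exact_mod_cast hc.pos, abs_le_En hc.1 x⟩)
    (fun c hc' _ => by
      have h := sum_line hc'.1.1 b S hS
      have h1 : ∑ x ∈ S, |(c.1 x : ℝ)| ≤ En c := by
        have h2 : ((∑ x ∈ S, (c.1 x).natAbs : ℕ) : ℝ) ≤ En c := by exact_mod_cast h.trans (by simp [En])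
        push_cast at h2
        simpa [Nat.cast_natAbs] using h2
      exact mul_le_mul_of_nonneg_left h1 (by linarith)) (by have : (0 : ℝ) ≤ S.card := Nat.cast_nonneg _
                                                            nlinarith)
    (by
      have h1 := exp_small hβ
      have h2 : (0 : ℝ) ≤ β / 2 * S.card := mul_nonneg (by linarith) (Nat.cast_nonneg _)
      have h3 := mul_le_mul_of_nonneg_left h1 h2
      linarith) (β / 2 * y)
    (fun η hs hA => mul_le_mul_of_nonneg_left (le_trans hA (sum_le_sum fun x _ => abs_sum_cl hs.fs)) (by linarith))
  refine this.trans (le_of_eq ?_)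
  congr 2; ring
lemma pr_ring (hβ : 2 * C2 ≤ β) (hD : Ray D) (R : ℕ) (y : ℝ) :
    pr β D (fun η => y ≤ ringS R η) ≤ 8 * exp (β * (2 * R + 2) - β / 8 * y) := by
  have hc := C2_ge
  have hβ0 : 0 < β := by linarith
  set S : Finset ℕ := range (2 * R + 1) with hS
  have main : ∀ (b : Bool) (f : ℕ → Site), (∀ i j, (if b then (f i).1 else (f i).2) = (if b then (f j).1 else (f j).2) → i = j) →
      pr β D (fun η => y / 4 ≤ ∑ j ∈ S, |(η (f j) : ℝ)|) ≤ 2 * exp (β * (2 * R + 2) - β / 8 * y) := by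
    intro b f hf
    have hinj : Function.Injective f := fun i j h => hf i j (by rw [h])
    have h1 := pr_line hβ hD b (S.image f) (by
      intro x hx x' hx' h
      obtain ⟨i, -, rfl⟩ := Finset.mem_image.1 hx
      obtain ⟨j, -, rfl⟩ := Finset.mem_image.1 hx'
      rw [hf i j h]) (y / 4)
    simp only [sum_image (fun a _ b _ h => hinj h), Finset.card_image_of_injective _ hinj, hS, Finset.card_range] at h1
    refine h1.trans (le_of_eq ?_)
    congr 2; push_cast; ring
  have h1 := main true (fun j => (-R + j, (R : ℤ))) (by intro i j h; simpa using h)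
  have h2 := main true (fun j => (-R + j, -(R : ℤ))) (by intro i j h; simpa using h)
  have h3 := main false (fun j => ((R : ℤ), -R + j)) (by intro i j h; simpa using h)
  have h4 := main false (fun j => (-(R : ℤ), -R + j)) (by intro i j h; simpa using h)
  have h5 : pr β D (fun η => y ≤ ringS R η) ≤ _ := pr_or hβ0 (B := fun η => y / 4 ≤ ∑ j ∈ S, |(η (-R + j, (R : ℤ)) : ℝ)| ∨ y / 4 ≤ ∑ j ∈ S, |(η (-R + j, -(R : ℤ)) : ℝ)|)
    (C := fun η => y / 4 ≤ ∑ j ∈ S, |(η ((R : ℤ), -R + j) : ℝ)| ∨ y / 4 ≤ ∑ j ∈ S, |(η (-(R : ℤ), -R + j) : ℝ)|) (fun η _ h => by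
      by_contra hn
      simp only [not_or, not_le] at hn
      rw [ringS, sum_add_distrib, sum_add_distrib, sum_add_distrib] at h
      linarith [hn.1.1, hn.1.2, hn.2.1, hn.2.2])
  have h6 := pr_or (D := D) hβ0 (A := fun η => y / 4 ≤ ∑ j ∈ S, |(η (-R + j, (R : ℤ)) : ℝ)| ∨ y / 4 ≤ ∑ j ∈ S, |(η (-R + j, -(R : ℤ)) : ℝ)|) (fun η _ h => h)
  have h7 := pr_or (D := D) hβ0 (A := fun η => y / 4 ≤ ∑ j ∈ S, |(η ((R : ℤ), -R + j) : ℝ)| ∨ y / 4 ≤ ∑ j ∈ S, |(η (-(R : ℤ), -R + j) : ℝ)|) (fun η _ h => h)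
  linarith
lemma pr_up1 (hβ : 2 * C2 ≤ β) (hD : Ray D) {δ : ℝ} (hδ : 0 < δ) (hδ1 : δ < 1) {h : ℕ} (hh : 1 ≤ h) :
    pr β D (fun η => (h : ℤ) ≤ η 0) ≤ exp (-(β * (1 - δ) * ((1 - δ) * h) ^ 2 / (log h / (2 * Real.pi) + 1))) +
      8 * exp (β * (2 * h + 2) - β / 8 * (δ * h ^ 2)) := by
  have hc := C2_ge
  have hβ0 : 0 < β := by linarith
  have hh' : (1 : ℝ) ≤ h := by exact_mod_cast hh
  have hlog : 0 ≤ log h := Real.log_natCast_nonneg h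
  have h1 := pr_gauss (D := D) hβ0 (lF_add h) (K := log h / (2 * Real.pi) + 1) (κ := 1 - δ) (by positivity) (by linarith) (by linarith)
    (fun u hu => lF_sq hh hu.fs) (y := (1 - δ) * h) (mul_nonneg (by linarith) (by linarith))
  refine (pr_or hβ0 (fun η _ hA => ?_)).trans (add_le_add h1 (pr_ring hβ hD h (δ * h ^ 2)))
  by_contra! hn
  have h2 := (le_abs_self _).trans (lF_ring hh η)
  have h3 : ((h : ℤ) : ℝ) ≤ η 0 := by exact_mod_cast hA
  push_cast at h3
  have h4 : (1 / h : ℝ) * ringS h η < (1 / h) * (δ * h ^ 2) := by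
    refine mul_lt_mul_of_pos_left hn.2 (by positivity)
  have h5 : (1 / h : ℝ) * (δ * h ^ 2) = δ * h := by field_simp
  linarith [hn.1]
theorem pr_up (hβ : 2 * C2 ≤ β) {δ : ℝ} (hδ : 0 < δ) (hδ1 : δ < 1) :
    ∀ᶠ h : ℕ in atTop, ∀ D : Finset Site, Ray D → pr β D (fun η => (h : ℤ) ≤ η 0) ≤
      exp (-((1 - δ) * (2 * Real.pi * β * h ^ 2 / log h))) := by
  have hc := C2_ge
  have hβ0 : 0 < β := by linarith
  have hpi := pi_gt_three
  have hpi' := Real.pi_lt_four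
  have hl : Tendsto (fun h : ℕ => log h) atTop atTop := Real.tendsto_log_atTop.comp tendsto_natCast_atTop_atTop
  have hn : Tendsto (fun h : ℕ => (h : ℝ)) atTop atTop := tendsto_natCast_atTop_atTop
  filter_upwards [hl.eventually_ge_atTop (10000 / δ), hn.eventually_ge_atTop (10000 / δ)] with h h1 h2 D hD
  have hd : 10000 ≤ 10000 / δ := by rw [le_div_iff₀ hδ]; nlinarith
  have hh : 1 ≤ h := by have : (1 : ℝ) ≤ h := by linarith
                        exact_mod_cast this
  rw [div_le_iff₀ hδ] at h1 h2
  set l := log h with hle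
  set x : ℝ := (h : ℝ) with hx
  have hx0 : 0 < x := by rw [hx]; exact_mod_cast hh
  have hl0 : 0 < l := by nlinarith
  have hlx : l ≤ x := (Real.log_le_sub_one_of_pos hx0).trans (by linarith)
  set X := 2 * Real.pi * β * x ^ 2 / l with hX
  have hX1 : X * l = 2 * Real.pi * β * x ^ 2 := by rw [hX]; field_simp
  have hX0 : 0 < X := by positivity
  have hX2 : 6 * x ≤ X := by
    rw [hX, le_div_iff₀ hl0]
    have a1 : 6 * x * l ≤ 6 * x * x := by gcongr
    have a2 : 6 ≤ 2 * Real.pi * β := by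
      have := mul_le_mul (show (6 : ℝ) ≤ 2 * Real.pi by linarith) (show (1 : ℝ) < β by linarith).le (by norm_num) (by positivity)
      linarith
    have a3 := mul_le_mul_of_nonneg_right a2 (sq_nonneg x)
    linarith
  have hbx : 0 < β * x ^ 2 := by positivity
  have hX3 : X ≤ δ * β * x ^ 2 / 256 := by
    rw [hX, div_le_iff₀ hl0]
    have a1 := mul_le_mul_of_nonneg_left h1 hbx.le
    have a2 := mul_le_mul_of_nonneg_right hpi'.le hbx.le
    linarith
  refine (pr_up1 hβ hD (δ := δ / 16) (by linarith) (by linarith) hh).trans ?_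
  rw [← hle, ← hx]
  have hlog2 : exp (-1) ≤ 1 / 2 := by
    rw [Real.exp_neg, inv_le_comm₀ (exp_pos _) (by norm_num)]; have := add_one_le_exp 1; norm_num; linarith
  have t1 : exp (-(β * (1 - δ / 16) * ((1 - δ / 16) * x) ^ 2 / (l / (2 * Real.pi) + 1))) ≤ (1 / 2) * exp (-((1 - δ) * X)) := by
    refine le_trans ?_ (mul_le_mul_of_nonneg_right hlog2 (exp_pos _).le)
    rw [← exp_add]
    refine exp_le_exp.2 ?_
    have e : β * (1 - δ / 16) * ((1 - δ / 16) * x) ^ 2 / (l / (2 * Real.pi) + 1) = (1 - δ / 16) ^ 3 * (X * (l / (l + 2 * Real.pi))) := by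
      rw [hX]; field_simp
    have e1 : 1 - δ / 16 ≤ l / (l + 2 * Real.pi) := by
      rw [le_div_iff₀ (by positivity)]; nlinarith
    have e2 : (1 - δ / 16) ^ 3 * (X * (1 - δ / 16)) ≤ (1 - δ / 16) ^ 3 * (X * (l / (l + 2 * Real.pi))) := by
      have : 0 ≤ 1 - δ / 16 := by linarith
      gcongr
    have e3 : 1 - δ / 4 ≤ (1 - δ / 16) ^ 4 := by
      have := one_add_mul_le_pow (a := -(δ / 16)) (by linarith) 4
      norm_num at this; rw [← sub_eq_add_neg] at this; linarith
    have e4 : (1 - δ / 4) * X ≤ (1 - δ / 16) ^ 4 * X := by gcongr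
    have e5 : 1 ≤ δ / 4 * X := by nlinarith
    rw [e]
    have e6 : (1 - δ / 16) ^ 3 * (X * (1 - δ / 16)) = (1 - δ / 16) ^ 4 * X := by ring
    linarith
  have t2 : 8 * exp (β * (2 * x + 2) - β / 8 * (δ / 16 * x ^ 2)) ≤ (1 / 2) * exp (-((1 - δ) * X)) := by
    have a0 : (16 : ℝ) ≤ exp 4 := by
      have : (2 : ℝ) ≤ exp 1 := by have := add_one_le_exp 1; linarith
      calc (16 : ℝ) = 2 ^ 4 := by norm_num
        _ ≤ exp 1 ^ 4 := by gcongr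
        _ = exp 4 := by rw [← exp_nat_mul]; norm_num
    have a1 : β * (2 * x + 2) - β / 8 * (δ / 16 * x ^ 2) ≤ -((1 - δ) * X) - 4 := by
      have b1 : (1 - δ) * X ≤ X := by nlinarith
      have b2 := mul_le_mul_of_nonneg_left h2 hx0.le
      have b3 := mul_le_mul_of_nonneg_left b2 hβ0.le
      have b4 : (4 : ℝ) ≤ β * x := by nlinarith
      have b5 : β ≤ β * x := le_mul_of_one_le_right hβ0.le (by rw [hx]; exact_mod_cast hh)
      linarith
    have a2 := exp_le_exp.2 a1
    rw [Real.exp_sub _ 4] at a2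
    have a3 := (le_div_iff₀ (exp_pos 4)).1 a2
    have a4 := mul_le_mul_of_nonneg_left a0 (exp_pos (β * (2 * x + 2) - β / 8 * (δ / 16 * x ^ 2))).le
    linarith
  linarith
end

def kG (c y : ℝ) : ℝ := (1 / 2) * ((1 / c) * arctan (y / c) - y / (c ^ 2 + y ^ 2))
lemma kG_deriv {c : ℝ} (hc : c ≠ 0) (y : ℝ) : HasDerivAt (kG c) ((y / (c ^ 2 + y ^ 2)) ^ 2) y := by
  have h0 : (0 : ℝ) < c ^ 2 + y ^ 2 := by positivity
  have h := (((at_deriv hc y).const_mul (1 / c)).sub ((hasDerivAt_id y).div (((hasDerivAt_id y).pow 2).const_add (c ^ 2)) h0.ne')).const_mul (1 / 2)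
  refine HasDerivAt.congr_deriv (f' := _) (h.congr_of_eventuallyEq ?_) ?_
  · exact Filter.Eventually.of_forall fun z => by simp [kG]
  · simp only [id, Pi.pow_apply]
    field_simp
    ring
lemma lg_deriv {c : ℝ} (hc : c ≠ 0) (y : ℝ) : HasDerivAt (fun y => (1 / 2) * log (c ^ 2 + y ^ 2)) (y / (c ^ 2 + y ^ 2)) y := by
  have h0 : (0 : ℝ) < c ^ 2 + y ^ 2 := by positivity
  have h := ((((hasDerivAt_id y).pow 2).const_add (c ^ 2)).log h0.ne').const_mul (1 / 2)
  refine h.congr_deriv ?_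
  simp only [id, Pi.pow_apply]; field_simp; ring
def lgS (x : Site) : ℝ := (1 / 2) * log (1 + (x.1 : ℝ) ^ 2 + (x.2 : ℝ) ^ 2)
lemma lg_row (N : ℕ) (b : ℝ) : ∑ i ∈ range (2 * N),
    ((1 / 2) * log ((Real.sqrt (1 + b ^ 2)) ^ 2 + (-N + i + 1 : ℝ) ^ 2) - (1 / 2) * log ((Real.sqrt (1 + b ^ 2)) ^ 2 + (-N + i : ℝ) ^ 2)) ^ 2 ≤
      Real.pi / 2 * (1 / Real.sqrt (1 + b ^ 2)) := by
  set c := Real.sqrt (1 + b ^ 2) with hc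
  have hc0 : 0 < c := Real.sqrt_pos.2 (by positivity)
  have h1 := Finset.sum_range_sub (fun j : ℕ => kG c (-N + j)) (2 * N)
  refine (sum_le_sum fun (i : ℕ) _ => sq_le_of_deriv (lg_deriv hc0.ne') (kG_deriv hc0.ne') (-N + (i : ℝ))).trans ?_
  have h2 : ∑ i ∈ range (2 * N), (kG c (-N + i + 1) - kG c (-N + i)) = kG c N - kG c (-N) := by
    refine Eq.trans (sum_congr rfl fun j _ => ?_) (h1.trans ?_)
    · push_cast; ring_nf
    · push_cast; ring_nf
  rw [h2]
  have e : kG c N - kG c (-N) = (1 / c) * arctan (N / c) - N / (c ^ 2 + N ^ 2) := by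
    unfold kG; rw [neg_div, Real.arctan_neg]; ring
  have h3 : (0 : ℝ) ≤ N / (c ^ 2 + N ^ 2) := by positivity
  have h4 : (1 / c) * arctan (N / c) ≤ (1 / c) * (Real.pi / 2) := by
    gcongr; exact (Real.arctan_lt_pi_div_two _).le
  rw [e]; linarith
lemma sum_inv (N : ℕ) (hN : 1 ≤ N) : ∑ j ∈ range (2 * N + 1), 1 / Real.sqrt (1 + (-N + j : ℝ) ^ 2) ≤ 2 * log N + 3 := by
  have h1 := harmonic_le_one_add_log N
  have h2 : ∑ i ∈ range N, 1 / ((i : ℝ) + 1) = (harmonic N : ℝ) := by rw [harmonic]; push_cast; simp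
  have key : ∀ t : ℝ, 0 < t → ∀ s : ℝ, s ^ 2 = t ^ 2 → 1 / Real.sqrt (1 + s ^ 2) ≤ 1 / t := by
    intro t ht s hs
    refine one_div_le_one_div_of_le ht (Real.le_sqrt_of_sq_le ?_); rw [hs]; linarith
  rw [show 2 * N + 1 = N + 1 + N by ring, Finset.sum_range_add, sum_range_succ, ← Finset.sum_range_reflect]
  have h3 : ∑ i ∈ range N, 1 / Real.sqrt (1 + (-N + (N - 1 - i : ℕ) : ℝ) ^ 2) ≤ ∑ i ∈ range N, 1 / ((i : ℝ) + 1) := by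
    refine sum_le_sum fun i hi => key _ (by positivity) _ ?_
    have hi := Finset.mem_range.1 hi
    have : ((N - 1 - i : ℕ) : ℝ) = N - 1 - i := by
      rw [Nat.sub_sub, Nat.cast_sub (by omega)]; push_cast; ring
    rw [this]; ring
  have h4 : ∑ i ∈ range N, 1 / Real.sqrt (1 + (-N + (N + 1 + i : ℕ) : ℝ) ^ 2) ≤ ∑ i ∈ range N, 1 / ((i : ℝ) + 1) := by
    refine sum_le_sum fun i hi => key _ (by positivity) _ ?_
    push_cast; ring
  have h5 : 1 / Real.sqrt (1 + (-N + N : ℝ) ^ 2) = 1 := by simp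
  rw [h5]
  linarith
lemma lg_en (N : ℕ) (hN : 1 ≤ N) : ∑ p ∈ (range (2 * N) ×ˢ range (2 * N + 1)) ×ˢ (Finset.univ : Finset Bool),
    (lgS (nb (edg N p)) - lgS (edg N p).1) ^ 2 ≤ 2 * Real.pi * log N + 3 * Real.pi := by
  rw [sum_product, sum_product, sum_comm]
  have h1 : ∀ j ∈ range (2 * N + 1), ∑ i ∈ range (2 * N), ∑ b : Bool, (lgS (nb (edg N ((i, j), b))) - lgS (edg N ((i, j), b)).1) ^ 2 ≤
      2 * (Real.pi / 2 * (1 / Real.sqrt (1 + (-N + j : ℝ) ^ 2))) := by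
    intro j _
    refine le_trans (le_of_eq ?_) (mul_le_mul_of_nonneg_left (lg_row N (-N + j)) two_pos.le)
    rw [mul_sum]
    refine sum_congr rfl fun i _ => ?_
    rw [Real.sq_sqrt (by positivity)]
    simp only [Fintype.sum_bool, edg, nb, lgS, if_true]
    simp
    ring_nf
  refine (sum_le_sum h1).trans ?_
  rw [← mul_sum, ← mul_sum]
  nlinarith [sum_inv N hN, pi_pos]
lemma spike (R h : ℕ) (hR : 2 ≤ R) {δ : ℝ} (hδ : 0 < δ) : ∃ φ : Site → ℤ, (∀ x : Site, φ x ≠ 0 → |x.1| ≤ R ∧ |x.2| ≤ R) ∧ φ 0 = h ∧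
    (E1 φ : ℝ) ≤ (1 + δ) * h ^ 2 * (2 * Real.pi * (log R + 5 / 2)) / log R ^ 2 + (1 + 1 / δ) * (2 * (2 * R + 2) * (2 * R + 3)) := by
  have hR' : (2 : ℝ) ≤ R := by exact_mod_cast hR
  have hl : 0 < log R := Real.log_pos (by linarith)
  set f : Site → ℝ := fun x => h * max 0 (1 - lgS x / log R) with hf
  set φ : Site → ℤ := fun x => ⌊f x⌋ with hφ
  have h0 : ∀ x : Site, φ x ≠ 0 → |x.1| ≤ R ∧ |x.2| ≤ R := by
    intro x hx
    have h1 : lgS x < log R := by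
      by_contra! hn
      apply hx
      have : max 0 (1 - lgS x / log R) = 0 := max_eq_left (by rw [sub_nonpos, one_le_div hl]; exact hn)
      simp [hφ, hf, this]
    have h2 : (1 + (x.1 : ℝ) ^ 2 + (x.2 : ℝ) ^ 2) < R ^ 2 := by
      have h3 : log (1 + (x.1 : ℝ) ^ 2 + (x.2 : ℝ) ^ 2) < log ((R : ℝ) ^ 2) := by
        rw [Real.log_pow]; unfold lgS at h1; push_cast; linarith
      exact (Real.log_lt_log_iff (by positivity) (by positivity)).1 h3
    constructor
    · have : |(x.1 : ℝ)| ≤ R := abs_le_of_sq_le_sq (by nlinarith [sq_nonneg (x.2 : ℝ)]) (by positivity)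
      exact_mod_cast this
    · have : |(x.2 : ℝ)| ≤ R := abs_le_of_sq_le_sq (by nlinarith [sq_nonneg (x.1 : ℝ)]) (by positivity)
      exact_mod_cast this
  refine ⟨φ, h0, by simp [hφ, hf, lgS], ?_⟩
  set N := R + 1 with hN
  set P := (range (2 * N) ×ˢ range (2 * N + 1)) ×ˢ (Finset.univ : Finset Bool) with hP
  rw [E1_eq (s := P.image (edg N)), sum_image (fun a _ b _ h => edg_inj N h)]
  swap
  · rintro ⟨⟨a, b⟩, t⟩ he
    have h1 : φ (a, b) ≠ 0 ∨ φ (nb ((a, b), t)) ≠ 0 := by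
      by_contra! hn; apply he; simp only [gr]; omega
    have h2 : -(N : ℤ) ≤ a ∧ -(N : ℤ) ≤ b ∧ a ≤ N ∧ b ≤ N ∧ (t = true → b < N) ∧ (t = false → a < N) := by
      rcases h1 with h1 | h1
      · have := h0 _ h1
        simp only [abs_le] at this; push_cast [hN]; refine ⟨?_, ?_, ?_, ?_, fun _ => ?_, fun _ => ?_⟩ <;> omega
      · have := h0 _ h1
        cases t <;> simp [nb, abs_le] at this <;> push_cast [hN] <;> refine ⟨?_, ?_, ?_, ?_, fun h => ?_, fun h => ?_⟩ <;> first | omega | cases h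
    simp only [Finset.mem_image, hP, mem_product, Finset.mem_range, Finset.mem_univ, and_true]
    cases t
    · refine ⟨(((a + N).toNat, (b + N).toNat), false), ?_, ?_⟩
      · simp at h2 ⊢; omega
      · simp [edg]; omega
    · refine ⟨(((b + N).toNat, (a + N).toNat), true), ?_, ?_⟩
      · simp at h2 ⊢; omega
      · simp [edg]; omega
  have h2 : ∀ e : Edge, ((gr φ e).natAbs ^ 2 : ℝ) ≤ (1 + δ) * h ^ 2 / log R ^ 2 * (lgS (nb e) - lgS e.1) ^ 2 + (1 + 1 / δ) := by
    intro e
    set d := |lgS (nb e) - lgS e.1| with hd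
    have a1 : |f (nb e) - f e.1| ≤ h / log R * d := by
      simp only [hf]
      rw [← mul_sub, abs_mul, abs_of_nonneg (Nat.cast_nonneg (α := ℝ) h), div_mul_eq_mul_div, mul_div_assoc]
      refine mul_le_mul_of_nonneg_left ?_ (Nat.cast_nonneg _)
      rw [max_comm, max_comm 0]
      refine (abs_max_sub_max_le_abs _ _ _).trans (le_of_eq ?_)
      rw [hd, show 1 - lgS (nb e) / log R - (1 - lgS e.1 / log R) = -(lgS (nb e) - lgS e.1) / log R by ring, abs_div, abs_neg, abs_of_pos hl]
    have a2 : |(gr φ e : ℝ)| ≤ h / log R * d + 1 := by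
      simp only [gr, hφ]; push_cast
      have b1 := Int.floor_le (f (nb e))
      have b2 := Int.lt_floor_add_one (f (nb e))
      have b3 := Int.floor_le (f e.1)
      have b4 := Int.lt_floor_add_one (f e.1)
      rw [abs_le] at a1 ⊢
      constructor <;> linarith [a1.1, a1.2]
    have a3 : ((gr φ e).natAbs ^ 2 : ℝ) = |(gr φ e : ℝ)| ^ 2 := by simp [Nat.cast_natAbs]
    rw [a3]
    have a5 : (h / log R * d + 1) ^ 2 ≤ (1 + δ) * (h / log R * d) ^ 2 + (1 + 1 / δ) := by
      set z := h / log R * d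
      have : (1 + δ) * z ^ 2 + (1 + 1 / δ) - (z + 1) ^ 2 = (δ * z - 1) ^ 2 / δ := by field_simp; ring
      have h9 : 0 ≤ (δ * z - 1) ^ 2 / δ := by positivity
      linarith
    refine (pow_le_pow_left₀ (abs_nonneg _) a2 2).trans (a5.trans (le_of_eq ?_))
    rw [mul_pow, hd, sq_abs, div_pow]; ring
  push_cast
  refine (sum_le_sum fun p _ => h2 (edg N p)).trans ?_
  rw [sum_add_distrib, ← mul_sum, sum_const, nsmul_eq_mul]
  have h3 := lg_en N (by omega)
  have h4 : log N ≤ log R + 1 := by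
    have : (N : ℝ) ≤ R * exp 1 := by
      have := add_one_le_exp 1
      rw [hN]; push_cast; nlinarith
    refine (log_le_log (by rw [hN]; positivity) this).trans ?_
    rw [Real.log_mul (by positivity) (exp_pos _).ne', Real.log_exp]
  have h5 : (P.card : ℝ) = 2 * (2 * R + 2) * (2 * R + 3) := by
    rw [hP]; simp [hN]; ring
  rw [h5]
  have h6 : (1 + δ) * h ^ 2 / log R ^ 2 * ∑ p ∈ P, (lgS (nb (edg N p)) - lgS (edg N p).1) ^ 2 ≤
      (1 + δ) * h ^ 2 / log R ^ 2 * (2 * Real.pi * (log R + 5 / 2)) := by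
    refine mul_le_mul_of_nonneg_left (h3.trans ?_) (by positivity)
    nlinarith [pi_pos]
  refine (add_le_add h6 (le_of_eq (mul_comm _ _))).trans (le_of_eq ?_)
  ring

set_option maxHeartbeats 800000 in
lemma pr_low {β : ℝ} (hβ : 2 * C2 ≤ β) {δ : ℝ} (hδ : 0 < δ) (hδ1 : δ < 1) : ∀ᶠ h : ℕ in atTop, ∀ D : Finset Site, Ray D →
    Qb h 0 ⊆ D → exp (-((1 + δ) * (2 * Real.pi * β * h ^ 2 / log h))) ≤ pr β D (fun η => (h : ℤ) ≤ η 0) := by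
  have hc2 := C2_ge
  have hβ0 : 0 < β := by linarith
  obtain ⟨d, hd⟩ : ∃ d, d = δ / 20 := ⟨_, rfl⟩
  have hd0 : 0 < d := by linarith
  have hd1 : d < 1 / 20 := by linarith
  have T : Tendsto (fun h : ℕ => log h) atTop atTop := Real.tendsto_log_atTop.comp tendsto_natCast_atTop_atTop
  have e1 := T.eventually_ge_atTop (5 / d + 2 / d + 24 * (1 + 1 / d) / d + 2)
  have e2 := T.eventually (Real.isLittleO_log_id_atTop.bound (half_pos hd0))
  have e3 := (tendsto_natCast_atTop_atTop (R := ℝ)).eventually (Real.isLittleO_log_id_atTop.bound (show (0 : ℝ) < 1 / 4 by norm_num))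
  have e4 := (tendsto_natCast_atTop_atTop (R := ℝ)).eventually_ge_atTop (1 / d + 1)
  filter_upwards [e1, e2, e3, e4] with h e1 e2 e3 e4 D hD hQ
  set x : ℝ := (h : ℝ) with hx
  set l := log x with hl
  have p1 : 0 < 5 / d := by positivity
  have p2 : 0 < 2 / d := by positivity
  have p3 : 0 < 24 * (1 + 1 / d) / d := by positivity
  have p4 : 0 < 1 / d := by positivity
  have l2 : 2 < l := by linarith
  have x0 : 0 < x := by linarith
  have hll : log l ≤ d / 2 * l := by
    have := le_trans (le_abs_self _) e2
    simpa [abs_of_pos (by linarith : 0 < l)] using this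
  have hlx : l ≤ x / 4 := by
    have := le_trans (le_abs_self _) e3
    simp only [id, Real.norm_eq_abs, abs_of_pos x0] at this; linarith
  obtain ⟨R, hR⟩ : ∃ R : ℕ, R = ⌊x / l⌋₊ := ⟨_, rfl⟩
  have hxl : 4 ≤ x / l := by rw [le_div_iff₀ (by linarith)]; linarith
  have hR1 : (R : ℝ) ≤ x / l := hR ▸ Nat.floor_le (by linarith)
  have hR2 : x / l < R + 1 := hR ▸ Nat.lt_floor_add_one _
  have hR3 : x / l / 2 ≤ R := by linarith
  have hR4 : 2 ≤ R := by
    have : (2 : ℝ) ≤ R := by linarith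
    exact_mod_cast this
  have hRx : (R : ℝ) ≤ x := hR1.trans (div_le_self x0.le (by linarith))
  set r := log R with hr
  have hr1 : (1 - d) * l ≤ r := by
    have h1 : log (x / l / 2) ≤ r := log_le_log (by linarith) hR3
    rw [Real.log_div (by linarith) (by norm_num), Real.log_div (by linarith) (by linarith)] at h1
    have h2 : log 2 ≤ d / 2 * l := by
      have : 2 / d * d ≤ l * d := mul_le_mul_of_nonneg_right (by linarith) hd0.le
      rw [div_mul_cancel₀ _ hd0.ne'] at this
      have := Real.log_two_lt_d9
      linarith
    linarith
  have hr0 : 1 < r := by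
    have : l * (1/2) ≤ l * (1 - d) := mul_le_mul_of_nonneg_left (by linarith) (by linarith)
    linarith
  have hr5 : 5 / 2 ≤ d * r := by
    have h1 : d * ((1 - d) * l) ≤ d * r := mul_le_mul_of_nonneg_left hr1 hd0.le
    have h2 : 5 / d * d ≤ l * d := mul_le_mul_of_nonneg_right (by linarith) hd0.le
    rw [div_mul_cancel₀ _ hd0.ne'] at h2
    have h3 : l * d * (1/2) ≤ l * d * (1 - d) := mul_le_mul_of_nonneg_left (by linarith) (by positivity)
    linarith
  obtain ⟨φ, hφ1, hφ2, hφ3⟩ := spike R h hR4 hd0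
  rw [← hx, ← hr] at hφ3
  have hSp : Sp D φ := by
    intro y hy
    by_contra h0
    obtain ⟨a, b⟩ := hφ1 y h0
    have : (R : ℤ) ≤ h := by rw [hx] at hRx; exact_mod_cast hRx
    rw [abs_le] at a b
    exact hy (hQ (mem_Qb.2 (by simp; omega)))
  have hsp := pr_spike hβ0 hSp 0
  have hz := pr_zero hβ hD 0
  rw [hφ2] at hsp
  refine le_trans ?_ hsp
  have hz2 : exp (-1) ≤ pr β D (fun η => η 0 = 0) := by
    refine le_trans ?_ hz
    rw [Real.exp_neg, ← one_div]
    refine one_div_le_one_div_of_le two_pos ?_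
    have := add_one_le_exp 1
    linarith
  refine le_trans ?_ (mul_le_mul_of_nonneg_left hz2 (exp_pos _).le)
  rw [← exp_add]
  refine exp_le_exp.2 ?_
  set q := x ^ 2 / l with hq
  have q0 : 0 < q := by positivity
  have b1 : (1 + d) * x ^ 2 * (2 * Real.pi * (r + 5 / 2)) / r ^ 2 ≤ 2 * Real.pi * q * (1 + 11 * d) := by
    rw [div_le_iff₀ (by positivity)]
    have a1 : r + 5 / 2 ≤ (1 + d) * r := by linarith
    have a2 : x ^ 2 = q * l := by rw [hq, div_mul_cancel₀ _ (by linarith)]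
    have a3 : l ≤ (1 + 2 * d) * r := by
      have : (1 + 2 * d) * ((1 - d) * l) ≤ (1 + 2 * d) * r := mul_le_mul_of_nonneg_left hr1 (by linarith)
      have h3 : 0 ≤ l * (d * (1 - 2 * d)) := by
        have : 0 < 1 - 2 * d := by linarith
        positivity
      linarith
    rw [a2]
    calc (1 + d) * (q * l) * (2 * Real.pi * (r + 5 / 2)) ≤ (1 + d) * (q * ((1 + 2 * d) * r)) * (2 * Real.pi * ((1 + d) * r)) := by gcongr
      _ = 2 * Real.pi * q * ((1 + d) * (1 + 2 * d) * (1 + d)) * r ^ 2 := by ring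
      _ ≤ _ := by
        refine mul_le_mul_of_nonneg_right (mul_le_mul_of_nonneg_left ?_ (by positivity)) (by positivity)
        have i1 : d * d ≤ 1 * d := mul_le_mul_of_nonneg_right (by linarith) hd0.le
        have i2 : d * (d * d) ≤ 1 * (d * d) := mul_le_mul_of_nonneg_right (by linarith) (by positivity)
        linarith
  have b2 : (1 + 1 / d) * (2 * (2 * R + 2) * (2 * R + 3)) ≤ d * q := by
    have hR5 : (2 : ℝ) ≤ R := by exact_mod_cast hR4
    have hR6 : 2 * (2 * (R : ℝ) + 2) * (2 * R + 3) ≤ 24 * R ^ 2 := by linarith [sq_nonneg ((R : ℝ) - 2)]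
    calc (1 + 1 / d) * (2 * (2 * R + 2) * (2 * R + 3)) ≤ (1 + 1 / d) * (24 * R ^ 2) := mul_le_mul_of_nonneg_left hR6 (by positivity)
      _ ≤ (1 + 1 / d) * (24 * (x / l) ^ 2) := by gcongr
      _ = (24 * (1 + 1 / d) / d) * d / l * q := by rw [hq]; field_simp
      _ ≤ l * d / l * q := by gcongr; linarith
      _ = d * q := by field_simp
  have b3 : 1 ≤ d * (β * q) := by
    have g1 : x ≤ q := by rw [hq, le_div_iff₀ (by linarith), sq]; exact mul_le_mul_of_nonneg_left (by linarith) x0.le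
    have g2 : 1 / d * d ≤ x * d := mul_le_mul_of_nonneg_right (by linarith) hd0.le
    rw [div_mul_cancel₀ _ hd0.ne'] at g2
    have g3 : 1 * q ≤ β * q := mul_le_mul_of_nonneg_right (by linarith) q0.le
    have g4 := mul_le_mul_of_nonneg_left g1 hd0.le
    have g5 := mul_le_mul_of_nonneg_left g3 hd0.le
    linarith
  have b4 : β * (E1 φ : ℝ) ≤ β * (2 * Real.pi * q * (1 + 11 * d) + d * q) := mul_le_mul_of_nonneg_left (by linarith) hβ0.le
  have b5 : 2 * Real.pi * β * x ^ 2 / l = 2 * Real.pi * (β * q) := by rw [hq]; ring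
  rw [b5]
  have b6 : 1 * (β * q) ≤ Real.pi * (β * q) := mul_le_mul_of_nonneg_right (by linarith [pi_gt_three]) (by positivity)
  have b7 := mul_le_mul_of_nonneg_left b6 hd0.le
  have b8 : 0 ≤ d * (Real.pi * (β * q)) := by positivity
  have : δ = 20 * d := by linarith
  rw [this]
  linarith

def ell (L : ℕ) : ℕ := ⌈(log L) ^ 2⌉₊
def pc (β : ℝ) (L h : ℕ) : ℝ := pr β (Qb (ell L) 0) (fun η => (h : ℤ) ≤ η 0)
def HH (β : ℝ) (L : ℕ) : ℕ := max 1 (Nat.findGreatest (fun h => log L ^ 8 / L ≤ pc β L h) L)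
lemma ray_Qb (ℓ : ℕ) (x : Site) : Ray (Qb ℓ x) := ray_prod _ _
lemma lcr {p : ℕ → ℝ} (h1 : ∀ h, p (h + 2) * p h ≤ p (h + 1) ^ 2) (h0 : ∀ h, 0 ≤ p h) (ha : ∀ h, p (h + 1) ≤ p h) {ρ : ℝ}
    (hρ : 0 < ρ) : ∀ n, ρ * p n < p (n + 1) → ρ ^ (n + 1) * p 0 ≤ p (n + 1) := by
  intro n
  induction n with
  | zero => intro h; simpa using h.le
  | succ n ih =>
    intro h
    have g1 : 0 < p (n + 2) := lt_of_le_of_lt (mul_nonneg hρ.le (h0 _)) h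
    have g2 : 0 < p (n + 1) := g1.trans_le (ha _)
    have g3 : 0 < p n := g2.trans_le (ha _)
    have g4 : ρ * p n < p (n + 1) := by
      refine lt_of_mul_lt_mul_right ?_ g2.le
      calc ρ * p n * p (n + 1) = ρ * p (n + 1) * p n := by ring
        _ < p (n + 2) * p n := mul_lt_mul_of_pos_right h g3
        _ ≤ p (n + 1) * p (n + 1) := by rw [← sq]; exact h1 n
    have := mul_le_mul_of_nonneg_left (ih g4) hρ.le
    rw [← mul_assoc, ← pow_succ'] at this
    exact this.trans h.le
lemma pc_anti {β : ℝ} (hβ : 2 * C2 ≤ β) (L h : ℕ) : pc β L (h + 1) ≤ pc β L h := by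
  have := C2_ge
  exact pr_mono (by linarith) fun η _ h => by push_cast at h; omega
lemma pc_anti' {β : ℝ} (hβ : 2 * C2 ≤ β) (L : ℕ) : Antitone (pc β L) := antitone_nat_of_succ_le (pc_anti hβ L)
lemma pc_nn {β : ℝ} (L h : ℕ) : 0 ≤ pc β L h := pr_nonneg
lemma pc_lc {β : ℝ} (hβ : 2 * C2 ≤ β) (L h : ℕ) : pc β L (h + 2) * pc β L h ≤ pc β L (h + 1) ^ 2 := by
  have := C2_ge
  have := pr_lc (β := β) (D := Qb (ell L) 0) (by linarith) 0 h
  simpa [pc] using this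
lemma pc_zero {β : ℝ} (hβ : 2 * C2 ≤ β) (L : ℕ) : 1 / 2 ≤ pc β L 0 := by
  have := C2_ge
  exact (pr_zero hβ (ray_Qb (ell L) 0) 0).trans (pr_mono (by linarith) fun η _ h => by simp [h])
def sL (β : ℝ) (L : ℕ) : ℝ := Real.sqrt ((1 / (4 * Real.pi * β)) * log L * log (log L))
lemma tlog : Tendsto (fun h : ℕ => log h) atTop atTop := Real.tendsto_log_atTop.comp tendsto_natCast_atTop_atTop
lemma tlog2 : Tendsto (fun h : ℕ => log (log h)) atTop atTop := Real.tendsto_log_atTop.comp tlog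
lemma ev_b {β : ℝ} (hβ : 1 ≤ β) {κ : ℝ} (hκ : 0 < κ) (X : ℝ) : ∀ᶠ L : ℕ in atTop, X ≤ log (log L) ∧
    log (log L) ^ 3 ≤ κ * log L ∧ 0 < sL β L ∧ sL β L ^ 2 = (1 / (4 * Real.pi * β)) * log L * log (log L) ∧
    |log (sL β L) - log (log L) / 2| ≤ κ * log (log L) ∧ X ≤ sL β L ∧ sL β L ≤ κ * log L ∧ X * log (log L) ≤ sL β L ∧ X ≤ log L := by
  have hp : 0 < 4 * Real.pi * β := by positivity
  have hp1 : 1 ≤ 4 * Real.pi * β := by nlinarith [pi_gt_three]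
  have e2 := tlog.eventually ((Real.isLittleO_pow_log_id_atTop (n := 3)).bound (c := κ) hκ)
  have e2' := tlog.eventually ((Real.isLittleO_pow_log_id_atTop (n := 1)).bound (c := 1 / (4 * Real.pi * β * (X ^ 2 + 1))) (by positivity))
  have e2'' := tlog.eventually ((Real.isLittleO_pow_log_id_atTop (n := 1)).bound (c := κ ^ 2) (by positivity))
  have e3 := tlog2.eventually (Real.isLittleO_log_id_atTop.bound hκ)
  filter_upwards [tlog2.eventually_ge_atTop (|X| + 1 + log (4 * Real.pi * β) / κ), e2, e2', e2'', e3, tlog.eventually_ge_atTop (|X| + 1)] with L h1 h2 h2' h2'' h3 h4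
  set a := log L with ha
  set b := log a with hb
  have hX := le_abs_self X
  have hX0 := abs_nonneg X
  have a0 : 0 < a := by linarith
  have hlp : 0 ≤ log (4 * Real.pi * β) := log_nonneg hp1
  have hlp' : 0 ≤ log (4 * Real.pi * β) / κ := by positivity
  have hlk : log (4 * Real.pi * β) ≤ κ * b := by
    rw [mul_comm κ, ← div_le_iff₀ hκ]; linarith
  have b1 : |X| + 1 ≤ b := by linarith
  have b0 : 0 < b := by linarith
  simp only [id, Real.norm_eq_abs, abs_of_pos a0, abs_of_pos b0, pow_one, abs_of_pos (pow_pos b0 3)] at h2 h2' h2'' h3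
  rw [abs_of_nonneg (log_nonneg (by linarith))] at h3
  have hc0 : 0 ≤ log b := log_nonneg (by linarith)
  have q : 0 < (1 / (4 * Real.pi * β)) * a * b := by positivity
  have s0 : 0 < sL β L := Real.sqrt_pos.2 q
  have s2 : sL β L ^ 2 = (1 / (4 * Real.pi * β)) * a * b := Real.sq_sqrt q.le
  have s3 : X * b ≤ sL β L := by
    refine Real.le_sqrt_of_sq_le ?_
    have : (X * b) ^ 2 ≤ (X ^ 2 + 1) * b * b := by nlinarith [sq_nonneg b]
    refine this.trans (mul_le_mul_of_nonneg_right ?_ b0.le)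
    calc (X ^ 2 + 1) * b ≤ (X ^ 2 + 1) * (1 / (4 * Real.pi * β * (X ^ 2 + 1)) * a) := mul_le_mul_of_nonneg_left h2' (by positivity)
      _ = 1 / (4 * Real.pi * β) * a := by field_simp
  refine ⟨by linarith, h2, s0, s2, ?_, ?_, ?_, s3, by linarith⟩
  · have e : log (sL β L) = (b + log b - log (4 * Real.pi * β)) / 2 := by
      show log (Real.sqrt _) = _
      rw [Real.log_sqrt q.le, Real.log_mul (by positivity) b0.ne', Real.log_mul (by positivity) a0.ne', one_div, Real.log_inv]
      ring
    rw [e, abs_le]; constructor <;> linarith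
  · rcases le_or_gt X 0 with h | h
    · linarith
    · refine le_trans ?_ s3
      nlinarith
  · refine Real.sqrt_le_iff.2 ⟨by positivity, ?_⟩
    have : 1 / (4 * Real.pi * β) * a * b ≤ 1 * a * b := by
      gcongr; rw [div_le_one hp]; exact hp1
    refine this.trans ?_
    calc 1 * a * b ≤ 1 * a * (κ ^ 2 * a) := by gcongr
      _ = _ := by ring

lemma tsL {β : ℝ} (hβ : 1 ≤ β) : Tendsto (sL β) atTop atTop :=
  tendsto_atTop.2 fun X => (ev_b hβ one_pos X).mono fun L h => h.2.2.2.2.2.1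
lemma tceil {β : ℝ} (hβ : 1 ≤ β) {t : ℝ} (ht : 0 < t) : Tendsto (fun L => ⌈t * sL β L⌉₊) atTop atTop :=
  tendsto_nat_ceil_atTop.comp ((tsL hβ).const_mul_atTop ht)
set_option maxHeartbeats 1000000 in
lemma HH_bd {β : ℝ} (hβ : 2 * C2 ≤ β) {δ : ℝ} (hδ : 0 < δ) (hδ1 : δ < 1 / 2) : ∀ᶠ L : ℕ in atTop,
    (1 - δ) * sL β L ≤ HH β L ∧ (HH β L : ℝ) ≤ (1 + δ) * sL β L := by
  have hc2 := C2_ge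
  have hβ1 : 1 ≤ β := by linarith
  obtain ⟨d, hd⟩ : ∃ d, d = δ / 4 := ⟨_, rfl⟩
  have hd0 : 0 < d := by linarith
  have hd1 : d < 1 / 8 := by linarith
  have i2 : d * d ≤ 1 / 8 * d := mul_le_mul_of_nonneg_right (by linarith) hd0.le
  have i2' : 0 < d * d := by positivity
  have i3 : d * (d * d) ≤ 1 / 8 * (d * d) := mul_le_mul_of_nonneg_right (by linarith) (by positivity)
  have i3' : 0 < d * (d * d) := by positivity
  have E := ev_b hβ1 (show 0 < d / 8 by linarith) (8 / d + 8)
  have U := (tceil hβ1 (show 0 < 1 + δ by linarith)).eventually (pr_up hβ hd0 (by linarith))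
  have Lw := (tceil hβ1 (show 0 < 1 - δ by linarith)).eventually (pr_low hβ hd0 (by linarith))
  filter_upwards [E, U, Lw, eventually_ge_atTop 1] with L E U Lw hL
  obtain ⟨E1, E2, E3, E4, E5, E6, E7, E8, E9⟩ := E
  have hL0 : (0 : ℝ) < L := by exact_mod_cast hL
  have haL : log L ≤ L := Real.log_le_self hL0.le
  have hLe : (L : ℝ) = exp (log L) := (exp_log hL0).symm
  have hell : (log L) ^ 2 ≤ ell L := Nat.le_ceil _
  set a := log L with ha
  set b := log a with hb
  set s := sL β L with hs
  have p8 : 0 < 8 / d := by positivity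
  have hdb : 8 ≤ d * b := by
    have := mul_le_mul_of_nonneg_left E1 hd0.le
    rw [mul_add, mul_div_cancel₀ _ hd0.ne'] at this
    linarith
  have hds : 8 ≤ d * s := by
    have := mul_le_mul_of_nonneg_left E6 hd0.le
    rw [mul_add, mul_div_cancel₀ _ hd0.ne'] at this
    linarith
  have b8 : 8 < b := by linarith
  have a8 : 8 < a := by linarith
  have hba : 8 * b ≤ d * a := by
    have : 1 * b ≤ b ^ 2 * b := mul_le_mul_of_nonneg_right (by nlinarith) (by linarith)
    linarith
  have hT : a ^ 8 / L = exp (8 * b - a) := by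
    rw [Real.exp_sub, ← hLe, ← exp_log (show 0 < a by linarith), ← exp_nat_mul]; norm_num [hb]
  have ls := abs_le.1 E5
  have s2 : 2 * Real.pi * β * s ^ 2 = a * b / 2 := by rw [E4]; have := pi_pos; field_simp; norm_num
  have lg2 : log 2 ≤ 1 := by have := Real.log_two_lt_d9; linarith
  have lg3 : log 3 ≤ 2 := by have := Real.log_le_sub_one_of_pos (show (0 : ℝ) < 3 by norm_num); linarith
  have hsa : 8 * s ≤ a := by
    have : d / 8 * a ≤ 1 / 8 * a := mul_le_mul_of_nonneg_right (by linarith) (by linarith)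
    linarith
  constructor
  · -- lower
    set h := ⌈(1 - δ) * s⌉₊ with hh
    have h1 : (1 - δ) * s ≤ h := Nat.le_ceil _
    have hs0 : 0 ≤ δ * s := by positivity
    have h2 : (h : ℝ) ≤ (1 - 2 * d) * s := by
      have := (Nat.ceil_lt_add_one (show 0 ≤ (1 - δ) * s from mul_nonneg (by linarith) E3.le)).le
      have e : δ = 4 * d := by linarith
      rw [← hh] at this; rw [e] at this; linarith
    have hds0 : 0 < d * s := by positivity
    have h3 : s / 2 ≤ h := by
      have : 1 / 2 * s ≤ (1 - δ) * s := mul_le_mul_of_nonneg_right (by linarith) E3.le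
      linarith
    have hlog : (1 - d) * b / 2 ≤ log h := by
      have := log_le_log (by linarith) h3
      rw [Real.log_div E3.ne' (by norm_num)] at this
      linarith
    have hb0 : 0 < (1 - d) * b / 2 := by
      have : 0 < 1 - d := by linarith
      positivity
    have hha : (h : ℝ) ≤ a := by linarith
    have hhl : h ≤ ell L := by
      have h9 : 1 * a ≤ a * a := mul_le_mul_of_nonneg_right (by linarith) (by linarith)
      have : (h : ℝ) ≤ ell L := by linarith
      exact_mod_cast this
    have hhL : h ≤ L := by
      have : (h : ℝ) ≤ L := by linarith
      exact_mod_cast this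
    have key : a ^ 8 / L ≤ pc β L h := by
      refine le_trans ?_ (Lw _ (ray_Qb _ _) fun y hy => ?_)
      · rw [hT]
        refine exp_le_exp.2 ?_
        have : (1 + d) * (2 * Real.pi * β * (h : ℝ) ^ 2 / log h) ≤ (1 - d) * a := by
          rw [← mul_div_assoc, div_le_iff₀ (by linarith)]
          calc (1 + d) * (2 * Real.pi * β * (h : ℝ) ^ 2) ≤ (1 + d) * (2 * Real.pi * β * ((1 - 2 * d) * s) ^ 2) := by gcongr
            _ = ((1 + d) * (1 - 2 * d) ^ 2) * (a * b / 2) := by rw [← s2]; ring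
            _ ≤ ((1 - d) * (1 - d)) * (a * b / 2) := by
              refine mul_le_mul_of_nonneg_right ?_ (by positivity)
              linarith
            _ = (1 - d) * a * ((1 - d) * b / 2) := by ring
            _ ≤ _ := mul_le_mul_of_nonneg_left hlog (mul_nonneg (by linarith) (by linarith))
        linarith
      · rw [mem_Qb] at hy ⊢
        have : (h : ℤ) ≤ ell L := by exact_mod_cast hhl
        simp at hy ⊢; omega
    have := Nat.le_findGreatest (P := fun h => log L ^ 8 / L ≤ pc β L h) hhL key
    have h5 : h ≤ HH β L := this.trans (le_max_right _ _)
    have h6 : (h : ℝ) ≤ HH β L := by exact_mod_cast h5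
    linarith
  · set h := ⌈(1 + δ) * s⌉₊ with hh
    have hs0 : 0 ≤ δ * s := by positivity
    have h1 : (1 + δ) * s ≤ h := Nat.le_ceil _
    have h2 := Nat.ceil_lt_add_one (show 0 ≤ (1 + δ) * s from mul_nonneg (by linarith) E3.le)
    rw [← hh] at h2
    have s8 : 8 < s := by linarith
    have h3 : (h : ℝ) ≤ 3 * s := by
      have : (1 + δ) * s ≤ 2 * s := mul_le_mul_of_nonneg_right (by linarith) E3.le
      linarith
    have hlog : log h ≤ (1 + d) * b / 2 := by
      have := log_le_log (by linarith) h3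
      rw [Real.log_mul (by norm_num) E3.ne'] at this
      linarith
    have hlog0 : 0 < log h := Real.log_pos (by linarith)
    have key : pc β L h < a ^ 8 / L := by
      refine lt_of_le_of_lt (U _ (ray_Qb _ _)) ?_
      rw [hT]
      refine Real.exp_lt_exp.2 ?_
      have : (1 + d) * a ≤ (1 - d) * (2 * Real.pi * β * (h : ℝ) ^ 2 / log h) := by
        rw [← mul_div_assoc, le_div_iff₀ hlog0]
        calc (1 + d) * a * log h ≤ (1 + d) * a * ((1 + d) * b / 2) := mul_le_mul_of_nonneg_left hlog (by positivity)
          _ = ((1 + d) * (1 + d)) * (a * b / 2) := by ring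
          _ ≤ ((1 - d) * (1 + δ) ^ 2) * (a * b / 2) := by
            refine mul_le_mul_of_nonneg_right ?_ (by positivity)
            have e : δ = 4 * d := by linarith
            rw [e]; linarith
          _ = (1 - d) * (2 * Real.pi * β * ((1 + δ) * s) ^ 2) := by rw [← s2]; ring
          _ ≤ _ := by
            have : 0 ≤ 1 - d := by linarith
            gcongr
      have : 0 < d * a := by positivity
      linarith
    have hlt : Nat.findGreatest (fun h => log L ^ 8 / L ≤ pc β L h) L < h := by
      by_contra hcon
      push Not at hcon
      have hne : Nat.findGreatest (fun h => log L ^ 8 / L ≤ pc β L h) L ≠ 0 := by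
        intro h0; rw [h0] at hcon
        have : (h : ℝ) ≤ 0 := by exact_mod_cast hcon
        linarith
      have g := Nat.findGreatest_of_ne_zero (P := fun h => log L ^ 8 / L ≤ pc β L h) rfl hne
      exact absurd (g.trans (pc_anti' hβ L hcon)) (not_le.2 key)
    have h1h : 1 < h := by
      have : (1 : ℝ) < h := by linarith
      exact_mod_cast this
    have : HH β L < h := max_lt h1h hlt
    by_contra hcon
    push Not at hcon
    have g : h ≤ HH β L := Nat.ceil_le.2 hcon.le
    omega

lemma HH_lim {β : ℝ} (hβ : 2 * C2 ≤ β) : Tendsto (fun L : ℕ => (HH β L : ℝ) / sL β L) atTop (𝓝 1) := by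
  have hc2 := C2_ge
  rw [Metric.tendsto_nhds]
  intro ε hε
  have hm : min (ε / 2) (1 / 4) < 1 / 2 := lt_of_le_of_lt (min_le_right _ _) (by norm_num)
  have hm0 : 0 < min (ε / 2) (1 / 4) := lt_min (by linarith) (by norm_num)
  filter_upwards [HH_bd hβ hm0 hm, ev_b (show 1 ≤ β by linarith) one_pos 1] with L h1 h2
  have s0 := h2.2.2.1
  rw [Real.dist_eq, abs_lt]
  have h3 := min_le_left (ε / 2) (1 / 4)
  have g1 : 1 - min (ε / 2) (1 / 4) ≤ (HH β L : ℝ) / sL β L := (le_div_iff₀ s0).2 h1.1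
  have g2 : (HH β L : ℝ) / sL β L ≤ 1 + min (ε / 2) (1 / 4) := (div_le_iff₀ s0).2 h1.2
  constructor <;> linarith
lemma HH_pos (β : ℝ) (L : ℕ) : 0 < HH β L := lt_of_lt_of_le one_pos (le_max_left _ _)
set_option maxHeartbeats 800000 in
lemma HH_facts {β : ℝ} (hβ : 2 * C2 ≤ β) : ∀ᶠ L : ℕ in atTop, log L ^ 8 / L ≤ pc β L (HH β L) ∧
    log L ^ 16 * pc β L (HH β L + 1) ≤ pc β L (HH β L) ∧ log L ^ 8 * L * pc β L (HH β L + 2) ≤ 1 ∧ (HH β L : ℝ) ≤ log L ∧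
    log L ^ 10 * exp (-(HH β L)) ≤ 1 ∧ pc β L (HH β L + 1) ≤ log L ^ 8 / L := by
  have hc2 := C2_ge
  filter_upwards [HH_bd hβ (show (0 : ℝ) < 1 / 4 by norm_num) (by norm_num), ev_b (show 1 ≤ β by linarith) (show (0 : ℝ) < 1 / 1000000 by norm_num) 40,
    eventually_ge_atTop 1] with L h1 E hL
  obtain ⟨E1, E2, E3, E4, E5, E6, E7, E8, E9⟩ := E
  have hL0 : (0 : ℝ) < L := by exact_mod_cast hL
  have haL : log L ≤ L := Real.log_le_self hL0.le
  have hLe : (L : ℝ) = exp (log L) := (exp_log hL0).symm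
  set H := HH β L with hH
  have hfg : H = max 1 (Nat.findGreatest (fun h => log L ^ 8 / L ≤ pc β L h) L) := rfl
  set a := log L with ha
  set b := log a with hb
  set s := sL β L with hs
  have a0 : 0 < a := by linarith
  have hβ0 : 0 < β := by linarith
  have hbs : 1000 * (b * s) ≤ a := by
    refine abs_le_of_sq_le_sq (a := 1000 * (b * s)) ?_ a0.le |> le_trans (le_abs_self _)
    have h4 : 1 / (4 * Real.pi * β) ≤ 1 := by
      rw [div_le_one (by positivity)]; nlinarith [pi_gt_three]
    calc (1000 * (b * s)) ^ 2 = 1000000 * (b ^ 2 * s ^ 2) := by ring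
      _ = 1000000 * (1 / (4 * Real.pi * β) * a * b ^ 3) := by rw [E4]; ring
      _ ≤ 1000000 * (1 * a * (1 / 1000000 * a)) := by gcongr
      _ = a ^ 2 := by ring
  have hb1 : b * 1 ≤ b * s := mul_le_mul_of_nonneg_left (by linarith) (by linarith)
  have aexp : ∀ n : ℕ, a ^ n = exp (n * b) := fun n => by rw [hb, exp_nat_mul, exp_log a0]
  have hT : a ^ 8 / L = exp (8 * b - a) := by
    rw [Real.exp_sub, ← hLe, aexp]; norm_num
  have H1 : (1 : ℝ) < H := by linarith
  have H1' : 1 < H := by exact_mod_cast H1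
  have P1 : a ^ 8 / L ≤ pc β L H := by
    have e : H = Nat.findGreatest (fun h => a ^ 8 / L ≤ pc β L h) L := by omega
    exact Nat.findGreatest_of_ne_zero (P := fun h => a ^ 8 / L ≤ pc β L h) e.symm (by omega)
  have HL : H + 1 ≤ L := by
    have : (H : ℝ) + 1 ≤ L := by linarith
    exact_mod_cast this
  have P2 : pc β L (H + 1) < a ^ 8 / L := by
    by_contra hcon
    push Not at hcon
    have := Nat.le_findGreatest (P := fun h => a ^ 8 / L ≤ pc β L h) HL hcon
    omega
  have key : ∀ n : ℕ, H ≤ n → n ≤ H + 1 → pc β L (n + 1) ≤ exp (-(16 * b)) * pc β L n := by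
    intro n hn hn2
    by_contra hcon
    push Not at hcon
    have g := lcr (pc_lc hβ L) (fun h => pc_nn L h) (pc_anti hβ L) (exp_pos _) n hcon
    have g2 : pc β L (n + 1) ≤ pc β L (H + 1) := pc_anti' hβ L (by omega)
    have g3 := pc_zero hβ L
    have g4 : exp (-(16 * b)) ^ (n + 1) * (1 / 2) ≤ exp (8 * b - a) := by
      rw [← hT]
      exact (mul_le_mul_of_nonneg_left g3 (by positivity)).trans (g.trans (g2.trans P2.le))
    have g5 : exp (-1) ≤ 1 / 2 := by
      rw [Real.exp_neg, ← one_div]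
      refine one_div_le_one_div_of_le two_pos ?_
      have := add_one_le_exp 1
      linarith
    have g6 := (mul_le_mul_of_nonneg_left g5 (by positivity)).trans g4
    rw [← exp_nat_mul, ← exp_add, exp_le_exp] at g6
    have g7 : ((n + 1 : ℕ) : ℝ) ≤ 4 * s := by
      have : (n : ℝ) ≤ H + 1 := by exact_mod_cast hn2
      push_cast; linarith
    have g8 := mul_le_mul_of_nonneg_right g7 (show 0 ≤ 16 * b by linarith)
    linarith
  have e16 : a ^ 16 * exp (-(16 * b)) = 1 := by
    rw [aexp, ← exp_add]; norm_num
  refine ⟨P1, ?_, ?_, by linarith, ?_, P2.le⟩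
  · have := mul_le_mul_of_nonneg_left (key H le_rfl (by omega)) (show 0 ≤ a ^ 16 by positivity)
    rwa [← mul_assoc, e16, one_mul] at this
  · have g := (key (H + 1) (by omega) le_rfl).trans (mul_le_mul_of_nonneg_left P2.le (exp_pos _).le)
    calc a ^ 8 * L * pc β L (H + 2) ≤ a ^ 8 * L * (exp (-(16 * b)) * (a ^ 8 / L)) := mul_le_mul_of_nonneg_left g (by positivity)
      _ = a ^ 16 * exp (-(16 * b)) := by field_simp
      _ ≤ 1 := e16.le
  · rw [aexp, ← exp_add, Real.exp_le_one_iff]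
    push_cast; linarith

def Sq (u v : ℤ) : Finset Site := Finset.Icc u v ×ˢ Finset.Icc u v
lemma mem_Sq {u v : ℤ} {x : Site} : x ∈ Sq u v ↔ (u ≤ x.1 ∧ x.1 ≤ v) ∧ u ≤ x.2 ∧ x.2 ≤ v := by simp [Sq]
lemma ray_Sq (u v : ℤ) : Ray (Sq u v) := ray_prod _ _
lemma card_Sq {u v : ℤ} {L : ℕ} (h : v - u + 1 ≤ L) : (Sq u v).card ≤ L ^ 2 := by
  rw [Sq, Finset.card_product, Int.card_Icc, sq]
  exact Nat.mul_le_mul (by omega) (by omega)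
lemma card_bd {u v : ℤ} {L : ℕ} (ℓ : ℕ) (h : v - u + 1 ≤ L) : ((Sq u v).filter fun x => ¬ Qb ℓ x ⊆ Sq u v).card ≤ 4 * (L * ℓ) := by
  have hsub : ((Sq u v).filter fun x => ¬ Qb ℓ x ⊆ Sq u v) ⊆
      ((Finset.Icc u (u + ℓ - 1) ×ˢ Finset.Icc u v) ∪ (Finset.Icc (v - ℓ + 1) v ×ˢ Finset.Icc u v)) ∪
      ((Finset.Icc u v ×ˢ Finset.Icc u (u + ℓ - 1)) ∪ (Finset.Icc u v ×ˢ Finset.Icc (v - ℓ + 1) v)) := by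
    intro x hx
    rw [Finset.mem_filter, mem_Sq] at hx
    obtain ⟨hx1, hx2⟩ := hx
    by_contra hc
    simp only [Finset.mem_union, mem_product, Finset.mem_Icc] at hc
    refine hx2 fun y hy => ?_
    rw [mem_Qb] at hy; rw [mem_Sq]; omega
  refine (card_le_card hsub).trans ?_
  refine (card_union_le _ _).trans ?_
  refine (Nat.add_le_add (card_union_le _ _) (card_union_le _ _)).trans ?_
  simp only [Finset.card_product, Int.card_Icc]
  have e1 : (v + 1 - u).toNat ≤ L := by omega
  have e2 : (u + (ℓ : ℤ) - 1 + 1 - u).toNat = ℓ := by omega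
  have e3 : (v + 1 - (v - (ℓ : ℤ) + 1)).toNat = ℓ := by omega
  rw [e2, e3]
  have := Nat.mul_le_mul_right ℓ e1
  nlinarith
lemma pc_eq {β : ℝ} (hβ : 2 * C2 ≤ β) {L : ℕ} (x : Site) (k : ℕ) : pc β L k = pr β (Qb (ell L) x) (fun η => (k : ℤ) ≤ η x) := by
  have hc2 := C2_ge
  rw [pc, pr_shift (by linarith) x (D' := Qb (ell L) x) (by intro y; simp only [mem_Qb, Prod.fst_add, Prod.snd_add, Prod.fst_zero, Prod.snd_zero]; omega)]
  simp
lemma pr_q {β : ℝ} (hβ : 2 * C2 ≤ β) {D : Finset Site} (hD : Ray D) {L : ℕ} {x : Site} (hx : Qb (ell L) x ⊆ D) (k : ℕ) :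
    pr β D (fun η => (k : ℤ) ≤ η x) ≤ pc β L k + exp (-(β - C1) * ell L) := by
  have hc2 := C2_ge
  refine (pr_dom hβ hD (ray_Qb _ x) hx subset_rfl (fun z => (k : ℤ) ≤ z)).trans ?_
  rw [pc_eq hβ x]
lemma pr_q' {β : ℝ} (hβ : 2 * C2 ≤ β) {D : Finset Site} (hD : Ray D) {L : ℕ} {x : Site} (hx : Qb (ell L) x ⊆ D) (k : ℕ) :
    pc β L k ≤ pr β D (fun η => (k : ℤ) ≤ η x) + exp (-(β - C1) * ell L) := by
  have hc2 := C2_ge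
  refine le_trans ?_ (pr_dom hβ (ray_Qb _ x) hD subset_rfl hx (fun z => (k : ℤ) ≤ z))
  rw [pc_eq hβ x]
lemma exp2q {q : ℝ} (h0 : 0 ≤ q) (h : q ≤ 1 / 2) : exp (-(2 * q)) ≤ 1 - q := by
  have h1 := add_one_le_exp (2 * q)
  rw [Real.exp_neg, inv_le_iff_one_le_mul₀ (exp_pos _)]
  have h2 := mul_le_mul_of_nonneg_left h1 (show 0 ≤ 1 - q by linarith)
  nlinarith
lemma pr_compl {β : ℝ} {D : Finset Site} (hβ : 0 < β) (A : (Site → ℤ) → Prop) : pr β D A + pr β D (fun η => ¬ A η) = 1 := by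
  refine le_antisymm ?_ (one_le_pr hβ fun η _ => _root_.em _)
  rw [← pr_true hβ (D := D)]
  unfold pr
  rw [← ENNReal.toReal_add (W_div_top hβ) (W_div_top hβ), ← ENNReal.add_div]
  refine ENNReal.toReal_mono (W_div_top hβ) (ENNReal.div_le_div_right ?_ _)
  rw [W, W, W, ← ENNReal.tsum_add]
  refine tsum_le_tsum fun η => ?_
  by_cases hA : A η <;> simp [hA]
lemma pr_site {β : ℝ} (hβ : 2 * C2 ≤ β) {D : Finset Site} (hD : Ray D) (x : Site) (k : ℕ) :
    exp (-(2 * pr β D (fun η => ((k + 1 : ℕ) : ℤ) ≤ η x))) ≤ pr β D (fun η => -(k : ℤ) ≤ η x) := by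
  have hc2 := C2_ge
  have hβ0 : 0 < β := by linarith
  have h1 : pr β D (fun η => ((k + 1 : ℕ) : ℤ) ≤ η x) = pr β D (fun η => ((k + 1 : ℕ) : ℤ) ≤ - η x) :=
    (pr_neg hβ0 (A := fun η => ((k + 1 : ℕ) : ℤ) ≤ η x)).symm
  have h2 : 1 ≤ pr β D (fun η => -(k : ℤ) ≤ η x) + pr β D (fun η => ((k + 1 : ℕ) : ℤ) ≤ - η x) := by
    rw [← pr_true (D := D) hβ0]
    refine pr_or hβ0 fun η _ _ => ?_
    push_cast; omega
  have h4 : pr β D (fun η => ((k + 1 : ℕ) : ℤ) ≤ η x) ≤ 1 / 2 := by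
    have g1 := pr_zero hβ hD x
    have g2 := pr_compl (D := D) hβ0 (fun η => η x = 0)
    have g3 : pr β D (fun η => ((k + 1 : ℕ) : ℤ) ≤ η x) ≤ pr β D (fun η => ¬ (η x = 0)) := pr_mono hβ0 fun η _ h => by push_cast at h; omega
    linarith
  rw [← h1] at h2
  exact (exp2q pr_nonneg h4).trans (by linarith)
lemma cost {β : ℝ} (hβ : 2 * C2 ≤ β) {u v : ℤ} {L : ℕ} (k : ℕ) (h : v - u + 1 ≤ L) :
    exp (-(2 * (L ^ 2 * (pc β L (k + 1) + exp (-(β - C1) * ell L)) + 4 * (L * ell L) * (2 * exp (1 - k))))) ≤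
      pr β (Sq u v) (fun η => ∀ x ∈ Sq u v, -(k : ℤ) ≤ η x) := by
  have hc2 := C2_ge
  have hβ0 : 0 < β := by linarith
  refine le_trans ?_ (pr_fkg hβ0 (-(k : ℤ)) (Sq u v))
  refine le_trans ?_ (Finset.prod_le_prod (fun x _ => (exp_pos _).le) fun x _ => pr_site hβ (ray_Sq u v) x k)
  rw [← Real.exp_sum, exp_le_exp, Finset.sum_neg_distrib, ← mul_sum, neg_le_neg_iff]
  refine mul_le_mul_of_nonneg_left ?_ two_pos.le
  rw [← Finset.sum_filter_add_sum_filter_not _ (fun x => Qb (ell L) x ⊆ Sq u v)]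
  refine add_le_add ?_ ?_
  · refine (Finset.sum_le_card_nsmul _ _ _ fun x hx => pr_q hβ (ray_Sq u v) (Finset.mem_filter.1 hx).2 (k + 1)).trans ?_
    rw [nsmul_eq_mul]
    refine mul_le_mul_of_nonneg_right ?_ (add_nonneg (pc_nn _ _) (exp_pos _).le)
    exact_mod_cast (Finset.card_filter_le _ _).trans (card_Sq h)
  · refine (Finset.sum_le_card_nsmul _ _ (2 * exp (1 - k)) fun x hx => ?_).trans ?_
    · have := pr_crude hβ (ray_Sq u v) x (k + 1)
      rw [show (2 : ℝ) - (k + 1) = 1 - k by ring] at this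
      refine le_trans (pr_mono hβ0 fun η _ h => ?_) this
      refine le_trans ?_ (le_abs_self _)
      have h' : ((((k + 1 : ℕ) : ℤ)) : ℝ) ≤ ((η x : ℤ) : ℝ) := by exact_mod_cast h
      push_cast at h'; exact h'
    · rw [nsmul_eq_mul]
      refine mul_le_mul_of_nonneg_right ?_ (by positivity)
      exact_mod_cast card_bd (ell L) h

lemma box_eq (L : ℕ) : box L = Sq 1 L := rfl
lemma cl_at {η : Site → ℤ} (h : FP (η, 0)) {x : Site} (hx : η x ≠ 0) : ∃ c ∈ ClF (η, 0), c.1 x ≠ 0 :=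
  exists_ne_zero_of_sum_ne_zero ((fst_eq h x) ▸ hx)
lemma sp_fp {D : Finset Site} {η : Site → ℤ} (h : Sp D η) : FP (η, 0) := ⟨h.fs, FS.zero⟩
lemma up_num {β : ℝ} (hβ : 2 * C2 ≤ β) {L : ℕ} (hL : 1 ≤ L) {ε : ℝ} (hδ : exp (-(β / 2 - C2)) ≤ ε / 4) :
    pr β (box L) (fun ξ => ε * L ^ 2 ≤ (((box L).filter fun x => 1 ≤ ξ x).card : ℝ)) ≤ 2 * exp (-(β * L * ε / 4)) := by
  have hc2 := C2_ge
  have hβ0 : 0 < β := by linarith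
  have hL0 : (0 : ℝ) < L := by exact_mod_cast hL
  have hs : 0 < β / (2 * L) := by positivity
  have hε : 0 < ε := by linarith [exp_pos (-(β / 2 - C2))]
  refine (pr_tilt hβ (ray_Sq 1 L) (box L) (s := β / (2 * L)) (n0 := 1) (M := β * L * ε / 8) hs.le
    (fun c x => if tch c x then 1 else 0) (fun c x => by split_ifs <;> norm_num) (fun c x hc h => ?_) (fun c hc _ => ?_)
    (by positivity) ?_ (β * L * ε / 2) (fun η hη hA => ?_)).trans_eq (by ring_nf)
  · by_cases ht : tch c x
    · have : (1 : ℝ) ≤ En c := by exact_mod_cast hc.pos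
      simp [ht, this]
    · simp [ht] at h
  · rw [sum_boole]
    have h1 := card_tch hc.1 (Finset.Icc (1 : ℤ) L) (Finset.Icc (1 : ℤ) L)
    have h2 : (((box L).filter (tch c)).card : ℝ) ≤ L * En c := by
      rw [Int.card_Icc] at h1; simp at h1; exact_mod_cast h1
    calc β / (2 * L) * (((box L).filter (tch c)).card : ℝ) ≤ β / (2 * L) * (L * En c) := mul_le_mul_of_nonneg_left h2 hs.le
      _ = _ := by field_simp
  · have h1 : ((box L).card : ℝ) ≤ (L : ℝ) ^ 2 := by exact_mod_cast card_Sq (by simp)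
    rw [mul_one]
    calc β / (2 * L) * ((box L).card : ℝ) * exp (-(β / 2 - C2)) ≤ β / (2 * L) * (L : ℝ) ^ 2 * (ε / 4) := by gcongr
      _ = _ := by field_simp; norm_num
  · have h1 : (((box L).filter fun x => 1 ≤ η x).card : ℝ) ≤ ∑ x ∈ box L, ∑ c ∈ ClF (η, 0), if tch c x then (1 : ℝ) else 0 := by
      rw [← sum_boole]
      refine sum_le_sum fun x _ => ?_
      by_cases hx : 1 ≤ η x
      · obtain ⟨c, hc, hcx⟩ := cl_at (sp_fp hη) (x := x) (by omega)
        rw [if_pos hx]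
        refine le_trans ?_ (single_le_sum (f := fun c => if tch c x then (1 : ℝ) else 0) (fun _ _ => by split_ifs <;> norm_num) hc)
        simp [show tch c x from Or.inl hcx]
      · rw [if_neg hx]; exact sum_nonneg fun _ _ => by split_ifs <;> norm_num
    calc β * L * ε / 2 = β / (2 * L) * (ε * L ^ 2) := by field_simp
      _ ≤ _ := mul_le_mul_of_nonneg_left (le_trans hA h1) hs.le
lemma up_mul {β : ℝ} (hβ : 0 < β) {L : ℕ} (H : ℕ) (ε : ℝ) :
    pr β (box L) (fun η => (∀ x, 0 ≤ η x) ∧ ε * L ^ 2 ≤ (((box L).filter fun x => (H : ℤ) + 2 ≤ η x).card : ℝ)) *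
      pr β (box L) (fun η => ∀ x ∈ box L, -((H + 1 : ℕ) : ℤ) ≤ η x) ≤
    pr β (box L) (fun η => ∀ x, 0 ≤ η x) * pr β (box L) (fun ξ => ε * L ^ 2 ≤ (((box L).filter fun x => 1 ≤ ξ x).card : ℝ)) := by
  refine pr_ff hβ (k := ((H + 1 : ℕ) : ℤ)) (by positivity) _ _ _ _ fun η σ hη hσ h1 h2 => ⟨fun x => ?_, ?_⟩
  · simp only [Pi.inf_apply, le_inf_iff]
    refine ⟨h1.1 x, ?_⟩
    by_cases hx : x ∈ box L
    · have := h2 x hx; omega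
    · rw [hσ x hx]; positivity
  · refine h1.2.trans ?_
    refine Nat.cast_le.2 (card_le_card fun x hx => ?_)
    rw [Finset.mem_filter] at hx ⊢
    refine ⟨hx.1, ?_⟩
    have := le_max_left (η x) (σ x + ((H + 1 : ℕ) : ℤ))
    push_cast at *; omega
lemma ev_cost {β : ℝ} (hβ : 2 * C2 ≤ β) : ∀ᶠ L : ℕ in atTop, ∀ u v : ℤ, v - u + 1 ≤ L →
    exp (-(L / log L)) ≤ pr β (Sq u v) (fun η => ∀ x ∈ Sq u v, -((HH β L + 1 : ℕ) : ℤ) ≤ η x) ∧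
    exp (-(2 * L ^ 2 * pc β L (HH β L + 1) + L)) ≤ pr β (Sq u v) (fun η => ∀ x ∈ Sq u v, -((HH β L : ℕ) : ℤ) ≤ η x) := by
  have hc2 := C2_ge
  filter_upwards [HH_facts hβ, tlog.eventually_ge_atTop 1000, eventually_ge_atTop 1] with L hF ha hL u v huv
  obtain ⟨F1, F2, F3, F4, F5, F6⟩ := hF
  have hL1 : (1 : ℝ) ≤ L := by exact_mod_cast hL
  have hLe : exp (log L) = (L : ℝ) := exp_log (by linarith)
  have hl1 : (log L) ^ 2 ≤ ell L := Nat.le_ceil _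
  have hl2 : (ell L : ℝ) ≤ (log L) ^ 2 + 1 := (Nat.ceil_lt_add_one (sq_nonneg _)).le
  have c1 := cost hβ (HH β L + 1) huv
  have c0 := cost hβ (HH β L) huv
  set a := log L with hadef
  set H := HH β L with hH
  have a0 : 0 < a := by linarith
  have hee : exp 1 ≤ 3 := by have := Real.exp_one_lt_d9; linarith
  have t1 : L ^ 2 * exp (-(β - C1) * ell L) ≤ 1 / a ^ 2 := by
    have g1 : -(β - C1) * ell L ≤ -(3 * a) := by
      have : 3 ≤ β - C1 := by simp only [C2] at hβ hc2; linarith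
      have h2 : 1 * a ≤ ell L := by nlinarith
      nlinarith
    calc L ^ 2 * exp (-(β - C1) * ell L) ≤ L ^ 2 * exp (-(3 * a)) := by gcongr
      _ = exp (-a) := by rw [← hLe, ← exp_nat_mul, ← exp_add]; congr 1; push_cast; ring
      _ ≤ 1 / a ^ 2 := by
        rw [Real.exp_neg, ← one_div]
        refine one_div_le_one_div_of_le (by positivity) ?_
        have := Real.quadratic_le_exp_of_nonneg (x := a / 2) (by linarith)
        have h3 : exp a = exp (a / 2) * exp (a / 2) := by rw [← exp_add]; ring_nf
        rw [h3]
        have h4 : a ≤ exp (a / 2) := by nlinarith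
        nlinarith
  have t2 : 4 * (L * ell L) * (2 * exp (1 - H)) ≤ 1 / a ^ 2 * L := by
    have g1 : (ell L : ℝ) ≤ 2 * a ^ 2 := by nlinarith
    have g2 : exp (-(H : ℝ)) ≤ 1 / a ^ 10 := by rw [le_div_iff₀ (by positivity)]; linarith
    have g3 : exp (1 - H) = exp 1 * exp (-(H : ℝ)) := by rw [← exp_add]; ring_nf
    have g4 : 48 ≤ a ^ 6 := by
      calc (48 : ℝ) ≤ a := by linarith
        _ ≤ a ^ 6 := le_self_pow₀ (by linarith) (by norm_num)
    calc 4 * (L * ell L) * (2 * exp (1 - H)) ≤ 4 * (L * (2 * a ^ 2)) * (2 * (3 * (1 / a ^ 10))) := by rw [g3]; gcongr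
      _ = 48 * (L / a ^ 8) := by field_simp; norm_num
      _ ≤ a ^ 6 * (L / a ^ 8) := by gcongr
      _ = _ := by field_simp
  have t3 : 1 / a ^ 2 ≤ 1 / 16 * (1 / a) := by
    rw [show 1 / a ^ 2 = 1 / a * (1 / a) by field_simp]
    refine mul_le_mul_of_nonneg_right ?_ (by positivity)
    exact one_div_le_one_div_of_le (by norm_num) (by linarith)
  have t4 : 1 / a ≤ 1 := by rw [div_le_one a0]; linarith
  have t5 := mul_le_mul_of_nonneg_right t3 (show (0 : ℝ) ≤ L by linarith)
  have t6 := mul_le_mul_of_nonneg_right t4 (show (0 : ℝ) ≤ L by linarith)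
  have t7 : 1 / 16 * (1 / a) * 1 ≤ 1 / 16 * (1 / a) * L := mul_le_mul_of_nonneg_left hL1 (by positivity)
  constructor
  · refine le_trans (exp_le_exp.2 (neg_le_neg ?_)) c1
    have t8 : (L : ℝ) ^ 2 * pc β L (H + 1 + 1) ≤ 1 / a ^ 2 * L := by
      have g4 : (1 : ℝ) ≤ a ^ 6 := one_le_pow₀ (by linarith)
      have g5 : pc β L (H + 2) * (a ^ 2 * L) ≤ 1 := by
        have : 0 ≤ pc β L (H + 2) * (a ^ 2 * L) := mul_nonneg (pc_nn _ _) (by positivity)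
        have := mul_le_mul_of_nonneg_left g4 this
        nlinarith
      calc (L : ℝ) ^ 2 * pc β L (H + 1 + 1) = (pc β L (H + 2) * (a ^ 2 * L)) * (1 / a ^ 2 * L) := by field_simp
        _ ≤ 1 * (1 / a ^ 2 * L) := mul_le_mul_of_nonneg_right g5 (by positivity)
        _ = _ := one_mul _
    have t9 : 4 * (L * ell L) * (2 * exp (1 - ((H + 1 : ℕ) : ℝ))) ≤ 4 * (L * ell L) * (2 * exp (1 - H)) := by
      gcongr; push_cast; linarith
    have : (L : ℝ) / a = 1 / a * L := by ring
    rw [this]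
    have t0 : 0 ≤ 1 / a * (L : ℝ) := by positivity
    linarith
  · refine le_trans (exp_le_exp.2 (neg_le_neg ?_)) c0
    linarith
lemma upper {β : ℝ} (hβ : 2 * C2 ≤ β) {ε : ℝ} (hδ : exp (-(β / 2 - C2)) ≤ ε / 4) {κ : ℝ} (hκ : 0 < κ) : ∀ᶠ L : ℕ in atTop,
    pr β (box L) (fun η => (∀ x, 0 ≤ η x) ∧ ε * L ^ 2 ≤ (((box L).filter fun x => (HH β L : ℤ) + 2 ≤ η x).card : ℝ)) ≤
      κ * pr β (box L) (fun η => ∀ x, 0 ≤ η x) := by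
  have hc2 := C2_ge
  have hβ0 : 0 < β := by linarith
  have hε : 0 < ε := by linarith [exp_pos (-(β / 2 - C2))]
  have T : Tendsto (fun L : ℕ => 2 * exp (-(β * ε / 8 * L))) atTop (𝓝 0) := by
    rw [show (0 : ℝ) = 2 * 0 by simp]
    exact (Real.tendsto_exp_neg_atTop_nhds_zero.comp (tendsto_natCast_atTop_atTop.const_mul_atTop (by positivity : 0 < β * ε / 8))).const_mul 2
  filter_upwards [ev_cost hβ, T.eventually_le_const hκ, tlog.eventually_ge_atTop (8 / (β * ε)), eventually_ge_atTop 1] with L h1 h2 h3 hL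
  have g1 := (h1 1 L (by simp)).1
  have g2 := up_mul hβ0 (L := L) (HH β L) ε
  have g3 := up_num hβ hL hδ
  set p := pr β (box L) (fun η => ∀ x, 0 ≤ η x)
  set q := pr β (box L) (fun η => (∀ x, 0 ≤ η x) ∧ ε * L ^ 2 ≤ (((box L).filter fun x => (HH β L : ℤ) + 2 ≤ η x).card : ℝ))
  have p0 : 0 ≤ p := pr_nonneg
  have q0 : 0 ≤ q := pr_nonneg
  have g4 : q * exp (-(L / log L)) ≤ p * (2 * exp (-(β * L * ε / 4))) :=
    (mul_le_mul_of_nonneg_left g1 q0).trans (g2.trans (mul_le_mul_of_nonneg_left g3 p0))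
  have g5 : (L : ℝ) / log L ≤ β * ε / 8 * L := by
    have a0 : 0 < log L := lt_of_lt_of_le (by positivity) h3
    rw [div_le_iff₀ a0]
    have : 8 / (β * ε) * (β * ε / 8 * L) ≤ log L * (β * ε / 8 * L) := mul_le_mul_of_nonneg_right h3 (by positivity)
    have e : 8 / (β * ε) * (β * ε / 8 * L) = L := by field_simp
    linarith
  have g6 : q = (q * exp (-(L / log L))) * exp (L / log L) := by
    rw [mul_assoc, ← exp_add, neg_add_cancel, Real.exp_zero, mul_one]
  rw [g6]
  calc _ ≤ p * (2 * exp (-(β * L * ε / 4))) * exp (L / log L) := mul_le_mul_of_nonneg_right g4 (exp_pos _).le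
    _ = p * (2 * exp (-(β * L * ε / 4) + L / log L)) := by rw [exp_add]; ring
    _ ≤ p * (2 * exp (-(β * ε / 8 * L))) := by gcongr; linarith
    _ ≤ p * κ := mul_le_mul_of_nonneg_left h2 p0
    _ = κ * p := mul_comm _ _

structure Lay (D D' X : Finset Site) (ℓ : ℕ) : Prop where
  rD : Ray D
  rD' : Ray D'
  sub : ∀ x ∈ X, Qb ℓ x ⊆ D
  eq : ∀ y, y ∈ D' ↔ ∃ x ∈ X, y ∈ Qb ℓ x
  sep : ∀ x ∈ X, ∀ y ∈ X, y ∈ Qb (2 * ℓ + 1) x → x = y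
def vS (ℓ : ℕ) (ω : Fld) (x : Site) : ℤ := ∑ c ∈ ClF ω, if En c ≤ ℓ then c.2 x else c.1 x
def JS (X : Finset Site) (ℓ : ℕ) (ω : Fld) : Finset Site := X.filter fun x => vS ℓ ω x ≤ -1
def PI (ℓ : ℕ) (I : Finset Site) (c : Fld) : Prop := En c ≤ ℓ ∧ ∃ x ∈ I, tch c x
lemma PI_sw (ℓ I) : SwInv (PI ℓ I) := fun c => by simp only [PI, tch_sw, En_sw]
section
variable {D D' X : Finset Site} {ℓ : ℕ}
lemma Lay.sub' (h : Lay D D' X ℓ) {x} (hx : x ∈ X) : Qb ℓ x ⊆ D' := fun y hy => (h.eq y).2 ⟨x, hx, hy⟩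
lemma Lay.PI_c (h : Lay D D' X ℓ) {I} (hI : I ⊆ X) : ∀ c, Conn c → SpP D D' c → PI ℓ I c → SpP D D' (c.2, c.1) := by
  rintro c hcon hs ⟨he, x, hx, ht⟩
  have key : ∀ y, y ∉ Qb ℓ x → ¬ tch c y := fun y hy ht' => hy (diam hcon ht ht' he)
  simp only [tch, not_or, not_not] at key
  exact ⟨fun y hy => (key y fun h' => hy (h.sub x (hI hx) h')).2, fun y hy => (key y fun h' => hy (h.sub' (hI hx) h')).1⟩
lemma act_in {I : Finset Site} {ω : Fld} {x} (hx : x ∈ I) : (act (PI ℓ I) ω).1 x = vS ℓ ω x := by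
  rw [act, sum_fst, vS]
  refine sum_congr rfl fun c hc => ?_
  unfold swp
  by_cases hl : En c ≤ ℓ
  · rw [if_pos hl]
    by_cases ht : tch c x
    · rw [if_pos ⟨hl, x, hx, ht⟩]
    · simp only [tch, not_or, not_not] at ht
      split_ifs <;> simp [ht.1, ht.2]
  · rw [if_neg hl, if_neg fun h => hl h.1]
lemma Lay.act_out (h : Lay D D' X ℓ) {I : Finset Site} (hI : I ⊆ X) {ω : Fld} (hω : FP ω) {x} (hx : x ∈ X) (hxI : x ∉ I) :
    (act (PI ℓ I) ω).1 x = ω.1 x := by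
  rw [act, sum_fst, fst_eq hω]
  refine sum_congr rfl fun c hc => ?_
  unfold swp
  split_ifs with hp
  · obtain ⟨he, y, hy, ht⟩ := hp
    have : ¬ tch c x := fun ht' => by
      have h1 := diam ((mem_ClF hω).1 hc).1 ht ht' he
      have := h.sep y (hI hy) x hx (by rw [mem_Qb] at h1 ⊢; push_cast; omega)
      exact hxI (this ▸ hy)
    simp only [tch, not_or, not_not] at this
    simp [this.1, this.2]
  · rfl
lemma Lay.inj (h : Lay D D' X ℓ) (β : ℝ) (t : ℕ) :
    2 ^ t * ∑' ω : Fld, (if (∀ x, 0 ≤ ω.1 x) ∧ t ≤ (JS X ℓ ω).card then wP β D D' ω else 0) ≤ ZP β D D' := by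
  rw [← ENNReal.tsum_mul_left]
  have key : ∑' p : Fld × Finset Site, (if (∀ x, 0 ≤ p.1.1 x) ∧ p.2 ⊆ JS X ℓ p.1 then wP β D D' p.1 else 0) ≤ ZP β D D' := by
    have sp : ∀ p : Fld × Finset Site, (if (∀ x, 0 ≤ p.1.1 x) ∧ p.2 ⊆ JS X ℓ p.1 then wP β D D' p.1 else 0) ≠ 0 →
        (∀ x, 0 ≤ p.1.1 x) ∧ p.2 ⊆ JS X ℓ p.1 ∧ SpP D D' p.1 := by
      intro p hp
      by_cases hh : (∀ x, 0 ≤ p.1.1 x) ∧ p.2 ⊆ JS X ℓ p.1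
      · rw [if_pos hh] at hp; exact ⟨hh.1, hh.2, wP_sp hp⟩
      · rw [if_neg hh] at hp; exact absurd rfl hp
    have hrec : ∀ p : Fld × Finset Site, (∀ x, 0 ≤ p.1.1 x) ∧ p.2 ⊆ JS X ℓ p.1 ∧ SpP D D' p.1 →
        p.2 = X.filter fun x => (act (PI ℓ p.2) p.1).1 x ≤ -1 := by
      intro p hp
      have hI : p.2 ⊆ X := hp.2.1.trans (Finset.filter_subset _ _)
      ext x
      rw [Finset.mem_filter]
      constructor
      · intro hx
        refine ⟨hI hx, ?_⟩
        rw [act_in hx]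
        exact (Finset.mem_filter.1 (hp.2.1 hx)).2
      · rintro ⟨hx, hx2⟩
        by_contra hn
        rw [h.act_out hI hp.2.2.fp hx hn] at hx2
        have := hp.1 x
        omega
    refine tsum_inj _ _ (fun p => act (PI ℓ p.2) p.1) ?_ ?_
    · intro p p' hp hp' he
      have q := sp p hp
      have q' := sp p' hp'
      have e2 : p.2 = p'.2 := by rw [hrec p q, hrec p' q', he]
      refine Prod.ext ?_ e2
      have he : act (PI ℓ p.2) p.1 = act (PI ℓ p'.2) p'.1 := he
      rw [← act_act (PI_sw ℓ p.2) q.2.2.fp, he, e2, act_act (PI_sw ℓ p'.2) q'.2.2.fp]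
    · intro p hp
      have q := sp p hp
      rw [if_pos ⟨q.1, q.2.1⟩, act_w (PI_sw _ _) h.rD h.rD' q.2.2 (h.PI_c (q.2.1.trans (Finset.filter_subset _ _)))]
  refine le_trans ?_ key
  rw [ENNReal.tsum_prod (f := fun ω I => if (∀ x, 0 ≤ ω.1 x) ∧ I ⊆ JS X ℓ ω then wP β D D' ω else 0)]
  refine tsum_le_tsum fun ω => ?_
  by_cases hh : (∀ x, 0 ≤ ω.1 x) ∧ t ≤ (JS X ℓ ω).card
  · rw [if_pos hh]
    refine le_trans ?_ (ENNReal.sum_le_tsum (JS X ℓ ω).powerset)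
    rw [sum_congr rfl (g := fun _ => wP β D D' ω) fun I hI => if_pos ⟨hh.1, Finset.mem_powerset.1 hI⟩, sum_const, Finset.card_powerset, nsmul_eq_mul]
    push_cast
    exact mul_le_mul_left (pow_le_pow_right₀ (by norm_num) hh.2) _
  · rw [if_neg hh, mul_zero]; exact zero_le
lemma Lay.exitE (h : Lay D D' X ℓ) {c : Fld} (hc : SpP D D' c) {x} (hx : x ∈ X) (h0 : c.2 x ≠ 0) :
    ∃ e : Edge, gp c e ≠ 0 ∧ e.1 ∈ Qb ℓ x := by
  obtain ⟨k, h1, h2⟩ := hc.2.fs.exit false x h0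
  refine ⟨_, fun hg => h2 (Prod.ext_iff.1 hg).2, ?_⟩
  have hk : k ≤ ℓ := by
    by_contra hk
    have h3 := h1 (ℓ + 1) (by omega)
    have h4 : ray false x ((ℓ + 1 : ℕ) : ℤ) ∉ D' := by
      rw [h.eq]
      rintro ⟨y, hy, hq⟩
      simp only [ray, mem_Qb] at hq
      have := h.sep x hx y hy (by rw [mem_Qb]; push_cast at hq ⊢; simp at hq; omega)
      subst this
      simp at hq
    rw [hc.2 _ h4] at h3
    exact h0 h3.symm
  simp only [ray, mem_Qb]; simp; omega
lemma Lay.large (h : Lay D D' X ℓ) {β : ℝ} (hβ : 2 * C2 ≤ β) (hM : β / 2 * X.card * exp (-(β / 2 - C2) * ℓ) ≤ 1) (t : ℝ) :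
    ∑' ω : Fld, (if t ≤ ((X.filter fun x => ∃ c ∈ ClF ω, ℓ < En c ∧ c.2 x ≠ 0).card : ℝ) then wP β D D' ω else 0) ≤
      2 * ex (2 - β / 2 * t) * ZP β D D' := by
  have hc2 := C2_ge
  have hβ0 : 0 < β / 2 := by linarith
  have := tiltS hβ h.rD h.rD' X (s := β / 2) (n0 := ℓ) (M := 1) hβ0.le (fun c x => if ℓ < En c ∧ c.2 x ≠ 0 then 1 else 0)
    (fun c x => by split_ifs <;> norm_num) (fun c x hc h0 => ?_) (fun c hc hs => ?_) one_pos hM (β / 2 * t)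
  · rw [mul_one] at this
    refine le_trans (tsum_le_tsum fun ω => ?_) this
    by_cases hh : t ≤ ((X.filter fun x => ∃ c ∈ ClF ω, ℓ < En c ∧ c.2 x ≠ 0).card : ℝ)
    · rw [if_pos hh, if_pos]
      refine mul_le_mul_of_nonneg_left (hh.trans ?_) hβ0.le
      rw [← sum_boole]
      refine sum_le_sum fun x _ => ?_
      by_cases hx : ∃ c ∈ ClF ω, ℓ < En c ∧ c.2 x ≠ 0
      · rw [if_pos hx]
        obtain ⟨c, hc, hcx⟩ := hx
        refine le_trans ?_ (single_le_sum (f := fun c : Fld => if ℓ < En c ∧ c.2 x ≠ 0 then (1 : ℝ) else 0) (fun _ _ => by split_ifs <;> norm_num) hc)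
        simp only [if_pos hcx, le_refl]
      · rw [if_neg hx]; exact sum_nonneg fun _ _ => by split_ifs <;> norm_num
    · rw [if_neg hh]; exact zero_le
  · by_cases hh : ℓ < En c ∧ c.2 x ≠ 0
    · rw [if_pos hh]
      exact ⟨Or.inr hh.2, by exact_mod_cast hh.1.le, by exact_mod_cast hc.pos⟩
    · rw [if_neg hh] at h0; exact absurd rfl h0
  · refine mul_le_mul_of_nonneg_left ?_ hβ0.le
    rw [sum_boole]
    set Y := X.filter fun x => ℓ < En c ∧ c.2 x ≠ 0
    have hY : ∀ x : Site, ∃ e : Edge, x ∈ Y → gp c e ≠ 0 ∧ e.1 ∈ Qb ℓ x := by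
      intro x
      by_cases hx : x ∈ Y
      · obtain ⟨hx1, hx2⟩ := Finset.mem_filter.1 hx
        obtain ⟨e, he⟩ := h.exitE hs hx1 hx2.2
        exact ⟨e, fun _ => he⟩
      · exact ⟨(0, false), fun h => absurd h hx⟩
    choose e he using hY
    have hinj : Set.InjOn e Y := by
      intro x hx y hy hxy
      have h1 := (he x hx).2
      have h2 := (he y hy).2
      rw [hxy] at h1
      refine h.sep x (Finset.mem_filter.1 hx).1 y (Finset.mem_filter.1 hy).1 ?_
      rw [mem_Qb] at h1 h2 ⊢; push_cast; omega
    rw [← Finset.card_image_of_injOn hinj]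
    exact_mod_cast card_le_En hc.1 _ fun f hf => by
      obtain ⟨x, hx, rfl⟩ := Finset.mem_image.1 hf
      exact (he x hx).1
end

def V (β : ℝ) (D : Finset Site) (f : (Site → ℤ) → ℝ≥0∞) : ℝ≥0∞ := ∑' η, wD β D η * f η
lemma V_mul {β : ℝ} {D D₁ D₂ : Finset Site} (hD : ∀ x, x ∈ D ↔ x ∈ D₁ ∨ x ∈ D₂)
    (hn : ∀ e : Edge, (e.1 ∉ D₁ ∧ nb e ∉ D₁) ∨ (e.1 ∉ D₂ ∧ nb e ∉ D₂)) (f g : (Site → ℤ) → ℝ≥0∞)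
    (hf : ∀ a b, Sp D₁ a → Sp D₂ b → f (a + b) = f a ∧ g (a + b) = g b) :
    V β D (fun η => f η * g η) = V β D₁ f * V β D₂ g := by
  have dj : ∀ x, x ∉ D₁ ∨ x ∉ D₂ := fun x => (hn (x, true)).imp And.left And.left
  have key : ∀ a b, Sp D₁ a → Sp D₂ b → wD β D (a + b) * (f (a + b) * g (a + b)) = wP β D₁ D₂ (a, b) * (f a * g b) := by
    intro a b ha hb
    rw [(hf a b ha hb).1, (hf a b ha hb).2]
    congr 1
    have hs : Sp D (a + b) := fun x hx => by
      rw [hD, not_or] at hx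
      simp [ha x hx.1, hb x hx.2]
    rw [wP, wD, wD, wD, if_pos hs, if_pos ha, if_pos hb, ← ex_add]
    congr 1
    have : E1 (a + b) = E1 a + E1 b := by
      have A := ha.fs.gf
      have B := hb.fs.gf
      have z : ∀ e, gr a e = 0 ∨ gr b e = 0 := fun e => (hn e).imp (fun h => by simp [gr, ha _ h.1, ha _ h.2]) fun h => by simp [gr, hb _ h.1, hb _ h.2]
      rw [E1_eq (η := a + b) (s := A.fs ∪ B.fs) (fun e he => ?_), E1_eq (η := a) (s := A.fs ∪ B.fs) (fun e he => by simp [A.mem, he]),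
        E1_eq (η := b) (s := A.fs ∪ B.fs) (fun e he => by simp [B.mem, he]), ← sum_add_distrib]
      · refine sum_congr rfl fun e _ => ?_
        rw [gr_add]
        rcases z e with h | h <;> simp [h]
      · rw [gr_add] at he
        simp only [Finset.mem_union, A.mem, B.mem]
        by_contra! hh
        exact he (by rw [hh.1, hh.2]; rfl)
    rw [this]; push_cast; ring
  rw [V, V, V, ← ZP_eq]
  have r : ∀ (D₁ : Finset Site) (η : Site → ℤ), Sp D₁ (fun x => if x ∈ D₁ then η x else 0) := fun D η x hx => if_neg hx
  refine le_antisymm (tsum_inj _ _ (fun η => ((fun x => if x ∈ D₁ then η x else 0), fun x => if x ∈ D₂ then η x else 0)) ?_ ?_)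
    (tsum_inj _ _ (fun ω => ω.1 + ω.2) ?_ ?_)
  · intro η η' h h' he
    funext x
    by_cases hx : x ∈ D
    · have h1 := congrFun (Prod.ext_iff.1 he).1 x
      have h2 := congrFun (Prod.ext_iff.1 he).2 x
      simp only at h1 h2
      rcases (hD x).1 hx with q | q
      · rwa [if_pos q, if_pos q] at h1
      · rwa [if_pos q, if_pos q] at h2
    · rw [wD_sp (left_ne_zero_of_mul h) x hx, wD_sp (left_ne_zero_of_mul h') x hx]
  · intro η h
    have hs := wD_sp (left_ne_zero_of_mul h)
    have e : η = (fun x => if x ∈ D₁ then η x else 0) + fun x => if x ∈ D₂ then η x else 0 := by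
      funext x
      simp only [Pi.add_apply]
      rcases dj x with q | q
      · rw [if_neg q]
        by_cases q' : x ∈ D₂
        · rw [if_pos q', zero_add]
        · rw [if_neg q', hs x (by rw [hD]; tauto)]; rfl
      · rw [if_neg q]
        by_cases q' : x ∈ D₁
        · rw [if_pos q', add_zero]
        · rw [if_neg q', hs x (by rw [hD]; tauto)]; rfl
    conv_lhs => rw [e]
    rw [key _ _ (r _ _) (r _ _)]
  · intro ω ω' h h' he
    have s := wP_sp (left_ne_zero_of_mul h)
    have s' := wP_sp (left_ne_zero_of_mul h')
    have he : ω.1 + ω.2 = ω'.1 + ω'.2 := he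
    refine Prod.ext (funext fun x => ?_) (funext fun x => ?_)
    · have hx := congrFun he x
      simp only [Pi.add_apply] at hx
      rcases dj x with q | q
      · rw [s.1 x q, s'.1 x q]
      · rwa [s.2 x q, s'.2 x q, add_zero, add_zero] at hx
    · have hx := congrFun he x
      simp only [Pi.add_apply] at hx
      rcases dj x with q | q
      · rwa [s.1 x q, s'.1 x q, zero_add, zero_add] at hx
      · rw [s.2 x q, s'.2 x q]
  · intro ω h
    have s := wP_sp (left_ne_zero_of_mul h)
    rw [key _ _ s.1 s.2]
lemma V_prod (β : ℝ) {ℓ : ℕ} {X : Finset Site} (f : Site → ℤ → ℝ≥0∞) (hX : ∀ x ∈ X, ∀ y ∈ X, y ∈ Qb (2 * ℓ + 1) x → x = y) :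
    V β (X.biUnion (Qb ℓ)) (fun η => ∏ x ∈ X, f x (η x)) = ∏ x ∈ X, V β (Qb ℓ x) (fun η => f x (η x)) := by
  induction X using Finset.induction_on with
  | empty =>
    simp only [Finset.biUnion_empty, Finset.prod_empty, V, mul_one]
    exact Z_empty β
  | insert x X hx ih =>
    have self : ∀ y, y ∈ Qb ℓ y := fun y => by rw [mem_Qb]; omega
    have hh : ∀ y ∈ X, y ∉ Qb (2 * ℓ + 1) x := fun y hy h => by
      have := hX x (by simp) y (by simp [hy]) h
      exact hx (this ▸ hy)
    rw [Finset.prod_insert hx, ← ih fun a ha b hb => hX a (by simp [ha]) b (by simp [hb])]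
    simp only [Finset.prod_insert hx]
    refine V_mul (fun y => by simp) (fun e => ?_) (fun η => f x (η x)) (fun η => ∏ x ∈ X, f x (η x)) fun a b ha hb => ⟨?_, ?_⟩
    · by_contra! hc
      have h1 : e.1 ∈ Qb ℓ x ∨ nb e ∈ Qb ℓ x := by by_contra! h; exact h.2 (hc.1 h.1)
      have h2 : e.1 ∈ X.biUnion (Qb ℓ) ∨ nb e ∈ X.biUnion (Qb ℓ) := by by_contra! h; exact h.2 (hc.2 h.1)
      have h3 : ∃ y ∈ X, e.1 ∈ Qb ℓ y ∨ nb e ∈ Qb ℓ y := by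
        simp only [mem_biUnion] at h2
        rcases h2 with ⟨y, h, h'⟩ | ⟨y, h, h'⟩
        exacts [⟨y, h, Or.inl h'⟩, ⟨y, h, Or.inr h'⟩]
      obtain ⟨y, hy, h3⟩ := h3
      refine hh y hy ?_
      obtain ⟨⟨p, q⟩, b⟩ := e
      cases b <;> simp only [nb, mem_Qb] at h1 h3 ⊢ <;> simp at h1 h3 ⊢ <;> omega
    · have : b x = 0 := hb x fun h => by
        obtain ⟨y, hy, h⟩ := mem_biUnion.1 h
        refine hh y hy ?_
        rw [mem_Qb] at h ⊢; push_cast; omega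
      simp [this]
    · refine Finset.prod_congr rfl fun y hy => ?_
      have : a y = 0 := ha y fun h => hh y hy (by rw [mem_Qb] at h ⊢; push_cast; omega)
      simp [this]
lemma V_half {β : ℝ} (hβ : 0 < β) {D : Finset Site} {A : (Site → ℤ) → Prop} {p : ℝ} (hp : p ≤ pr β D A) (hp0 : 0 ≤ p) :
    V β D (fun η => if A η then 2⁻¹ else 1) ≤ ex (-(p / 2)) * Z β D := by
  have e : V β D (fun η => if A η then 2⁻¹ else 1) = 2⁻¹ * W β D A + W β D (fun η => ¬ A η) := by
    rw [V, W, W, ← ENNReal.tsum_mul_left, ← ENNReal.tsum_add]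
    refine tsum_congr fun η => ?_
    by_cases h : A η
    · simp only [h, if_true, not_true, if_false, add_zero]; rw [mul_comm]
    · simp only [h, if_true, not_false_iff, if_false]; simp
  rw [e, W_eq hβ, W_eq hβ, ← mul_assoc, ← add_mul]
  refine mul_le_mul_left ?_ _
  have : (2⁻¹ : ℝ≥0∞) = ofReal (1 / 2) := by
    rw [one_div, ENNReal.ofReal_inv_of_pos two_pos]; simp
  have h1 := pr_compl hβ (D := D) A
  have h2 := pr_nonneg (β := β) (D := D) (A := A)
  have h3 := pr_nonneg (β := β) (D := D) (A := fun η => ¬ A η)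
  rw [this, ← ofReal_mul (by norm_num), ← ofReal_add (by positivity) h3, ex]
  refine ofReal_le_ofReal ?_
  have := add_one_le_exp (-(p / 2))
  linarith
lemma Lay.few {D D' X : Finset Site} {L : ℕ} (h : Lay D D' X (ell L)) {β : ℝ} (hβ : 2 * C2 ≤ β) (A : Finset Site) (hA : A ⊆ X) (H : ℕ) (t : ℕ) :
    W β D' (fun σ => (A.filter fun x => σ x ≤ -(H : ℤ)).card ≤ t) ≤ 2 ^ t * ex (-(pc β L H * A.card / 2)) * Z β D' := by
  have hc2 := C2_ge
  have hβ0 : 0 < β := by linarith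
  have hD : D' = X.biUnion (Qb (ell L)) := by ext y; rw [h.eq]; simp
  have hZ : Z β D' = ∏ x ∈ X, Z β (Qb (ell L) x) := by
    have := V_prod β (fun _ _ => 1) h.sep
    rw [← hD] at this
    simpa [V, Z] using this
  have hV := V_prod β (fun x v => if x ∈ A ∧ v ≤ -(H : ℤ) then 2⁻¹ else 1) h.sep
  rw [← hD] at hV
  calc _ ≤ 2 ^ t * V β D' (fun η => ∏ x ∈ X, if x ∈ A ∧ η x ≤ -(H : ℤ) then 2⁻¹ else 1) := by
        rw [W, V, ← ENNReal.tsum_mul_left]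
        refine tsum_le_tsum fun η => ?_
        by_cases hh : (A.filter fun x => η x ≤ -(H : ℤ)).card ≤ t
        · rw [if_pos hh, Finset.prod_ite]
          have e : X.filter (fun x => x ∈ A ∧ η x ≤ -(H : ℤ)) = A.filter fun x => η x ≤ -(H : ℤ) := by
            ext x; simp only [Finset.mem_filter]; constructor
            · tauto
            · exact fun q => ⟨hA q.1, q⟩
          rw [e, prod_const, Finset.prod_const_one, mul_one, mul_comm (wD _ _ _), ← mul_assoc]
          refine le_mul_of_one_le_left zero_le ?_
          calc (1 : ℝ≥0∞) = 2 ^ t * 2⁻¹ ^ t := by rw [← mul_pow, ENNReal.mul_inv_cancel (by norm_num) (by norm_num), one_pow]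
            _ ≤ _ := mul_le_mul_right (pow_le_pow_right_of_le_one' (by norm_num) hh) _
        · rw [if_neg hh]; exact zero_le
    _ ≤ 2 ^ t * ((∏ x ∈ X, if x ∈ A then ex (-(pc β L H / 2)) else 1) * Z β D') := by
        rw [hV, hZ, ← Finset.prod_mul_distrib]
        refine mul_le_mul_right (Finset.prod_le_prod' fun x hx => ?_) _
        by_cases hxA : x ∈ A
        · simp only [hxA, true_and, if_true]
          have q := V_half hβ0 (p := pc β L H) (D := Qb (ell L) x) (A := fun η => η x ≤ -(H : ℤ)) ?_ (pc_nn _ _)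
          · refine le_of_eq_of_le (tsum_congr fun η => ?_) q
            by_cases hh : η x ≤ -(H : ℤ) <;> simp only [hh, if_true, if_false]
          rw [pc_eq hβ x, ← pr_neg hβ0]
          exact pr_mono hβ0 fun η _ h => by simp only [Pi.neg_apply] at h; omega
        · simp [hxA, V, Z]
    _ = _ := by
        rw [Finset.prod_ite_mem, Finset.inter_eq_right.2 hA, prod_const, ← mul_assoc]
        congr 2
        rw [ex, ex, ← ENNReal.ofReal_pow (exp_pos _).le, ← exp_nat_mul]
        congr 2; ring

def Qs (ℓ H : ℕ) (η : Site → ℤ) (x : Site) : Prop := η x ≤ (H : ℤ) - 1 ∧ ∀ c ∈ ClF (η, 0), En c ≤ ℓ → c.1 x = 0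
lemma Qs_vS {ℓ H : ℕ} {ω : Fld} (hω : FP ω) {x} (h : Qs ℓ H ω.1 x) (hσ : ω.2 x ≤ -(H : ℤ)) (hn : ¬ ∃ c ∈ ClF ω, ℓ < En c ∧ c.2 x ≠ 0) :
    vS ℓ ω x ≤ -1 := by
  have : vS ℓ ω x = ω.1 x + ω.2 x := by
    rw [fst_eq hω, snd_eq hω, vS, ← sum_add_distrib]
    refine sum_congr rfl fun c hc => ?_
    split_ifs with hl
    · have : c.1 x = 0 := by
        by_contra h0
        obtain ⟨c', h1, h2, h3⟩ := single_cl hω ((mem_ClF hω).1 hc) h0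
        exact h3 (h.2 c' ((mem_ClF (ω := (ω.1, 0)) ⟨hω.1, FS.zero⟩).2 h1) (h2.trans hl))
      rw [this, zero_add]
    · have : c.2 x = 0 := by
        by_contra h0
        exact hn ⟨c, hc, not_le.1 hl, h0⟩
      rw [this, add_zero]
  have h1 := h.1
  omega
lemma Lay.main {D D' X : Finset Site} {L : ℕ} (h : Lay D D' X (ell L)) {β : ℝ} (hβ : 2 * C2 ≤ β)
    (hM : β / 2 * X.card * exp (-(β / 2 - C2) * ell L) ≤ 1) (H m t : ℕ) :
    pr β D (fun η => (∀ x, 0 ≤ η x) ∧ m ≤ (X.filter (Qs (ell L) H η)).card) ≤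
      (1 / 2) ^ t + 2 * exp (2 - β / 2 * t) + 2 ^ (2 * t) * exp (-(pc β L H * m / 2)) := by
  have hc2 := C2_ge
  have hβ0 : 0 < β := by linarith
  refine pr_le_of hβ0 (by positivity) ?_
  have hZ0 := Z_ne_zero β D'
  have hZ1 := Z_ne_top hβ0 D'
  refine (ENNReal.mul_le_mul_iff_left hZ0 hZ1).1 ?_
  rw [← W_fst]
  have a1 : ∑' ω : Fld, (if (∀ x, 0 ≤ ω.1 x) ∧ t ≤ (JS X (ell L) ω).card then wP β D D' ω else 0) ≤ ofReal ((1 / 2) ^ t) * ZP β D D' := by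
    have e : ofReal ((1 / 2) ^ t) * 2 ^ t = 1 := by
      rw [show (2 : ℝ≥0∞) ^ t = ofReal (2 ^ t) by rw [ENNReal.ofReal_pow two_pos.le]; simp, ← ofReal_mul (by positivity), ← mul_pow]
      norm_num
    have := mul_le_mul_right (h.inj β t) (ofReal ((1 / 2) ^ t))
    rwa [← mul_assoc, e, one_mul] at this
  have a2 := h.large hβ hM t
  have a3 : ∑' ω : Fld, (if m ≤ (X.filter (Qs (ell L) H ω.1)).card ∧ ((X.filter (Qs (ell L) H ω.1)).filter fun x => ω.2 x ≤ -(H : ℤ)).card ≤ 2 * t then wP β D D' ω else 0) ≤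
      ofReal (2 ^ (2 * t) * exp (-(pc β L H * m / 2))) * ZP β D D' := by
    rw [ZP_mul, Z, ← ENNReal.tsum_mul_right, ← ENNReal.tsum_mul_left,
      ENNReal.tsum_prod (f := fun η σ => if m ≤ (X.filter (Qs (ell L) H η)).card ∧ ((X.filter (Qs (ell L) H η)).filter fun x => σ x ≤ -(H : ℤ)).card ≤ 2 * t then wP β D D' (η, σ) else 0)]
    refine tsum_le_tsum fun η => ?_
    by_cases hm : m ≤ (X.filter (Qs (ell L) H η)).card
    · simp only [hm, true_and]
      calc _ = wD β D η * W β D' (fun σ => ((X.filter (Qs (ell L) H η)).filter fun x => σ x ≤ -(H : ℤ)).card ≤ 2 * t) := by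
            rw [W, ← ENNReal.tsum_mul_left]
            refine tsum_congr fun σ => ?_
            split_ifs <;> simp [wP]
        _ ≤ wD β D η * (ofReal (2 ^ (2 * t) * exp (-(pc β L H * m / 2))) * Z β D') := by
            refine mul_le_mul_right ((h.few hβ _ (Finset.filter_subset _ _) H (2 * t)).trans (mul_le_mul_left ?_ _)) _
            rw [ofReal_mul (by positivity), ENNReal.ofReal_pow two_pos.le]
            simp only [ofReal_ofNat]
            refine mul_le_mul_right (ex_mono ?_) _
            have := mul_le_mul_of_nonneg_left (Nat.cast_le (α := ℝ).2 hm) (pc_nn (β := β) L H)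
            linarith
        _ = _ := by ring
    · simp only [hm, false_and, if_false, tsum_zero]; exact zero_le
  have hsum : ofReal ((1 / 2) ^ t + 2 * exp (2 - β / 2 * t) + 2 ^ (2 * t) * exp (-(pc β L H * m / 2))) * Z β D * Z β D' =
      ofReal ((1 / 2) ^ t) * ZP β D D' + 2 * ex (2 - β / 2 * t) * ZP β D D' + ofReal (2 ^ (2 * t) * exp (-(pc β L H * m / 2))) * ZP β D D' := by
    rw [ofReal_add (by positivity) (by positivity), ofReal_add (by positivity) (by positivity), ofReal_mul two_pos.le, ZP_mul, ex]
    simp only [ofReal_ofNat]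
    ring
  rw [hsum]
  refine le_trans ?_ (add_le_add (add_le_add a1 a2) a3)
  rw [← ENNReal.tsum_add, ← ENNReal.tsum_add]
  refine tsum_le_tsum fun ω => ?_
  by_cases hA : (∀ x, 0 ≤ ω.1 x) ∧ m ≤ (X.filter (Qs (ell L) H ω.1)).card
  · by_cases hw : wP β D D' ω = 0
    · simp [hw]
    have hω := (wP_sp hw).fp
    rw [if_pos hA]
    by_cases c1 : t ≤ (JS X (ell L) ω).card
    · rw [if_pos ⟨hA.1, c1⟩, add_assoc]; exact le_self_add
    by_cases c2 : (t : ℝ) ≤ ((X.filter fun x => ∃ c ∈ ClF ω, ell L < En c ∧ c.2 x ≠ 0).card : ℝ)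
    · rw [if_pos c2, add_right_comm]; exact le_add_self
    rw [if_pos (c := m ≤ _ ∧ _) ⟨hA.2, ?_⟩]
    · exact le_add_self
    · rw [Nat.cast_le] at c2
      have hsub : ((X.filter (Qs (ell L) H ω.1)).filter fun x => ω.2 x ≤ -(H : ℤ)) ⊆
          JS X (ell L) ω ∪ X.filter fun x => ∃ c ∈ ClF ω, ell L < En c ∧ c.2 x ≠ 0 := by
        intro x hx
        simp only [Finset.mem_filter, JS, Finset.mem_union] at hx ⊢
        by_cases hn : ∃ c ∈ ClF ω, ell L < En c ∧ c.2 x ≠ 0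
        · exact Or.inr ⟨hx.1.1, hn⟩
        · exact Or.inl ⟨hx.1.1, Qs_vS hω hx.1.2 hx.2 hn⟩
      have := (card_le_card hsub).trans (card_union_le _ _)
      omega
  · rw [if_neg hA]; exact zero_le

lemma sm_num {β : ℝ} (hβ : 2 * C2 ≤ β) {L ℓ : ℕ} (hL : 1 ≤ L) (hℓ : 1 ≤ ℓ) {ε : ℝ} (hδ : exp (-(β / 2 - C2)) ≤ ε / 4) :
    pr β (box L) (fun ξ => ε * L ^ 2 ≤ (((box L).filter fun x => ∃ c ∈ ClF (ξ, 0), En c ≤ ℓ ∧ c.1 x ≠ 0).card : ℝ)) ≤ 2 * exp (-(β * L ^ 2 * ε / (4 * ℓ))) := by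
  have hc2 := C2_ge
  have hβ0 : 0 < β := by linarith
  have hL0 : (0 : ℝ) < L := by exact_mod_cast hL
  have hℓ0 : (0 : ℝ) < ℓ := by exact_mod_cast hℓ
  have hs : 0 < β / (2 * ℓ) := by positivity
  have hε : 0 < ε := by linarith [exp_pos (-(β / 2 - C2))]
  refine (pr_tilt hβ (ray_Sq 1 L) (box L) (s := β / (2 * ℓ)) (n0 := 1) (M := β * L ^ 2 * ε / (8 * ℓ)) hs.le
    (fun c x => if En c ≤ ℓ ∧ tch c x then 1 else 0) (fun c x => by split_ifs <;> norm_num) (fun c x hc h => ?_) (fun c hc _ => ?_)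
    (by positivity) ?_ (β * L ^ 2 * ε / (2 * ℓ)) (fun η hη hA => ?_)).trans_eq (by congr 2; field_simp; ring)
  · by_cases ht : En c ≤ ℓ ∧ tch c x
    · have : (1 : ℝ) ≤ En c := by exact_mod_cast hc.pos
      simp [ht, this]
    · simp [ht] at h
  · rw [sum_boole]
    by_cases he : En c ≤ ℓ
    · simp only [he, true_and]
      have h2 : (((box L).filter (tch c)).card : ℝ) ≤ ℓ * En c := by
        exact_mod_cast (card_tch2 hc.1 (box L)).trans (Nat.mul_le_mul_right _ he)
      calc β / (2 * ℓ) * (((box L).filter (tch c)).card : ℝ) ≤ β / (2 * ℓ) * (ℓ * En c) := mul_le_mul_of_nonneg_left h2 hs.le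
        _ = _ := by field_simp
    · simp only [he, false_and, Finset.filter_false, Finset.card_empty, Nat.cast_zero, mul_zero]; positivity
  · have h1 : ((box L).card : ℝ) ≤ (L : ℝ) ^ 2 := by exact_mod_cast card_Sq (by simp)
    rw [mul_one]
    calc β / (2 * ℓ) * ((box L).card : ℝ) * exp (-(β / 2 - C2)) ≤ β / (2 * ℓ) * (L : ℝ) ^ 2 * (ε / 4) := by gcongr
      _ = _ := by field_simp; norm_num
  · have h1 : (((box L).filter fun x => ∃ c ∈ ClF (η, 0), En c ≤ ℓ ∧ c.1 x ≠ 0).card : ℝ) ≤ ∑ x ∈ box L, ∑ c ∈ ClF (η, 0), if En c ≤ ℓ ∧ tch c x then (1 : ℝ) else 0 := by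
      rw [← sum_boole]
      refine sum_le_sum fun x _ => ?_
      by_cases hx : ∃ c ∈ ClF (η, 0), En c ≤ ℓ ∧ c.1 x ≠ 0
      · rw [if_pos hx]
        obtain ⟨c, hc, hl, hcx⟩ := hx
        refine le_trans ?_ (single_le_sum (f := fun c => if En c ≤ ℓ ∧ tch c x then (1 : ℝ) else 0) (fun _ _ => by split_ifs <;> norm_num) hc)
        simp [show tch c x from Or.inl hcx, hl]
      · rw [if_neg hx]; exact sum_nonneg fun _ _ => by split_ifs <;> norm_num
    calc β * L ^ 2 * ε / (2 * ℓ) = β / (2 * ℓ) * (ε * L ^ 2) := by field_simp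
      _ ≤ _ := mul_le_mul_of_nonneg_left (le_trans hA h1) hs.le
lemma pr_Or {ι : Type} {β : ℝ} (hβ : 0 < β) {D : Finset Site} (s : Finset ι) {A : (Site → ℤ) → Prop} (B : ι → (Site → ℤ) → Prop)
    (h : ∀ η, Sp D η → A η → ∃ i ∈ s, B i η) : pr β D A ≤ ∑ i ∈ s, pr β D (B i) := by
  induction s using Finset.induction_on generalizing A with
  | empty =>
    rw [Finset.sum_empty]
    refine pr_le_of hβ le_rfl ?_
    rw [W, ENNReal.tsum_eq_zero.2 fun η => ?_]
    · exact zero_le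
    · by_cases hA : A η
      · by_cases hs : Sp D η
        · obtain ⟨i, hi, _⟩ := h η hs hA; simp at hi
        · rw [if_pos hA, wD, if_neg hs]
      · rw [if_neg hA]
  | insert i s hi ih =>
    rw [sum_insert hi]
    refine le_trans ?_ (add_le_add_right (ih (A := fun η => ∃ j ∈ s, B j η) fun η _ h => h) _)
    refine pr_or hβ fun η hs hA => ?_
    obtain ⟨j, hj, hb⟩ := h η hs hA
    rcases Finset.mem_insert.1 hj with rfl | q
    exacts [Or.inl hb, Or.inr ⟨j, q, hb⟩]
def RA (L ℓ : ℕ) (a : ℕ) : Finset ℤ := (Finset.Icc (1 + ℓ : ℤ) (L - ℓ)).filter fun z => z % ((2 * ℓ + 2 : ℕ) : ℤ) = a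
lemma mem_RA {L ℓ a : ℕ} {z : ℤ} : z ∈ RA L ℓ a ↔ (1 + ℓ ≤ z ∧ z ≤ L - ℓ) ∧ z % ((2 * ℓ + 2 : ℕ) : ℤ) = a := by simp [RA]
lemma RA_sep {L ℓ a : ℕ} {z w : ℤ} (hz : z ∈ RA L ℓ a) (hw : w ∈ RA L ℓ a) (h1 : z - (2 * ℓ + 1) ≤ w) (h2 : w ≤ z + (2 * ℓ + 1)) : z = w := by
  rw [mem_RA] at hz hw
  have : ((2 * ℓ + 2 : ℕ) : ℤ) ∣ z - w := Int.dvd_of_emod_eq_zero (Int.emod_eq_emod_iff_emod_sub_eq_zero.1 (hz.2.trans hw.2.symm))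
  have := Int.eq_zero_of_abs_lt_dvd this (by rw [abs_lt]; push_cast; constructor <;> omega)
  omega
def TA (L ℓ a : ℕ) : Finset ℤ := (RA L ℓ a).biUnion fun z => Finset.Icc (z - ℓ) (z + ℓ)
lemma lay (L ℓ : ℕ) (a : ℕ × ℕ) : Lay (box L) (TA L ℓ a.1 ×ˢ TA L ℓ a.2) (RA L ℓ a.1 ×ˢ RA L ℓ a.2) ℓ where
  rD := ray_prod _ _
  rD' := ray_prod _ _
  sub := fun x hx y hy => by
    simp only [mem_product, mem_RA] at hx
    rw [mem_Qb] at hy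
    rw [box_eq, mem_Sq]
    omega
  eq := fun y => by
    simp only [mem_product, TA, mem_biUnion, Finset.mem_Icc, mem_Qb]
    constructor
    · rintro ⟨⟨z, hz, h1⟩, w, hw, h2⟩
      exact ⟨(z, w), ⟨hz, hw⟩, h1, h2⟩
    · rintro ⟨x, ⟨hz, hw⟩, h1, h2⟩
      exact ⟨⟨_, hz, h1⟩, _, hw, h2⟩
  sep := fun x hx y hy h => by
    rw [mem_Qb] at h
    rw [mem_product] at hx hy
    push_cast at h
    exact Prod.ext (RA_sep hx.1 hy.1 h.1.1 h.1.2) (RA_sep hx.2 hy.2 h.2.1 h.2.2)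
lemma low_comb {β : ℝ} (hβ : 2 * C2 ≤ β) {L : ℕ} (hL : 1 ≤ L) (hℓ : 1 ≤ ell L) {ε : ℝ} (hδ : exp (-(β / 2 - C2)) ≤ ε / 16)
    (hM : β / 2 * L ^ 2 * exp (-(β / 2 - C2) * ell L) ≤ 1) (hb : 16 * (ell L : ℝ) ≤ ε * L) (H m t : ℕ)
    (hm : (m : ℝ) * (2 * ell L + 2) ^ 2 ≤ ε / 2 * L ^ 2) :
    pr β (box L) (fun η => (∀ x, 0 ≤ η x) ∧ ε * L ^ 2 ≤ (((box L).filter fun x => η x ≤ (H : ℤ) - 1).card : ℝ)) ≤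
      2 * exp (-(β * L ^ 2 * ε / (16 * ell L))) + (2 * ell L + 2) ^ 2 *
        ((1 / 2) ^ t + 2 * exp (2 - β / 2 * t) + 2 ^ (2 * t) * exp (-(pc β L H * m / 2))) := by
  have hc2 := C2_ge
  have hβ0 : 0 < β := by linarith
  have hL0 : (0 : ℝ) < L := by exact_mod_cast hL
  set ℓ := ell L with hl
  set G : Finset (ℕ × ℕ) := range (2 * ℓ + 2) ×ˢ range (2 * ℓ + 2) with hG
  have hGc : (G.card : ℝ) = (2 * ℓ + 2) ^ 2 := by rw [hG, Finset.card_product, Finset.card_range]; push_cast; ring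
  set X : ℕ × ℕ → Finset Site := fun a => RA L ℓ a.1 ×ˢ RA L ℓ a.2 with hX
  set B : ℕ × ℕ → (Site → ℤ) → Prop := fun a η => (∀ x, 0 ≤ η x) ∧ m ≤ ((X a).filter (Qs ℓ H η)).card with hB
  have h2 := sm_num hβ hL hℓ (ε := ε / 4) (by linarith)
  have e : β * L ^ 2 * (ε / 4) / (4 * ℓ) = β * L ^ 2 * ε / (16 * ℓ) := by field_simp; norm_num
  rw [e] at h2
  have h3 : pr β (box L) (fun η => ∃ a ∈ G, B a η) ≤ (2 * ℓ + 2) ^ 2 *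
        ((1 / 2) ^ t + 2 * exp (2 - β / 2 * t) + 2 ^ (2 * t) * exp (-(pc β L H * m / 2))) := by
    rw [← hGc, ← nsmul_eq_mul]
    refine (pr_Or hβ0 G B fun η _ h => h).trans (Finset.sum_le_card_nsmul _ _ _ fun a _ => ?_)
    refine (lay L ℓ a).main hβ (le_trans ?_ hM) H m t
    have : (X a).card ≤ L ^ 2 := le_trans (card_le_card fun x hx => (lay L ℓ a).sub x hx (by rw [mem_Qb]; omega)) (card_Sq (by simp) : (box L).card ≤ L ^ 2)
    have : ((X a).card : ℝ) ≤ L ^ 2 := by exact_mod_cast this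
    gcongr
  refine le_trans (pr_or hβ0 fun η hs hA => ?_) (add_le_add h2 h3)
  by_contra! hc
  obtain ⟨c1, c2⟩ := hc
  have c3 : ∀ a ∈ G, ((X a).filter (Qs ℓ H η)).card < m := fun a ha => by
    by_contra! h
    exact c2 a ha ⟨hA.1, h⟩
  set N := (Sq 1 L).filter fun x => ¬ Qb ℓ x ⊆ Sq 1 L
  set S := (box L).filter fun x => ∃ c ∈ ClF (η, 0), En c ≤ ℓ ∧ c.1 x ≠ 0
  have hsub : ((box L).filter fun x => η x ≤ (H : ℤ) - 1) ⊆ N ∪ S ∪ G.biUnion fun a => (X a).filter (Qs ℓ H η) := by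
    intro x hx
    rw [Finset.mem_filter] at hx
    by_contra hn
    simp only [Finset.mem_union, not_or] at hn
    obtain ⟨⟨n1, n2⟩, n3⟩ := hn
    have n1 : Qb ℓ x ⊆ Sq 1 L := by
      by_contra h; exact n1 (Finset.mem_filter.2 ⟨hx.1, h⟩)
    have q1 := n1 (show (x.1 - ℓ, x.2 - ℓ) ∈ Qb ℓ x by rw [mem_Qb]; simp only; omega)
    have q2 := n1 (show (x.1 + ℓ, x.2 + ℓ) ∈ Qb ℓ x by rw [mem_Qb]; simp only; omega)
    rw [mem_Sq] at q1 q2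
    simp only at q1 q2
    have g0 : (0 : ℤ) < ((2 * ℓ + 2 : ℕ) : ℤ) := by push_cast; omega
    have r : ∀ z : ℤ, (z % ((2 * ℓ + 2 : ℕ) : ℤ)).toNat < 2 * ℓ + 2 ∧ z % ((2 * ℓ + 2 : ℕ) : ℤ) = ((z % ((2 * ℓ + 2 : ℕ) : ℤ)).toNat : ℤ) := fun z => by
      have u1 := Int.emod_nonneg z g0.ne'
      have u2 := Int.emod_lt_of_pos z g0
      omega
    refine n3 (mem_biUnion.2 ⟨((x.1 % ((2 * ℓ + 2 : ℕ) : ℤ)).toNat, (x.2 % ((2 * ℓ + 2 : ℕ) : ℤ)).toNat), ?_, Finset.mem_filter.2 ⟨?_, hx.2, ?_⟩⟩)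
    · rw [hG, mem_product, Finset.mem_range, Finset.mem_range]; exact ⟨(r _).1, (r _).1⟩
    · rw [hX, mem_product, mem_RA, mem_RA]
      exact ⟨⟨by constructor <;> omega, (r _).2⟩, ⟨by constructor <;> omega, (r _).2⟩⟩
    · intro c hc he
      by_contra h0
      exact n2 (Finset.mem_filter.2 ⟨hx.1, c, hc, he, h0⟩)
  have k1 := (card_le_card hsub).trans ((card_union_le _ _).trans (Nat.add_le_add (card_union_le _ _) Finset.card_biUnion_le))
  have k2 : N.card ≤ 4 * (L * ℓ) := card_bd ℓ (by simp)
  have k3 : ((∑ a ∈ G, ((X a).filter (Qs ℓ H η)).card : ℕ) : ℝ) < m * (2 * ℓ + 2) ^ 2 := by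
    rw [← hGc, mul_comm, ← Nat.cast_mul, Nat.cast_lt]
    calc _ < ∑ a ∈ G, m := Finset.sum_lt_sum_of_nonempty ⟨(0, 0), by simp [hG]⟩ c3
      _ = _ := by simp
  have k1 : (((box L).filter fun x => η x ≤ (H : ℤ) - 1).card : ℝ) ≤ N.card + S.card + ((∑ a ∈ G, ((X a).filter (Qs ℓ H η)).card : ℕ) : ℝ) := by exact_mod_cast k1
  have k2 : (N.card : ℝ) ≤ 4 * (L * ℓ) := by exact_mod_cast k2
  have k4 := mul_le_mul_of_nonneg_left hb hL0.le
  have k5 := hA.2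
  have e3 : (L : ℝ) * (ε * L) = ε * L ^ 2 := by ring
  have e4 : (L : ℝ) * (16 * ℓ) = 16 * (L * ℓ) := by ring
  have e5 : ε / 4 * (L : ℝ) ^ 2 = ε * L ^ 2 / 4 := by ring
  have e6 : ε / 2 * (L : ℝ) ^ 2 = ε * L ^ 2 / 2 := by ring
  rw [e5] at c1
  linarith

lemma floor_lb {β : ℝ} (hβ : 2 * C2 ≤ β) : ∀ᶠ L : ℕ in atTop,
    exp (-(21 * β * L * log L ^ 2 + 2 * L ^ 2 * pc β L (HH β L + 1))) ≤ pr β (box L) (fun η => ∀ x, 0 ≤ η x) := by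
  have hc2 := C2_ge
  filter_upwards [HH_facts hβ, ev_cost hβ, tlog.eventually_ge_atTop 1] with L F C ha
  have h1 := (C 2 (L - 1) (by omega)).2
  have hH := F.2.2.2.1
  set a := log L
  have h2 := pr_floor hβ (ray_Sq 1 L) (D' := Sq 2 (L - 1)) (fun x hx => by rw [mem_Sq] at hx ⊢; omega)
    (fun e he => by obtain ⟨⟨p, q⟩, b⟩ := e; cases b <;> simp only [mem_Sq, nb] at he ⊢ <;> simp <;> omega)
    (fun e he => by obtain ⟨⟨p, q⟩, b⟩ := e; cases b <;> simp only [mem_Sq, nb] at he ⊢ <;> simp at he <;> omega) (H := HH β L)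
  have hn : (Sq 1 L \ Sq 2 (L - 1)).card ≤ 4 * (L * 1) := by
    refine le_trans (card_le_card fun x hx => ?_) (card_bd (u := 1) (v := L) (L := L) 1 (by simp))
    rw [Finset.mem_sdiff] at hx
    refine Finset.mem_filter.2 ⟨hx.1, fun hs => hx.2 ?_⟩
    have q1 := hs (show (x.1 - 1, x.2 - 1) ∈ Qb 1 x by rw [mem_Qb]; simp; omega)
    have q2 := hs (show (x.1 + 1, x.2 + 1) ∈ Qb 1 x by rw [mem_Qb]; simp; omega)
    rw [mem_Sq] at q1 q2 ⊢
    simp only at q1 q2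
    omega
  refine le_trans ?_ h2
  have hB : exp (-(4 * β * a ^ 2 + 1)) ≤ exp (-(4 * β) * (HH β L : ℝ) ^ 2) / 2 := by
    have e1 : exp (-(4 * β * a ^ 2 + 1)) = exp (-(4 * β * a ^ 2)) * exp (-1) := by rw [← exp_add]; ring_nf
    have e2 : exp (-1) ≤ 1 / 2 := by have := Real.exp_neg_one_lt_d9; linarith
    have e3 : (HH β L : ℝ) ^ 2 ≤ a ^ 2 := pow_le_pow_left₀ (Nat.cast_nonneg _) hH 2
    have e5 := mul_le_mul_of_nonneg_left e3 (by linarith : 0 ≤ 4 * β)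
    have e4 : exp (-(4 * β * a ^ 2)) ≤ exp (-(4 * β) * (HH β L : ℝ) ^ 2) := exp_le_exp.2 (by linarith)
    rw [e1, div_eq_mul_one_div]
    exact mul_le_mul e4 e2 (exp_pos _).le (exp_pos _).le
  have hB2 : exp (-(4 * β * a ^ 2 + 1)) ^ (4 * L) ≤ (exp (-(4 * β) * (HH β L : ℝ) ^ 2) / 2) ^ (Sq 1 L \ Sq 2 (L - 1)).card := by
    have e0 : 0 ≤ 4 * β * a ^ 2 := by have : 0 ≤ β := by linarith
                                      positivity
    refine le_trans (pow_le_pow_of_le_one (exp_pos _).le (Real.exp_le_one_iff.2 (by linarith)) (by omega : (Sq 1 L \ Sq 2 (L - 1)).card ≤ 4 * L)) (pow_le_pow_left₀ (exp_pos _).le hB _)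
  refine le_trans ?_ (mul_le_mul hB2 h1 (exp_pos _).le (by positivity))
  rw [← exp_nat_mul, ← exp_add, exp_le_exp]
  push_cast
  have hL0 : (0 : ℝ) ≤ L := Nat.cast_nonneg L
  have s1 : (1 : ℝ) ≤ a ^ 2 := one_le_pow₀ ha
  have s2 : (L : ℝ) * 1 ≤ L * a ^ 2 := mul_le_mul_of_nonneg_left s1 hL0
  have s3 : 1 * (L * a ^ 2) ≤ β * (L * a ^ 2) := mul_le_mul_of_nonneg_right (by linarith) (by positivity)
  have e1 : 4 * (L : ℝ) * -(4 * β * a ^ 2 + 1) = -(16 * (β * (L * a ^ 2))) - 4 * L := by ring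
  have e2 : 21 * β * L * a ^ 2 = 21 * (β * (L * a ^ 2)) := by ring
  rw [e1, e2]
  linarith
lemma bd_t {β q : ℝ} (hβ : 6 ≤ β) (hq : 0 ≤ q) : (1 / 2 : ℝ) ^ ⌊q / 8⌋₊ + 2 * exp (2 - β / 2 * (⌊q / 8⌋₊ : ℕ)) + 2 ^ (2 * ⌊q / 8⌋₊) * exp (-(q / 2)) ≤ 400 * exp (-(q / 16)) := by
  set t := ⌊q / 8⌋₊
  have t1 : (t : ℝ) ≤ q / 8 := Nat.floor_le (by positivity)
  have t2 : q / 8 < t + 1 := Nat.lt_floor_add_one _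
  have l1 := Real.log_two_gt_d9
  have l2 := Real.log_two_lt_d9
  have P := exp_pos (-(q / 16))
  have e0 : ∀ n : ℕ, (2 : ℝ) ^ n = exp (n * log 2) := fun n => by rw [exp_nat_mul, exp_log two_pos]
  have t0 : (0 : ℝ) ≤ t := Nat.cast_nonneg _
  have m1 := mul_le_mul_of_nonneg_left l1.le t0
  have m2 := mul_le_mul_of_nonneg_left l2.le t0
  have x1 := Real.exp_one_lt_d9
  have b1 : (1 / 2 : ℝ) ^ t ≤ 3 * exp (-(q / 16)) := by
    rw [one_div, inv_pow, e0, ← Real.exp_neg]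
    calc _ ≤ exp (1 + -(q / 16)) := exp_le_exp.2 (by linarith)
      _ = exp 1 * exp (-(q / 16)) := exp_add _ _
      _ ≤ _ := mul_le_mul_of_nonneg_right (by linarith) P.le
  have b2 : exp (2 - β / 2 * t) ≤ 150 * exp (-(q / 16)) := by
    have := mul_le_mul_of_nonneg_right hβ t0
    calc _ ≤ exp (((5 : ℕ) : ℝ) * 1 + -(q / 16)) := exp_le_exp.2 (by push_cast; linarith)
      _ = exp 1 ^ 5 * exp (-(q / 16)) := by rw [exp_add, exp_nat_mul]
      _ ≤ _ := by
        refine mul_le_mul_of_nonneg_right ((pow_le_pow_left₀ (exp_pos _).le x1.le 5).trans (by norm_num)) P.le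
  have b3 : (2 : ℝ) ^ (2 * t) * exp (-(q / 2)) ≤ exp (-(q / 16)) := by
    rw [e0, ← exp_add]
    refine exp_le_exp.2 ?_
    push_cast
    linarith
  linarith
set_option maxHeartbeats 800000 in
lemma lower {β : ℝ} (hβ : 2 * C2 + 2 ≤ β) {ε : ℝ} (hδ : exp (-(β / 2 - C2)) ≤ ε / 16) {κ : ℝ} (hκ : 0 < κ) : ∀ᶠ L : ℕ in atTop,
    pr β (box L) (fun η => (∀ x, 0 ≤ η x) ∧ ε * L ^ 2 ≤ (((box L).filter fun x => η x ≤ (HH β L : ℤ) - 1).card : ℝ)) ≤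
      κ * pr β (box L) (fun η => ∀ x, 0 ≤ η x) := by
  have hc2 := C2_ge
  have hε : 0 < ε := by linarith [exp_pos (-(β / 2 - C2))]
  have hβ' : 2 * C2 ≤ β := by linarith
  have T : Tendsto (fun L : ℕ => (L : ℝ)) atTop atTop := tendsto_natCast_atTop_atTop
  have E4 := T.eventually ((Real.isLittleO_pow_log_id_atTop (n := 4)).bound (c := ε / 300) (by positivity))
  filter_upwards [HH_facts hβ', floor_lb hβ', tlog.eventually_ge_atTop (max 10 β), tlog.eventually_ge_atTop (140000 * β / ε + 12800 / ε), eventually_ge_atTop 1,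
    T.eventually_ge_atTop (64000000 / (ε * κ)), T.eventually_ge_atTop 1, E4] with L F hfl ha ha2 hL1 hL2 hL E4
  obtain ⟨F1, F2, F3, F4, F5, F6⟩ := F
  have hE : exp (log L) = (L : ℝ) := exp_log (by linarith)
  have hl1 : log L ^ 2 ≤ (ell L : ℝ) := Nat.le_ceil _
  have hl2 : (ell L : ℝ) < log L ^ 2 + 1 := Nat.ceil_lt_add_one (by positivity)
  set a := log L with haD
  set p := pc β L (HH β L) with hp
  set p' := pc β L (HH β L + 1) with hp'
  have a10 : 10 ≤ a := (le_max_left _ _).trans ha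
  have aβ : β ≤ a := (le_max_right _ _).trans ha
  have a2 : 10 * 10 ≤ a ^ 2 := by rw [pow_two]; exact mul_le_mul a10 a10 (by norm_num) (by linarith)
  have hE4 : a ^ 4 ≤ ε / 300 * L := by
    simp only [id, Real.norm_eq_abs] at E4
    rwa [abs_of_nonneg (by positivity), abs_of_nonneg (by linarith)] at E4
  have a24 : a ^ 2 * 100 ≤ a ^ 4 := by
    have := mul_le_mul_of_nonneg_left a2 (by positivity : 0 ≤ a ^ 2)
    calc _ = a ^ 2 * (10 * 10) := by ring
      _ ≤ _ := this
      _ = _ := by ring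
  have p0 : 0 ≤ p := pc_nn _ _
  have p1 : p ≤ 1 := pr_le_one (by linarith)
  set g : ℝ := 2 * ell L + 2 with hg
  have g1 : g ≤ 3 * a ^ 2 := by rw [hg]; linarith
  have g0 : 1 ≤ g := by rw [hg]; linarith
  have g2 : g ^ 2 ≤ 9 * a ^ 4 := (pow_le_pow_left₀ (by linarith) g1 2).trans_eq (by ring)
  set m : ℕ := ⌊ε / 2 * L ^ 2 / g ^ 2⌋₊ with hm
  have g20 : 0 < g ^ 2 := by positivity
  have hm1 : (m : ℝ) ≤ ε / 2 * L ^ 2 / g ^ 2 := Nat.floor_le (by positivity)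
  have hm2 : ε / 2 * L ^ 2 / g ^ 2 < m + 1 := Nat.lt_floor_add_one _
  have hm3 : ε * L ^ 2 / (100 * a ^ 4) ≤ m := by
    have h1 : ε / 2 * L ^ 2 / (9 * a ^ 4) ≤ ε / 2 * L ^ 2 / g ^ 2 := by gcongr
    have h2 : ε / 2 * L ^ 2 / (9 * a ^ 4) = 100 / 18 * (ε * L ^ 2 / (100 * a ^ 4)) := by field_simp; norm_num
    have h3 : 1 ≤ ε * L ^ 2 / (100 * a ^ 4) := by
      rw [le_div_iff₀ (by positivity), one_mul]
      have : (L : ℝ) * 1 ≤ L * L := mul_le_mul_of_nonneg_left hL (by linarith)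
      have := mul_le_mul_of_nonneg_left this hε.le
      calc _ ≤ ε * (L * 1) := by linarith [mul_pos hε (by linarith : (0 : ℝ) < L)]
        _ ≤ _ := this
        _ = _ := by ring
    linarith
  set q := p * m with hq
  have q0 : 0 ≤ q := by positivity
  have c := low_comb hβ' hL1 (by have : (0 : ℝ) < ell L := by linarith
                                 exact_mod_cast this) hδ ?_ ?_ (HH β L) m ⌊q / 8⌋₊ ?_
  rotate_left
  · have z1 : -(β / 2 - C2) * ell L ≤ -(3 * a) := by
      have y1 : 1 * (ell L : ℝ) ≤ (β / 2 - C2) * ell L := mul_le_mul_of_nonneg_right (by linarith) (by positivity)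
      have y2 : 10 * a ≤ a ^ 2 := by rw [pow_two]; exact mul_le_mul_of_nonneg_right a10 (by linarith)
      linarith
    have z2 : β / 2 ≤ L := by have := add_one_le_exp a; linarith
    calc β / 2 * L ^ 2 * exp (-(β / 2 - C2) * ell L) ≤ L * L ^ 2 * exp (-(3 * a)) := by
          have := exp_le_exp.2 z1
          gcongr
      _ = 1 := by
          rw [← hE, ← exp_nat_mul, ← exp_add, ← exp_add]
          simp only [Real.exp_eq_one_iff]; push_cast; ring
  · have : 16 * (ell L : ℝ) ≤ 17 * a ^ 2 := by linarith
    have : 0 ≤ ε * L := by positivity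
    linarith
  · calc (m : ℝ) * g ^ 2 ≤ ε / 2 * L ^ 2 / g ^ 2 * g ^ 2 := mul_le_mul_of_nonneg_right hm1 g20.le
      _ = _ := by field_simp
  have k1 : exp (-(β * L ^ 2 * ε / (16 * ell L))) ≤ exp (-(q / 16)) := by
    refine exp_le_exp.2 (neg_le_neg ?_)
    have u1 : q ≤ 1 * (ε / 2 * L ^ 2 / g ^ 2) := mul_le_mul p1 hm1 (by positivity) (by norm_num)
    have u2 : (ell L : ℝ) ≤ g ^ 2 := by
      have : g * 1 ≤ g * g := mul_le_mul_of_nonneg_left g0 (by linarith)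
      rw [pow_two]; linarith
    have el : (0 : ℝ) < ell L := by linarith
    calc q / 16 ≤ (1 * (ε / 2 * L ^ 2 / g ^ 2)) / 16 := by linarith
      _ ≤ (1 * (ε / 2 * L ^ 2 / ell L)) / 16 := by gcongr
      _ = (1 / 2) * (L ^ 2 * ε / (16 * ell L)) := by field_simp
      _ ≤ β * (L ^ 2 * ε / (16 * ell L)) := mul_le_mul_of_nonneg_right (by linarith) (by positivity)
      _ = _ := by ring
  have k2 := bd_t (β := β) (by linarith) q0
  have P := exp_pos (-(q / 16))
  have k3 : pr β (box L) (fun η => (∀ x, 0 ≤ η x) ∧ ε * L ^ 2 ≤ (((box L).filter fun x => η x ≤ (HH β L : ℤ) - 1).card : ℝ)) ≤ 4000 * a ^ 4 * exp (-(q / 16)) := by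
    refine c.trans ?_
    have v1 := mul_le_mul g2 k2 (by positivity) (by positivity)
    have a41 : 1 ≤ a ^ 4 := by linarith
    have v2 := mul_le_mul_of_nonneg_right a41 P.le
    calc _ ≤ 2 * exp (-(q / 16)) + 9 * a ^ 4 * (400 * exp (-(q / 16))) := add_le_add (by linarith) v1
      _ ≤ _ := by linarith [v2]
  have L0 : (0 : ℝ) < L := by linarith
  have qA : p * (ε * L ^ 2 / (100 * a ^ 4)) ≤ q := mul_le_mul_of_nonneg_left hm3 p0
  have qB : ε * L * a ^ 4 / 100 ≤ q := by
    refine le_trans ?_ (le_trans (mul_le_mul_of_nonneg_right F1 (by positivity)) qA)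
    refine le_of_eq ?_
    field_simp
  have k4 : 2 * L ^ 2 * p' ≤ q / 64 := by
    have w1 : p' ≤ p / a ^ 16 := by rw [le_div_iff₀ (by positivity), mul_comm]; exact F2
    have w2 : 12800 ≤ ε * a ^ 12 := by
      have y1 : a ≤ a ^ 12 := le_self_pow₀ (by linarith) (by norm_num)
      have y2 : 12800 / ε ≤ a := by
        have : 0 ≤ 140000 * β / ε := div_nonneg (by linarith) hε.le
        linarith
      rw [div_le_iff₀ hε] at y2
      have := mul_le_mul_of_nonneg_left y1 hε.le
      linarith
    refine le_trans (mul_le_mul_of_nonneg_left w1 (by positivity)) (le_trans ?_ (div_le_div_of_nonneg_right qA (by norm_num)))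
    have : p * (ε * L ^ 2 / (100 * a ^ 4)) / 64 = (ε * a ^ 12) * (p * L ^ 2 / (6400 * a ^ 16)) := by field_simp; ring
    rw [this]
    refine le_trans (le_of_eq ?_) (mul_le_mul_of_nonneg_right w2 (by positivity))
    field_simp; ring
  have k5 : 21 * β * L * a ^ 2 ≤ q / 64 := by
    have y2 : 140000 * β / ε ≤ a := by
      have : 0 ≤ 12800 / ε := by positivity
      linarith
    rw [div_le_iff₀ hε] at y2
    have y3 : a * ε ≤ a ^ 2 * ε := mul_le_mul_of_nonneg_right (le_self_pow₀ (by linarith) (by norm_num)) hε.le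
    have y4 := mul_le_mul_of_nonneg_right (y2.trans y3) (by positivity : 0 ≤ L * a ^ 2)
    have e1 : a ^ 2 * ε * (L * a ^ 2) = ε * L * a ^ 4 := by ring
    have e2 : 140000 * β * (L * a ^ 2) = 140000 * (β * L * a ^ 2) := by ring
    have e3 : 0 ≤ β * L * a ^ 2 := by have : 0 ≤ β := by linarith
                                      positivity
    rw [e1, e2] at y4
    have e4 : 21 * β * L * a ^ 2 = 21 * (β * L * a ^ 2) := by ring
    rw [e4]
    linarith
  have k6 : exp (-(q / 32)) ≤ pr β (box L) (fun η => ∀ x, 0 ≤ η x) := le_trans (exp_le_exp.2 (by linarith)) hfl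
  refine k3.trans (le_trans ?_ (mul_le_mul_of_nonneg_left k6 hκ.le))
  have e1 : exp (-(q / 16)) = exp (-(q / 32)) * exp (-(q / 32)) := by rw [← exp_add]; ring_nf
  rw [e1, ← mul_assoc]
  refine mul_le_mul_of_nonneg_right ?_ (exp_pos _).le
  rw [Real.exp_neg, ← div_eq_mul_inv, div_le_iff₀ (exp_pos _)]
  have h1 := add_one_le_exp (q / 32)
  have h2 : ε * L * a ^ 4 / 3200 ≤ exp (q / 32) := by linarith
  refine le_trans ?_ (mul_le_mul_of_nonneg_left h2 hκ.le)
  rw [div_le_iff₀ (by positivity)] at hL2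
  have := mul_le_mul_of_nonneg_right hL2 (by positivity : 0 ≤ a ^ 4)
  have e2 : L * (ε * κ) * a ^ 4 = κ * (ε * L * a ^ 4 / 3200) * 3200 := by ring
  rw [e2] at this
  have : 0 ≤ a ^ 4 := by positivity
  linarith

lemma dgW_eq {β : ℝ} (hβ : 0 < β) (D : Finset Site) (A : (Site → ℤ) → Prop) : dgW β D A = (W β D A).toReal := by
  rw [dgW, W, ENNReal.tsum_toReal_eq fun η => ?_]
  · refine tsum_congr fun η => ?_
    by_cases hs : Sp D η
    · by_cases hA : A η
      · rw [if_pos ⟨hs, hA⟩, if_pos hA, wD, if_pos hs, dgH_eq hs.fs, ex, ENNReal.toReal_ofReal (exp_pos _).le]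
      · rw [if_neg fun h => hA h.2, if_neg hA]; rfl
    · rw [if_neg fun h => hs h.1, wD, if_neg hs]; simp
  · split_ifs
    · unfold wD; split_ifs
      exacts [ex_ne_top _, ENNReal.zero_ne_top]
    · exact ENNReal.zero_ne_top
lemma floor_eq {β : ℝ} (hβ : 0 < β) (D : Finset Site) (A : (Site → ℤ) → Prop) :
    dgProbFloor β D A = pr β D (fun η => A η ∧ ∀ x, 0 ≤ η x) / pr β D (fun η => ∀ x, 0 ≤ η x) := by
  rw [dgProbFloor, dgW_eq hβ, dgW_eq hβ, pr, pr, ENNReal.toReal_div, ENNReal.toReal_div, div_div_div_cancel_right₀]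
  exact ENNReal.toReal_ne_zero.2 ⟨Z_ne_zero _ _, Z_ne_top hβ _⟩

theorem dg_floor_two_point_height (ε : ℝ) (hε : 0 < ε) :
    ∃ β₀ > (0 : ℝ), ∀ β ≥ β₀, ∃ H : ℕ → ℕ,
      (∀ L, 0 < H L) ∧
      Tendsto (fun L : ℕ =>
          (H L : ℝ) /
            Real.sqrt ((1 / (4 * Real.pi * β)) * Real.log L * Real.log (Real.log L)))
        atTop (𝓝 1) ∧
      Tendsto (fun L : ℕ =>
          dgProbFloor β (box L) fun η =>
            (1 - ε) * (L : ℝ) ^ 2 ≤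
              (((box L).filter fun v => η v = (H L : ℤ) ∨ η v = (H L : ℤ) + 1).card : ℝ))
        atTop (𝓝 1) := by
  have hc2 := C2_ge
  have h64 : 0 < 64 / ε := by positivity
  refine ⟨2 * C2 + 2 + 64 / ε, by linarith, fun β hβ => ?_⟩
  have hβ : 2 * C2 + 2 + 64 / ε ≤ β := hβ
  have hβ' : 2 * C2 ≤ β := by linarith
  have hβ0 : 0 < β := by linarith
  have hδ : Real.exp (-(β / 2 - C2)) ≤ ε / 32 := by
    rw [Real.exp_neg, inv_le_comm₀ (Real.exp_pos _) (by positivity), inv_div]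
    have := Real.add_one_le_exp (β / 2 - C2)
    have e : 64 / ε = 2 * (32 / ε) := by ring
    linarith
  refine ⟨HH β, HH_pos β, HH_lim hβ', ?_⟩
  rw [Metric.tendsto_nhds]
  intro κ hκ
  filter_upwards [floor_lb hβ', upper hβ' (ε := ε / 2) (by linarith) (κ := κ / 4) (by positivity),
    lower (by linarith : 2 * C2 + 2 ≤ β) (ε := ε / 2) (by linarith) (κ := κ / 4) (by positivity)] with L h1 h2 h3
  have hp := lt_of_lt_of_le (Real.exp_pos _) h1
  rw [floor_eq hβ0]
  have h4 : pr β (box L) (fun η => ((1 - ε) * (L : ℝ) ^ 2 ≤ (((box L).filter fun v => η v = (HH β L : ℤ) ∨ η v = (HH β L : ℤ) + 1).card : ℝ)) ∧ ∀ x, 0 ≤ η x) ≤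
      pr β (box L) (fun η => ∀ x, 0 ≤ η x) := pr_mono hβ0 fun η _ h => h.2
  have h5 : pr β (box L) (fun η => ∀ x, 0 ≤ η x) ≤
      pr β (box L) (fun η => ((1 - ε) * (L : ℝ) ^ 2 ≤ (((box L).filter fun v => η v = (HH β L : ℤ) ∨ η v = (HH β L : ℤ) + 1).card : ℝ)) ∧ ∀ x, 0 ≤ η x) +
      (κ / 4 * pr β (box L) (fun η => ∀ x, 0 ≤ η x) + κ / 4 * pr β (box L) (fun η => ∀ x, 0 ≤ η x)) := by
    refine le_trans (pr_or hβ0 (C := fun η => ((∀ x, 0 ≤ η x) ∧ ε / 2 * L ^ 2 ≤ (((box L).filter fun x => (HH β L : ℤ) + 2 ≤ η x).card : ℝ)) ∨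
      ((∀ x, 0 ≤ η x) ∧ ε / 2 * L ^ 2 ≤ (((box L).filter fun x => η x ≤ (HH β L : ℤ) - 1).card : ℝ))) fun η _ hA => ?_)
      (add_le_add_right ((pr_or hβ0 fun η _ h => h).trans (add_le_add h2 h3)) _)
    by_contra! hc
    have c1 := lt_of_not_ge fun h => (hc.1 h).elim fun x hx => absurd (hA x) (not_le.2 hx)
    have c2 := hc.2.1 hA
    have c3 := hc.2.2 hA
    have hsub : box L ⊆ ((box L).filter fun v => η v = (HH β L : ℤ) ∨ η v = (HH β L : ℤ) + 1) ∪ (((box L).filter fun x => (HH β L : ℤ) + 2 ≤ η x) ∪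
        ((box L).filter fun x => η x ≤ (HH β L : ℤ) - 1)) := by
      intro x hx
      simp only [Finset.mem_union, Finset.mem_filter, hx, true_and]
      omega
    have k := (Finset.card_le_card hsub).trans ((Finset.card_union_le _ _).trans (Nat.add_le_add_left (Finset.card_union_le _ _) _))
    have hb : (box L).card = L ^ 2 := by simp [box, pow_two]
    rw [hb] at k
    have k : ((L : ℝ) ^ 2) ≤ (((box L).filter fun v => η v = (HH β L : ℤ) ∨ η v = (HH β L : ℤ) + 1).card : ℝ) + ((((box L).filter fun x => (HH β L : ℤ) + 2 ≤ η x).card : ℝ) +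
        (((box L).filter fun x => η x ≤ (HH β L : ℤ) - 1).card : ℝ)) := by exact_mod_cast k
    linarith
  rw [Real.dist_eq, abs_sub_comm, abs_of_nonneg (by rw [sub_nonneg]; exact div_le_one_of_le₀ h4 hp.le), sub_lt_comm, lt_div_iff₀ hp]
  have := mul_pos hκ hp
  linarith
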